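/- arXiv:2108.10100 — 6 statements merged into one kernel-verified Lean document; each statement's English description precedes it below -/
import Mathlib

section
/- Let f be a log-concave probability density on ℝⁿ. Then the function p ↦ pⁿ·∫_{ℝⁿ} f(x)^p dx is log-concave on (0,∞), i.e. p ↦ n·log p + log(∫ f^p) is a concave function of p on (0,∞). -/
open MeasureTheory Real
open scoped Classical

/-- A function `f : ℝⁿ → ℝ` is log-concave if `f = e^{-V}` for some convex
`V : ℝⁿ → (-∞, +∞]`, encoded as a real-valued convex function `V` on a convex set `s`
(with `V = +∞`, i.e. `f = 0`, outside `s`). -/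
def IsLogConcaveFnN {n : ℕ} (f : EuclideanSpace ℝ (Fin n) → ℝ) : Prop :=
  ∃ (s : Set (EuclideanSpace ℝ (Fin n))) (V : EuclideanSpace ℝ (Fin n) → ℝ),
    ConvexOn ℝ s V ∧ ∀ x, f x = if x ∈ s then Real.exp (-V x) else 0

open scoped ENNReal Pointwise

theorem ennreal_rpow_ne_zero (x : ℝ≥0∞) (a : ℝ) (ha : 0 < a) (hx : x ≠ 0) : x ^ a ≠ 0 := by
  simp [ENNReal.rpow_eq_zero_iff, hx, ha, ha.not_gt]

theorem bm_compact (K L C : Set ℝ) (hK : IsCompact K) (hL : IsCompact L)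
    (hKn : K.Nonempty) (hLn : L.Nonempty)
    (h : ∀ x ∈ K, ∀ y ∈ L, x + y ∈ C) : volume K + volume L ≤ volume C := by
  obtain ⟨u, hu⟩ := hK.exists_isGreatest hKn
  obtain ⟨v, hv⟩ := hL.exists_isLeast hLn
  have e1 : volume ((fun x => -v + x) ⁻¹' K) = volume K := measure_preimage_add volume _ _
  have e2 : volume ((fun x => -u + x) ⁻¹' L) = volume L := measure_preimage_add volume _ _
  rw [← e1, ← e2, ← measure_union₀]
  · apply measure_mono
    rintro z (hz | hz)
    · have := h _ hz v hv.1
      simpa using this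
    · have := h u hu.1 _ hz
      simpa using this
  · exact (hL.measurableSet.preimage (measurable_const_add _)).nullMeasurableSet
  · refine measure_mono_null (t := {u + v}) ?_ (by simp)
    rintro z ⟨hz1, hz2⟩
    have h1 := hu.2 hz1
    have h2 := hv.2 hz2
    simp only [Set.mem_singleton_iff]
    linarith

theorem bm_meas (A B C : Set ℝ) (hA : MeasurableSet A) (hB : MeasurableSet B)
    (hAn : A.Nonempty) (hBn : B.Nonempty)
    (h : ∀ x ∈ A, ∀ y ∈ B, x + y ∈ C) : volume A + volume B ≤ volume C := by
  obtain ⟨a, ha⟩ := hAn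
  obtain ⟨b, hb⟩ := hBn
  refine le_of_forall_lt fun r hr => ?_
  obtain ⟨r1, hr1, r2, hr2, hr⟩ : ∃ K, (K ⊆ A ∧ IsCompact K) ∧ ∃ L, (L ⊆ B ∧ IsCompact L) ∧
      r < volume K + volume L := by
    have e : ∀ A : Set ℝ, (⨆ K, ⨆ (_ : K ⊆ A), ⨆ (_ : IsCompact K), volume K) =
        ⨆ K, ⨆ (_ : K ⊆ A ∧ IsCompact K), volume K := by
      intro A; simp only [iSup_and]
    rw [hA.measure_eq_iSup_isCompact, hB.measure_eq_iSup_isCompact, e, e] at hr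
    by_contra! hc
    refine absurd hr (not_lt.2 ?_)
    refine ENNReal.biSup_add_biSup_le' (p := fun K => K ⊆ A ∧ IsCompact K)
      (q := fun L => L ⊆ B ∧ IsCompact L) ⟨∅, by simp⟩ ⟨∅, by simp⟩ ?_
    intro K hK L hL
    exact hc K hK L hL
  refine hr.trans_le ((add_le_add (measure_mono (Set.subset_insert a r1))
    (measure_mono (Set.subset_insert b r2))).trans ?_)
  apply bm_compact _ _ _ (hr1.2.insert a) (hr2.2.insert b) (by simp) (by simp)
  intro x hx y hy
  apply h
  · rcases hx with rfl | hx
    exacts [ha, hr1.1 hx]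
  · rcases hy with rfl | hy
    exacts [hb, hr2.1 hy]

theorem bm_weighted (a b : ℝ) (ha : 0 < a) (hb : 0 < b) (A B C : Set ℝ)
    (hA : MeasurableSet A) (hB : MeasurableSet B)
    (hAn : A.Nonempty) (hBn : B.Nonempty)
    (h : ∀ x ∈ A, ∀ y ∈ B, a * x + b * y ∈ C) :
    ENNReal.ofReal a * volume A + ENNReal.ofReal b * volume B ≤ volume C := by
  have e1 : ENNReal.ofReal a * volume A = volume (a • A) := by
    rw [Measure.addHaar_smul]; simp [abs_of_pos ha]
  have e2 : ENNReal.ofReal b * volume B = volume (b • B) := by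
    rw [Measure.addHaar_smul]; simp [abs_of_pos hb]
  rw [e1, e2]
  apply bm_meas _ _ _ (hA.const_smul₀ a) (hB.const_smul₀ b) (hAn.smul_set) (hBn.smul_set)
  rintro _ ⟨x, hx, rfl⟩ _ ⟨y, hy, rfl⟩
  exact h x hx y hy

theorem pl_real (a b : ℝ) (ha : 0 < a) (hb : 0 < b) (F G H : ℝ → ℝ)
    (hF : Measurable F) (hG : Measurable G) (hH : Measurable H)
    (hF0 : ∀ x, 0 ≤ F x) (hG0 : ∀ x, 0 ≤ G x) (hH0 : ∀ x, 0 ≤ H x)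
    (hF1 : ∀ x, F x ≤ 1) (hG1 : ∀ x, G x ≤ 1)
    (hFs : ∀ t < 1, ∃ x, t < F x) (hGs : ∀ t < 1, ∃ x, t < G x)
    (h : ∀ x y, min (F x) (G y) ≤ H (a * x + b * y)) :
    ENNReal.ofReal a * (∫⁻ x, ENNReal.ofReal (F x)) + ENNReal.ofReal b * (∫⁻ x, ENNReal.ofReal (G x))
      ≤ ∫⁻ x, ENNReal.ofReal (H x) := by
  rw [lintegral_eq_lintegral_meas_lt volume (.of_forall hF0) hF.aemeasurable,
    lintegral_eq_lintegral_meas_lt volume (.of_forall hG0) hG.aemeasurable,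
    lintegral_eq_lintegral_meas_lt volume (.of_forall hH0) hH.aemeasurable]
  have mF : Measurable fun t : ℝ => volume {x | t < F x} :=
    Antitone.measurable fun s t hst => measure_mono fun x hx => lt_of_le_of_lt hst hx
  rw [← lintegral_const_mul' _ _ ENNReal.ofReal_ne_top,
    ← lintegral_const_mul' _ _ ENNReal.ofReal_ne_top,
    ← lintegral_add_left (mF.const_mul _)]
  apply lintegral_mono
  intro t
  rcases lt_or_ge t 1 with ht | ht
  · apply bm_weighted a b ha hb _ _ _ (measurableSet_lt measurable_const hF)
      (measurableSet_lt measurable_const hG) (hFs t ht) (hGs t ht)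
    intro x hx y hy
    exact lt_of_lt_of_le (lt_min hx hy) (h x y)
  · have e1 : {x | t < F x} = ∅ := by
      ext x; simpa using (hF1 x).trans ht
    have e2 : {x | t < G x} = ∅ := by
      ext x; simpa using (hG1 x).trans ht
    simp [e1, e2]

theorem ennreal_amgm (a b : ℝ) (ha : 0 < a) (hb : 0 < b) (hab : a + b = 1) (x y : ℝ≥0∞) :
    x ^ a * y ^ b ≤ ENNReal.ofReal a * x + ENNReal.ofReal b * y := by
  by_cases hx : x = ∞
  · simp [hx, ENNReal.mul_top, ha]
  by_cases hy : y = ∞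
  · simp [hy, ENNReal.mul_top, hb]
  lift x to NNReal using hx
  lift y to NNReal using hy
  lift a to NNReal using ha.le
  lift b to NNReal using hb.le
  rw [← ENNReal.coe_rpow_of_nonneg _ a.coe_nonneg, ← ENNReal.coe_rpow_of_nonneg _ b.coe_nonneg]
  simp only [ENNReal.ofReal_coe_nnreal]
  exact_mod_cast NNReal.geom_mean_le_arith_mean2_weighted a b x y (by exact_mod_cast hab)

theorem ennreal_min_le (a b : ℝ) (ha : 0 < a) (hb : 0 < b) (hab : a + b = 1) (x y : ℝ≥0∞) :
    min x y ≤ x ^ a * y ^ b := by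
  calc min x y = min x y ^ a * min x y ^ b := by
        rw [← ENNReal.rpow_add_of_nonneg _ _ ha.le hb.le, hab, ENNReal.rpow_one]
    _ ≤ _ := by
        gcongr
        · exact min_le_left _ _
        · exact min_le_right _ _

def PLProp (E : Type*) [AddCommGroup E] [Module ℝ E] [MeasureSpace E] (a b : ℝ) : Prop :=
  ∀ f g h : E → ℝ≥0∞, Measurable f → Measurable g → Measurable h →
    (∀ x y, f x ^ a * g y ^ b ≤ h (a • x + b • y)) →
    (∫⁻ x, f x) ^ a * (∫⁻ x, g x) ^ b ≤ ∫⁻ x, h x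

theorem pl_bdd (a b : ℝ) (ha : 0 < a) (hb : 0 < b) (hab : a + b = 1)
    (f g h : ℝ → ℝ≥0∞) (hf : Measurable f) (hg : Measurable g) (hh : Measurable h)
    (k : ℝ≥0∞) (hk : k ≠ ∞) (hfk : ∀ x, f x ≤ k) (hgk : ∀ x, g x ≤ k)
    (H : ∀ x y, f x ^ a * g y ^ b ≤ h (a • x + b • y)) :
    (∫⁻ x, f x) ^ a * (∫⁻ x, g x) ^ b ≤ ∫⁻ x, h x := by
  set A := ⨆ x, f x with hA
  set B := ⨆ x, g x with hB
  have hAt : A ≠ ∞ := ne_top_of_le_ne_top hk (iSup_le hfk)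
  have hBt : B ≠ ∞ := ne_top_of_le_ne_top hk (iSup_le hgk)
  by_cases hA0 : A = 0
  · have : ∀ x, f x = 0 := by simpa [hA] using hA0
    simp [this, ha]
  by_cases hB0 : B = 0
  · have : ∀ x, g x = 0 := by simpa [hB] using hB0
    simp [this, hb]
  set C := A ^ a * B ^ b with hC
  have hC0 : C ≠ 0 := by
    simp only [hC]
    exact mul_ne_zero (ennreal_rpow_ne_zero _ _ ha hA0) (ennreal_rpow_ne_zero _ _ hb hB0)
  have hCt : C ≠ ∞ := by
    simp only [hC]
    refine ENNReal.mul_ne_top ?_ ?_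
    · exact ENNReal.rpow_ne_top_of_nonneg ha.le hAt
    · exact ENNReal.rpow_ne_top_of_nonneg hb.le hBt
  have f1 : ∀ x, f x / A ≤ 1 := fun x => ENNReal.div_le_of_le_mul (by simpa using le_iSup f x)
  have g1 : ∀ x, g x / B ≤ 1 := fun x => ENNReal.div_le_of_le_mul (by simpa using le_iSup g x)
  have ft : ∀ x, f x / A ≠ ∞ := fun x => ne_top_of_le_ne_top (by simp) (f1 x)
  have gt : ∀ x, g x / B ≠ ∞ := fun x => ne_top_of_le_ne_top (by simp) (g1 x)
  have ht : ∀ x, min (h x / C) 1 ≠ ∞ := fun x => ne_top_of_le_ne_top (by simp) (min_le_right _ _)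
  have key := pl_real a b ha hb (fun x => (f x / A).toReal) (fun x => (g x / B).toReal)
    (fun x => (min (h x / C) 1).toReal) (hf.div_const A).ennreal_toReal
    (hg.div_const B).ennreal_toReal ((hh.div_const C).min measurable_const).ennreal_toReal
    (fun _ => ENNReal.toReal_nonneg) (fun _ => ENNReal.toReal_nonneg)
    (fun _ => ENNReal.toReal_nonneg)
    (fun x => ENNReal.toReal_le_of_le_ofReal (by simp) (by simpa using f1 x))
    (fun x => ENNReal.toReal_le_of_le_ofReal (by simp) (by simpa using g1 x))
    ?_ ?_ ?_
  · simp only [ENNReal.ofReal_toReal (ft _), ENNReal.ofReal_toReal (gt _),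
      ENNReal.ofReal_toReal (ht _)] at key
    have key2 := (ennreal_amgm a b ha hb hab _ _).trans
      (key.trans (lintegral_mono fun x => min_le_left (h x / C) 1))
    simp only [div_eq_mul_inv] at key2
    rw [lintegral_mul_const _ hf, lintegral_mul_const _ hg, lintegral_mul_const _ hh,
      ← div_eq_mul_inv (∫⁻ x, h x), ENNReal.le_div_iff_mul_le (.inl hC0) (.inl hCt),
      ENNReal.mul_rpow_of_nonneg _ _ ha.le, ENNReal.mul_rpow_of_nonneg _ _ hb.le] at key2
    refine le_trans (le_of_eq ?_) key2
    have e1 : (A⁻¹) ^ a * A ^ a = 1 := by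
      rw [← ENNReal.mul_rpow_of_nonneg _ _ ha.le, ENNReal.inv_mul_cancel hA0 hAt, ENNReal.one_rpow]
    have e2 : (B⁻¹) ^ b * B ^ b = 1 := by
      rw [← ENNReal.mul_rpow_of_nonneg _ _ hb.le, ENNReal.inv_mul_cancel hB0 hBt, ENNReal.one_rpow]
    calc _ = (∫⁻ x, f x) ^ a * (∫⁻ x, g x) ^ b * ((A⁻¹) ^ a * A ^ a) * ((B⁻¹) ^ b * B ^ b) := by
          rw [e1, e2]; simp
      _ = _ := by rw [hC]; ring
  · intro t ht1
    have : ENNReal.ofReal t * A < A := by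
      conv_rhs => rw [← one_mul A]
      rw [ENNReal.mul_lt_mul_iff_left hA0 hAt]
      simpa using ht1
    obtain ⟨x, hx⟩ := lt_iSup_iff.1 this
    refine ⟨x, ?_⟩
    rw [← ENNReal.lt_div_iff_mul_lt (.inl hA0) (.inl hAt)] at hx
    have ht2 : ENNReal.ofReal (max t 0) < _ := lt_of_eq_of_lt (by simp) hx
    exact (le_max_left t 0).trans_lt
      ((ENNReal.ofReal_lt_iff_lt_toReal (le_max_right _ _) (ft x)).1 ht2)
  · intro t ht1
    have : ENNReal.ofReal t * B < B := by
      conv_rhs => rw [← one_mul B]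
      rw [ENNReal.mul_lt_mul_iff_left hB0 hBt]
      simpa using ht1
    obtain ⟨x, hx⟩ := lt_iSup_iff.1 this
    refine ⟨x, ?_⟩
    rw [← ENNReal.lt_div_iff_mul_lt (.inl hB0) (.inl hBt)] at hx
    have ht2 : ENNReal.ofReal (max t 0) < _ := lt_of_eq_of_lt (by simp) hx
    exact (le_max_left t 0).trans_lt
      ((ENNReal.ofReal_lt_iff_lt_toReal (le_max_right _ _) (gt x)).1 ht2)
  · intro x y
    rw [← ENNReal.toReal_min (ft x) (gt y)]
    refine ENNReal.toReal_mono (ht _) (le_min ?_ ((min_le_left _ _).trans (f1 x)))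
    refine (ennreal_min_le a b ha hb hab _ _).trans ?_
    rw [ENNReal.div_rpow_of_nonneg _ _ ha.le, ENNReal.div_rpow_of_nonneg _ _ hb.le,
      ENNReal.le_div_iff_mul_le (.inl hC0) (.inl hCt)]
    refine le_trans (le_of_eq ?_) (H x y)
    have e1 : (A ^ a)⁻¹ * A ^ a = 1 := ENNReal.inv_mul_cancel (ennreal_rpow_ne_zero _ _ ha hA0)
      (ENNReal.rpow_ne_top_of_nonneg ha.le hAt)
    have e2 : (B ^ b)⁻¹ * B ^ b = 1 := ENNReal.inv_mul_cancel (ennreal_rpow_ne_zero _ _ hb hB0)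
      (ENNReal.rpow_ne_top_of_nonneg hb.le hBt)
    calc _ = f x ^ a * g y ^ b * ((A ^ a)⁻¹ * A ^ a) * ((B ^ b)⁻¹ * B ^ b) := by
          rw [hC, div_eq_mul_inv, div_eq_mul_inv]; ring
      _ = _ := by rw [e1, e2]; simp

theorem lintegral_trunc (f : ℝ → ℝ≥0∞) (hf : Measurable f) :
    Filter.Tendsto (fun k : ℕ => ∫⁻ x, min (f x) k) Filter.atTop (nhds (∫⁻ x, f x)) := by
  apply lintegral_tendsto_of_tendsto_of_monotone
  · exact fun k => (hf.min measurable_const).aemeasurable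
  · refine .of_forall fun x k l hkl => ?_
    exact min_le_min le_rfl (by exact_mod_cast hkl)
  · refine .of_forall fun x => ?_
    have := (tendsto_const_nhds (x := f x)).min ENNReal.tendsto_nat_nhds_top
    simpa using this

theorem pl_one (a b : ℝ) (ha : 0 < a) (hb : 0 < b) (hab : a + b = 1) : PLProp ℝ a b := by
  intro f g h hf hg hh H
  by_cases hf0 : ∫⁻ x, f x = 0
  · simp [hf0, ha]
  by_cases hg0 : ∫⁻ x, g x = 0
  · simp [hg0, hb]
  have t1 := (ENNReal.continuous_rpow_const (y := a)).continuousAt.tendsto.comp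
    (lintegral_trunc f hf)
  have t2 := (ENNReal.continuous_rpow_const (y := b)).continuousAt.tendsto.comp
    (lintegral_trunc g hg)
  have t3 := ENNReal.Tendsto.mul t1 (.inl (ennreal_rpow_ne_zero _ _ ha hf0)) t2
    (.inl (ennreal_rpow_ne_zero _ _ hb hg0))
  refine le_of_tendsto' t3 fun k => ?_
  refine pl_bdd a b ha hb hab _ _ h (hf.min measurable_const) (hg.min measurable_const) hh k
    (by simp) (fun x => min_le_right _ _) (fun x => min_le_right _ _) ?_
  intro x y
  refine le_trans ?_ (H x y)
  gcongr
  · exact min_le_left _ _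
  · exact min_le_left _ _

theorem pl_prod (E F : Type*) [AddCommGroup E] [Module ℝ E] [MeasureSpace E]
    [AddCommGroup F] [Module ℝ F] [MeasureSpace F] [SFinite (volume : Measure F)] (a b : ℝ)
    (hE : PLProp E a b) (hF : PLProp F a b) : PLProp (E × F) a b := by
  intro f g h hf hg hh H
  rw [Measure.volume_eq_prod, lintegral_prod _ hf.aemeasurable, lintegral_prod _ hg.aemeasurable,
    lintegral_prod _ hh.aemeasurable]
  apply hE _ _ _ hf.lintegral_prod_right' hg.lintegral_prod_right' hh.lintegral_prod_right'
  intro x y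
  apply hF _ _ _ (hf.comp measurable_prodMk_left) (hg.comp measurable_prodMk_left)
    (hh.comp measurable_prodMk_left)
  intro u v
  exact H (x, u) (y, v)

theorem pl_transfer (E F : Type*) [AddCommGroup E] [Module ℝ E] [MeasureSpace E]
    [AddCommGroup F] [Module ℝ F] [MeasureSpace F] (a b : ℝ) (e : E ≃ᵐ F)
    (he : MeasurePreserving e volume volume)
    (hl : ∀ x y, e (a • x + b • y) = a • e x + b • e y)
    (hE : PLProp E a b) : PLProp F a b := by
  intro f g h hf hg hh H
  rw [← he.lintegral_comp hf, ← he.lintegral_comp hg, ← he.lintegral_comp hh]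
  apply hE _ _ _ (hf.comp e.measurable) (hg.comp e.measurable) (hh.comp e.measurable)
  intro x y
  simp only [Function.comp, hl]
  exact H _ _

theorem pl_pi (a b : ℝ) (ha : 0 < a) (hb : 0 < b) (hab : a + b = 1) (n : ℕ) :
    PLProp (Fin n → ℝ) a b := by
  induction n with
  | zero =>
    intro f g h hf hg hh H
    rw [Measure.volume_pi_eq_dirac, lintegral_dirac, lintegral_dirac, lintegral_dirac]
    convert H _ _ using 2
  | succ n ih =>
    have e := MeasurableEquiv.piFinSuccAbove (fun _ : Fin (n + 1) => ℝ) 0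
    refine pl_transfer _ _ a b (MeasurableEquiv.piFinSuccAbove (fun _ : Fin (n + 1) => ℝ) 0).symm
      (volume_preserving_piFinSuccAbove (fun _ : Fin (n + 1) => ℝ) 0).symm ?_
      (pl_prod _ _ a b (pl_one a b ha hb hab) ih)
    intro x y
    rw [MeasurableEquiv.symm_apply_eq]
    rfl

theorem pl_euclidean (a b : ℝ) (ha : 0 < a) (hb : 0 < b) (hab : a + b = 1) (n : ℕ) :
    PLProp (EuclideanSpace ℝ (Fin n)) a b := by
  refine pl_transfer _ _ a b (MeasurableEquiv.toLp 2 (Fin n → ℝ))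
    (PiLp.volume_preserving_toLp (Fin n)) ?_ (pl_pi a b ha hb hab n)
  intro x y
  rfl

theorem scaled_integral (n : ℕ) (p : ℝ) (hp : 0 < p) (F : EuclideanSpace ℝ (Fin n) → ℝ≥0∞)
    (hF : Measurable F) :
    ∫⁻ y, F (p⁻¹ • y) = ENNReal.ofReal (p ^ n) * ∫⁻ x, F x := by
  have := lintegral_map (μ := volume) hF (measurable_const_smul (p⁻¹))
  rw [← this, Measure.map_addHaar_smul _ (inv_ne_zero hp.ne'), lintegral_smul_measure]
  simp [abs_of_pos hp]

theorem lc_pointwise {n : ℕ} {f : EuclideanSpace ℝ (Fin n) → ℝ} (hlc : IsLogConcaveFnN f)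
    (a b : ℝ) (ha : 0 < a) (hb : 0 < b) (hab : a + b = 1) (x y : EuclideanSpace ℝ (Fin n)) :
    f x ^ a * f y ^ b ≤ f (a • x + b • y) := by
  obtain ⟨s, V, hV, hf⟩ := hlc
  have hnn : 0 ≤ f (a • x + b • y) := by rw [hf]; split_ifs <;> positivity
  by_cases hx : x ∈ s
  · by_cases hy : y ∈ s
    · rw [hf, hf y, hf (a • x + b • y), if_pos hx, if_pos hy, if_pos (hV.1 hx hy ha.le hb.le hab),
        ← Real.exp_mul, ← Real.exp_mul, ← Real.exp_add, Real.exp_le_exp]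
      have := hV.2 hx hy ha.le hb.le hab
      simp only [smul_eq_mul] at this
      linarith
    · rw [hf y, if_neg hy, Real.zero_rpow hb.ne', mul_zero]; exact hnn
  · rw [hf x, if_neg hx, Real.zero_rpow ha.ne', zero_mul]; exact hnn

theorem main_ineq (n : ℕ) (f : EuclideanSpace ℝ (Fin n) → ℝ)
    (hmeas : Measurable f) (hnonneg : ∀ x, 0 ≤ f x) (hlc : IsLogConcaveFnN f)
    (p q a b : ℝ) (hp : 0 < p) (hq : 0 < q) (ha : 0 < a) (hb : 0 < b) (hab : a + b = 1) :
    (ENNReal.ofReal (p ^ n) * ∫⁻ x, ENNReal.ofReal (f x ^ p)) ^ a *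
    (ENNReal.ofReal (q ^ n) * ∫⁻ x, ENNReal.ofReal (f x ^ q)) ^ b ≤
    ENNReal.ofReal ((a * p + b * q) ^ n) * ∫⁻ x, ENNReal.ofReal (f x ^ (a * p + b * q)) := by
  have hr : 0 < a * p + b * q := by positivity
  have hm : ∀ r : ℝ, Measurable fun x => ENNReal.ofReal (f x ^ r) := fun r =>
    (hmeas.pow_const r).ennreal_ofReal
  rw [← scaled_integral n p hp _ (hm p), ← scaled_integral n q hq _ (hm q),
    ← scaled_integral n _ hr _ (hm _)]
  apply pl_euclidean a b ha hb hab n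
  · exact (hm p).comp (measurable_const_smul _)
  · exact (hm q).comp (measurable_const_smul _)
  · exact (hm _).comp (measurable_const_smul _)
  intro x y
  set r := a * p + b * q with hrdef
  have n1 := hnonneg (p⁻¹ • x)
  have n2 := hnonneg (q⁻¹ • y)
  rw [ENNReal.ofReal_rpow_of_nonneg (by positivity) ha.le,
    ENNReal.ofReal_rpow_of_nonneg (by positivity) hb.le, ← ENNReal.ofReal_mul (by positivity)]
  apply ENNReal.ofReal_le_ofReal
  have key := lc_pointwise hlc (a * p / r) (b * q / r) (by positivity) (by positivity)
    (by rw [← add_div, div_self hr.ne']) (p⁻¹ • x) (q⁻¹ • y)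
  have e : (a * p / r) • p⁻¹ • x + (b * q / r) • q⁻¹ • y = r⁻¹ • (a • x + b • y) := by
    rw [smul_smul, smul_smul, smul_add, smul_smul, smul_smul]
    congr 2 <;> field_simp
  rw [e] at key
  have := Real.rpow_le_rpow (by positivity) key hr.le
  rw [Real.mul_rpow (by positivity) (by positivity), ← Real.rpow_mul n1, ← Real.rpow_mul n2,
    div_mul_cancel₀ _ hr.ne', div_mul_cancel₀ _ hr.ne'] at this
  rwa [← Real.rpow_mul n1, ← Real.rpow_mul n2, mul_comm p, mul_comm q]

theorem J_pos (n : ℕ) (f : EuclideanSpace ℝ (Fin n) → ℝ)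
    (hmeas : Measurable f) (hnonneg : ∀ x, 0 ≤ f x) (hint : ∫ x, f x = 1) (p : ℝ) (hp : 0 < p) :
    ∫⁻ x, ENNReal.ofReal (f x ^ p) ≠ 0 := by
  intro h0
  rw [lintegral_eq_zero_iff (hmeas.pow_const p).ennreal_ofReal] at h0
  have : f =ᵐ[volume] 0 := by
    filter_upwards [h0] with x hx
    simp only [Pi.zero_apply, ENNReal.ofReal_eq_zero] at hx
    by_contra hne
    have hpos : 0 < f x := lt_of_le_of_ne (hnonneg x) (Ne.symm hne)
    exact absurd hx (not_le.2 (Real.rpow_pos_of_pos hpos p))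
  rw [integral_congr_ae this] at hint
  simp at hint

theorem J_fin (n : ℕ) (f : EuclideanSpace ℝ (Fin n) → ℝ)
    (hmeas : Measurable f) (hnonneg : ∀ x, 0 ≤ f x) (hint : ∫ x, f x = 1)
    (hlc : IsLogConcaveFnN f) (p : ℝ) (hp : 0 < p) :
    ∫⁻ x, ENNReal.ofReal (f x ^ p) ≠ ∞ := by
  intro htop
  have hI : Integrable f := by
    by_contra hc
    rw [integral_undef hc] at hint
    simp at hint
  have h1 : ∫⁻ x, ENNReal.ofReal (f x) = 1 := by
    rw [← ofReal_integral_eq_lintegral_ofReal hI (.of_forall hnonneg), hint]; simp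
  obtain ⟨q, a, b, hq, ha, hb, hab, e⟩ : ∃ q a b : ℝ, 0 < q ∧ 0 < a ∧ 0 < b ∧ a + b = 1 ∧
      a * p + b * q = 1 := by
    have hp1 : 0 < p + 1 := by positivity
    refine ⟨1 / p, 1 / (p + 1), p / (p + 1), by positivity,
      by positivity, by positivity, ?_, ?_⟩
    · field_simp; ring
    · field_simp
  have key := main_ineq n f hmeas hnonneg hlc p q a b hp hq ha hb hab
  rw [e, htop] at key
  simp only [Real.rpow_one, h1] at key
  have hpn : ENNReal.ofReal (p ^ n) ≠ 0 := by simp; positivity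
  have hqn : ENNReal.ofReal (q ^ n) ≠ 0 := by simp; positivity
  rw [ENNReal.mul_top hpn, ENNReal.top_rpow_of_pos ha, ENNReal.top_mul] at key
  · simp at key
  · have := mul_ne_zero hqn (J_pos n f hmeas hnonneg hint q hq)
    simp only [ne_eq, ENNReal.rpow_eq_zero_iff, this, hb.not_gt]
    simp

/-- For a log-concave probability density `f` on `ℝⁿ`, the map `p ↦ pⁿ·∫ f^p` is
log-concave on `(0,∞)`, i.e. `p ↦ n·log p + log ∫ f^p` is concave on `(0,∞)`. -/
theorem logConcave_rpow_integral
    (n : ℕ) (f : EuclideanSpace ℝ (Fin n) → ℝ)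
    (hmeas : Measurable f) (hnonneg : ∀ x, 0 ≤ f x) (hint : ∫ x, f x = 1)
    (hlc : IsLogConcaveFnN f) :
    ConcaveOn ℝ (Set.Ioi (0 : ℝ))
      (fun p => n * Real.log p + Real.log (∫ x, f x ^ p)) := by
  have hJ : ∀ r : ℝ, ∫ x, f x ^ r = (∫⁻ x, ENNReal.ofReal (f x ^ r)).toReal := fun r =>
    integral_eq_lintegral_of_nonneg_ae (.of_forall fun x => Real.rpow_nonneg (hnonneg x) r)
      (hmeas.pow_const r).aestronglyMeasurable
  have hpos : ∀ r : ℝ, 0 < r → 0 < ∫ x, f x ^ r := fun r hr => by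
    rw [hJ]
    exact ENNReal.toReal_pos (J_pos n f hmeas hnonneg hint r hr)
      (J_fin n f hmeas hnonneg hint hlc r hr)
  rw [concaveOn_iff_forall_pos]
  refine ⟨convex_Ioi 0, ?_⟩
  intro p hp q hq a b ha hb hab
  simp only [Set.mem_Ioi] at hp hq
  simp only [smul_eq_mul]
  have hr : 0 < a * p + b * q := by positivity
  have key := main_ineq n f hmeas hnonneg hlc p q a b hp hq ha hb hab
  have key2 := ENNReal.toReal_mono (ENNReal.mul_ne_top ENNReal.ofReal_ne_top
    (J_fin n f hmeas hnonneg hint hlc _ hr)) key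
  simp only [ENNReal.toReal_mul, ← ENNReal.toReal_rpow, ← hJ] at key2
  rw [ENNReal.toReal_ofReal (by positivity), ENNReal.toReal_ofReal (by positivity),
    ENNReal.toReal_ofReal (by positivity)] at key2
  have pp := hpos p hp
  have pq := hpos q hq
  have pr := hpos _ hr
  have key3 := Real.log_le_log (by positivity) key2
  rw [Real.log_mul (by positivity) (by positivity), Real.log_rpow (by positivity),
    Real.log_rpow (by positivity), Real.log_mul (by positivity) (by positivity),
    Real.log_mul (by positivity) (by positivity), Real.log_mul (by positivity) (by positivity),
    Real.log_pow, Real.log_pow, Real.log_pow] at key3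
  exact key3
end

section
/- Let f(x) = Σ_{n=0}^∞ a_n xⁿ be a power series converging for every x ≥ 0. Suppose there is a nonnegative integer N such that a_n ≥ 0 for n < N and a_n ≤ 0 for n ≥ N, and suppose at least one coefficient is strictly positive and at least one is strictly negative. Then there exists x₀ > 0 such that f(x) > 0 for all x ∈ (0, x₀) and f(x) < 0 for all x ∈ (x₀, ∞). -/
theorem pow_cross_aux {x y : ℝ} (hx : 0 < x) (hxy : x ≤ y) {n k : ℕ} (h : n ≤ k) :
    y ^ n * x ^ k ≤ x ^ n * y ^ k := by
  obtain ⟨d, rfl⟩ := Nat.exists_eq_add_of_le h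
  have h1 : x ^ d ≤ y ^ d := pow_le_pow_left₀ hx.le hxy d
  have h2 : 0 < x ^ n * y ^ n := by have := hx.trans_le hxy; positivity
  rw [pow_add, pow_add]
  nlinarith [mul_le_mul_of_nonneg_left h1 h2.le]

theorem key_aux (a : ℕ → ℝ)
    (hconv : ∀ x : ℝ, 0 ≤ x → Summable (fun n => a n * x ^ n))
    (N : ℕ) (hpos : ∀ n, n < N → 0 ≤ a n) (hneg : ∀ n, N ≤ n → a n ≤ 0)
    (k : ℕ) (hk : k ≤ N) (hk' : N ≤ k + 1) {x y : ℝ} (hx : 0 < x) (hxy : x ≤ y) (i : ℕ) :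
    a i * (x ^ i * y ^ k - y ^ i * x ^ k) ≤
      y ^ k * (∑' n, a n * x ^ n) - x ^ k * (∑' n, a n * y ^ n) := by
  have h1 := ((hconv x hx.le).hasSum.mul_left (y ^ k)).sub
    ((hconv y (hx.le.trans hxy)).hasSum.mul_left (x ^ k))
  have h2 := le_hasSum h1 i (by
    intro j _
    rcases lt_or_ge j N with h | h
    · have := mul_nonneg (hpos j h) (sub_nonneg.2 (pow_cross_aux hx hxy (show j ≤ k by omega)))
      linarith
    · have := mul_nonneg (neg_nonneg.2 (hneg j h))
        (sub_nonneg.2 (pow_cross_aux hx hxy (show k ≤ j by omega)))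
      linarith)
  linarith

/-- Let `f(x) = Σ aₙ xⁿ` be a power series converging for every `x ≥ 0`. If there is `N`
such that `aₙ ≥ 0` for `n < N` and `aₙ ≤ 0` for `n ≥ N`, and at least one coefficient is
strictly positive and at least one strictly negative, then there is `x₀ > 0` such that
`f > 0` on `(0, x₀)` and `f < 0` on `(x₀, ∞)`. -/
theorem powerSeries_single_sign_change
    (a : ℕ → ℝ)
    (hconv : ∀ x : ℝ, 0 ≤ x → Summable (fun n => a n * x ^ n))
    (N : ℕ) (hpos : ∀ n, n < N → 0 ≤ a n) (hneg : ∀ n, N ≤ n → a n ≤ 0)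
    (hsomepos : ∃ n, 0 < a n) (hsomeneg : ∃ n, a n < 0) :
    ∃ x₀ > (0 : ℝ),
      (∀ x : ℝ, 0 < x → x < x₀ → 0 < ∑' n, a n * x ^ n) ∧
      (∀ x : ℝ, x₀ < x → ∑' n, a n * x ^ n < 0) := by
  obtain ⟨p, hp⟩ := hsomepos
  obtain ⟨m, hm⟩ := hsomeneg
  have hpN : p < N := by
    by_contra h
    linarith [hneg p (not_lt.1 h)]
  have hmN : N ≤ m := by
    by_contra h
    linarith [hpos m (not_le.1 h)]
  have key := key_aux a hconv N hpos hneg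
  set f : ℝ → ℝ := fun x => ∑' n, a n * x ^ n with hf
  change ∀ k : ℕ, k ≤ N → N ≤ k + 1 → ∀ {x y : ℝ}, 0 < x → x ≤ y → ∀ i : ℕ,
    a i * (x ^ i * y ^ k - y ^ i * x ^ k) ≤ y ^ k * f x - x ^ k * f y at key
  change ∃ x₀ > (0 : ℝ), (∀ x : ℝ, 0 < x → x < x₀ → 0 < f x) ∧ (∀ x : ℝ, x₀ < x → f x < 0)
  have mono : ∀ x y : ℝ, 0 < x → x < y → x ^ N * f y < y ^ N * f x := by
    intro x y hx hxy
    have h := key N le_rfl (by omega) hx hxy.le p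
    have hy := hx.trans hxy
    obtain ⟨d, rfl⟩ := Nat.exists_eq_add_of_lt hpN
    have h1 : x ^ (d + 1) < y ^ (d + 1) := pow_lt_pow_left₀ hxy hx.le (by omega)
    have h2 : 0 < a p * (x ^ p * y ^ p) * (y ^ (d + 1) - x ^ (d + 1)) :=
      mul_pos (by positivity) (by linarith)
    have h3 : a p * (x ^ p * y ^ (p + d + 1) - y ^ p * x ^ (p + d + 1))
      = a p * (x ^ p * y ^ p) * (y ^ (d + 1) - x ^ (d + 1)) := by ring
    linarith
  -- positive somewhere
  have hne : ∃ x, 0 < x ∧ 0 < f x := by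
    have hD : 0 < a p + |f 1| + 1 := by positivity
    refine ⟨a p / (a p + |f 1| + 1), by positivity, ?_⟩
    set x := a p / (a p + |f 1| + 1) with hxd
    have hx : 0 < x := by positivity
    have hx1 : x ≤ 1 := by
      rw [hxd, div_le_one hD]; linarith [abs_nonneg (f 1)]
    have hxe : x * (a p + |f 1| + 1) = a p := by rw [hxd]; field_simp
    have h := key N le_rfl (by omega) hx hx1 p
    simp only [one_pow, mul_one, one_mul] at h
    obtain ⟨d, rfl⟩ := Nat.exists_eq_add_of_lt hpN
    have hz : x ^ (d + 1) ≤ x := pow_le_of_le_one hx.le hx1 (by omega)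
    have hz0 : 0 < x ^ (d + 1) := by positivity
    have h4 : 0 < a p * (1 - x ^ (d + 1)) + x ^ (d + 1) * f 1 := by
      have := neg_abs_le (f 1)
      nlinarith [mul_le_mul_of_nonneg_right hz (show 0 ≤ a p + |f 1| by positivity),
        mul_le_mul_of_nonneg_left this hz0.le]
    have h5 := mul_pos (pow_pos hx p) h4
    have h6 : x ^ (p + d + 1) = x ^ p * x ^ (d + 1) := by ring
    rw [h6] at h
    linarith
  -- bounded
  have hbd : ∃ B, ∀ x, 0 < x → 0 < f x → x ≤ B := by
    refine ⟨1 + |f 1| / (- a m), ?_⟩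
    intro x hx hfx
    by_contra hB
    push Not at hB
    have hq : 0 ≤ |f 1| / (- a m) := div_nonneg (abs_nonneg _) (by linarith)
    have hx1 : 1 ≤ x := by linarith
    have h := key (N - 1) (by omega) (by omega) one_pos hx1 m
    simp only [one_pow, mul_one, one_mul] at h
    have h1 : |f 1| < (x - 1) * (- a m) := by
      rw [← div_lt_iff₀ (by linarith)]; linarith
    obtain ⟨d, hd⟩ := Nat.exists_eq_add_of_lt (show N - 1 < m by omega)
    have hz : x ≤ x ^ (d + 1) := le_self_pow₀ hx1 (by omega)
    have h4 : f 1 + a m * (x ^ (d + 1) - 1) < 0 := by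
      have := le_abs_self (f 1)
      nlinarith [mul_le_mul_of_nonneg_right hz (show 0 ≤ - a m by linarith)]
    have h5 := mul_neg_of_pos_of_neg (pow_pos hx (N - 1)) h4
    have h6 : x ^ m = x ^ (N - 1) * x ^ (d + 1) := by
      rw [← pow_add]; congr 1
    rw [h6] at h
    linarith
  obtain ⟨w, hw, hfw⟩ := hne
  obtain ⟨B, hB⟩ := hbd
  have bdd : BddAbove {x | 0 < x ∧ 0 < f x} := ⟨B, fun x hx => hB x hx.1 hx.2⟩
  have hx0 : 0 < sSup {x | 0 < x ∧ 0 < f x} := lt_of_lt_of_le hw (le_csSup bdd (show w ∈ {x | 0 < x ∧ 0 < f x} from ⟨hw, hfw⟩))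
  refine ⟨sSup {x | 0 < x ∧ 0 < f x}, hx0, ?_, ?_⟩
  · intro x hx hlt
    obtain ⟨y, ⟨hy, hfy⟩, hxy⟩ := exists_lt_of_lt_csSup (s := {x | 0 < x ∧ 0 < f x}) ⟨w, hw, hfw⟩ hlt
    have h1 := mono x y hx hxy
    have h2 : 0 < x ^ N * f y := by positivity
    exact pos_of_mul_pos_right (h2.trans h1) (by positivity)
  · intro x hlt
    obtain ⟨z, hz0, hzx⟩ := exists_between hlt
    have hz : 0 < z := hx0.trans hz0
    have hfz : f z ≤ 0 := by
      by_contra h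
      exact absurd (le_csSup bdd (show z ∈ {x | 0 < x ∧ 0 < f x} from ⟨hz, not_le.1 h⟩)) (not_le.2 hz0)
    have h1 := mono z x hz hzx
    have h2 : x ^ N * f z ≤ 0 := mul_nonpos_of_nonneg_of_nonpos (by have := hz.trans hzx; positivity) hfz
    by_contra h
    have : 0 ≤ z ^ N * f x := mul_nonneg (by positivity) (not_lt.1 h)
    linarith
end

section
/- Define G(a,b,α) = 2·(aα + 1 − e^{−αb})^{2/(1−α)}·(a + 1 − e^{−b})^{(1−3α)/(1−α)} − (a³/3 + ∫₀ᵇ (x+a)²·e^{−x} dx). Let α* be the unique solution in (1,∞) of (1/(α−1))·log α = (1/2)·log 6. Then G(a,b,α*) ≥ 0 for all a, b ≥ 0. -/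
open MeasureTheory Real intervalIntegral

/-- The function `G(a,b,α)` from the paper:
`G(a,b,α) = 2·(aα + 1 − e^{−αb})^{2/(1−α)}·(a + 1 − e^{−b})^{(1−3α)/(1−α)}
  − (a³/3 + ∫₀ᵇ (x+a)²·e^{−x} dx)`. -/
noncomputable def G (a b α : ℝ) : ℝ :=
  2 * (a * α + 1 - Real.exp (-(α * b))) ^ (2 / (1 - α)) *
      (a + 1 - Real.exp (-b)) ^ ((1 - 3 * α) / (1 - α)) -
    (a ^ 3 / 3 + ∫ x in (0 : ℝ)..b, (x + a) ^ 2 * Real.exp (-x))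


noncomputable def sF (b : ℝ) : ℝ := 1 - Real.exp (-b)
noncomputable def tF (α b : ℝ) : ℝ := (1 - Real.exp (-(α * b))) / α
noncomputable def m1F (b : ℝ) : ℝ := 1 - Real.exp (-b) * (b + 1)
noncomputable def m2F (b : ℝ) : ℝ := 2 - Real.exp (-b) * (b ^ 2 + 2 * b + 2)
/-- `U = 3 V`, where `V` is the second moment. -/
noncomputable def UF (a b : ℝ) : ℝ := a ^ 3 + 3 * sF b * a ^ 2 + 6 * m1F b * a + 3 * m2F b
/-- logarithmic form of the inequality. -/
noncomputable def LF (α p a b : ℝ) : ℝ :=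
  (3 + p) * Real.log (a + sF b) - p * Real.log (a + tF α b) - Real.log (UF a b)
/-- the numerator of the derivative of `LF` with respect to `a`. -/
noncomputable def NF (α p b a : ℝ) : ℝ :=
  (6 * a * (2 * m1F b - sF b ^ 2) + 3 * (3 * m2F b - 2 * m1F b * sF b)) * (a + tF α b)
    - p * (sF b - tF α b) * UF a b
noncomputable def kF (α p b : ℝ) : ℝ := (p + 2) * sF b - (p + 3) * tF α b

lemma hd_conv {f g : ℝ → ℝ} {f' g' x : ℝ} (h : HasDerivAt f f' x) (e : ∀ y, g y = f y)
    (e' : g' = f') : HasDerivAt g g' x := by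
  have e0 : g = f := funext e
  rw [e', e0]; exact h

lemma exp_neg_hasDeriv (b : ℝ) : HasDerivAt (fun b : ℝ => Real.exp (-b)) (-Real.exp (-b)) b := by
  simpa using (hasDerivAt_neg b).exp

lemma sF_deriv (b : ℝ) : HasDerivAt sF (Real.exp (-b)) b := by
  exact hd_conv ((exp_neg_hasDeriv b).const_sub 1) (fun y => rfl) (by ring)

lemma tF_deriv {α : ℝ} (hα : 1 < α) (b : ℝ) : HasDerivAt (tF α) (Real.exp (-(α * b))) b := by
  have h : HasDerivAt (fun b : ℝ => -(α * b)) (-(α * 1)) b := ((hasDerivAt_id b).const_mul α).neg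
  have h2 := ((h.exp).const_sub 1).div_const α
  exact hd_conv h2 (fun y => rfl) (by field_simp)

lemma m1F_deriv (b : ℝ) : HasDerivAt m1F (b * Real.exp (-b)) b := by
  have h := ((exp_neg_hasDeriv b).mul ((hasDerivAt_id b).add_const 1)).const_sub 1
  exact hd_conv h (fun y => rfl) (by simp; ring)

lemma m2F_deriv (b : ℝ) : HasDerivAt m2F (b ^ 2 * Real.exp (-b)) b := by
  have h0 : HasDerivAt (fun b : ℝ => b ^ 2 + 2 * b + 2) (2 * b + 2) b := by
    have := (((hasDerivAt_id b).pow 2).add ((hasDerivAt_id b).const_mul 2)).add_const (2 : ℝ)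
    simpa using this
  have h := ((exp_neg_hasDeriv b).mul h0).const_sub 2
  exact hd_conv h (fun y => rfl) (by ring)

lemma sF_zero : sF 0 = 0 := by simp [sF]
lemma tF_zero (α : ℝ) : tF α 0 = 0 := by simp [tF]
lemma m1F_zero : m1F 0 = 0 := by simp [m1F]
lemma m2F_zero : m2F 0 = 0 := by simp [m2F]

lemma sF_pos {b : ℝ} (hb : 0 < b) : 0 < sF b := by
  have : Real.exp (-b) < 1 := by rw [Real.exp_lt_one_iff]; linarith
  unfold sF; linarith

lemma sF_nonneg {b : ℝ} (hb : 0 ≤ b) : 0 ≤ sF b := by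
  have : Real.exp (-b) ≤ 1 := by rw [Real.exp_le_one_iff]; linarith
  unfold sF; linarith

lemma tF_pos {α b : ℝ} (hα : 1 < α) (hb : 0 < b) : 0 < tF α b := by
  have : Real.exp (-(α * b)) < 1 := by
    rw [Real.exp_lt_one_iff]; have : 0 < α * b := by positivity
    linarith
  unfold tF; apply div_pos <;> linarith

lemma tF_nonneg {α b : ℝ} (hα : 1 < α) (hb : 0 ≤ b) : 0 ≤ tF α b := by
  rcases hb.eq_or_lt with h | h
  · rw [← h, tF_zero]
  · exact (tF_pos hα h).le

lemma exp_mul_neg (b : ℝ) : Real.exp (-b) * Real.exp b = 1 := by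
  rw [← Real.exp_add]; simp

lemma m1F_nonneg (b : ℝ) : 0 ≤ m1F b := by
  have h := Real.add_one_le_exp b
  have h2 := exp_mul_neg b
  have h3 := Real.exp_pos (-b)
  unfold m1F
  nlinarith

lemma cubic_lt_exp {b : ℝ} (hb : 0 < b) : 1 + b + b ^ 2 / 2 < Real.exp b := by
  have h := Real.sum_le_exp_of_nonneg hb.le 4
  simp [Finset.sum_range_succ, Nat.factorial] at h
  have : 0 < b ^ 3 := by positivity
  nlinarith

lemma m2F_pos {b : ℝ} (hb : 0 < b) : 0 < m2F b := by
  have h := cubic_lt_exp hb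
  have h2 := exp_mul_neg b
  have h3 := Real.exp_pos (-b)
  unfold m2F
  nlinarith

lemma m2F_nonneg {b : ℝ} (hb : 0 ≤ b) : 0 ≤ m2F b := by
  rcases hb.eq_or_lt with h | h
  · rw [← h, m2F_zero]
  · exact (m2F_pos h).le

lemma sq_le_m1F {b : ℝ} (hb : 0 ≤ b) : sF b ^ 2 ≤ 2 * m1F b := by
  have h := Real.self_le_sinh_iff.2 hb
  rw [Real.sinh_eq] at h
  have h2 := exp_mul_neg b
  have h3 := Real.exp_pos (-b)
  unfold m1F sF
  nlinarith

/-- strict Bernoulli is not needed. -/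
lemma tF_le_sF {α b : ℝ} (hα : 1 < α) : tF α b ≤ sF b := by
  have h := one_add_mul_self_le_rpow_one_add (s := Real.exp (-b) - 1) (by linarith [Real.exp_pos (-b)]) hα.le
  have e : (1 + (Real.exp (-b) - 1)) ^ α = Real.exp (-(α * b)) := by
    rw [add_sub_cancel, ← Real.exp_mul]; ring_nf
  rw [e] at h
  unfold tF sF
  rw [div_le_iff₀ (by linarith)]
  nlinarith

lemma cross_le {α b : ℝ} (hα : 1 < α) :
    Real.exp (-(α * b)) * sF b ≤ Real.exp (-b) * tF α b := by
  have h := one_add_mul_self_le_rpow_one_add (s := Real.exp b - 1) (by linarith [Real.exp_pos b]) hα.le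
  have e : (1 + (Real.exp b - 1)) ^ α = Real.exp (α * b) := by
    rw [add_sub_cancel, ← Real.exp_mul]; ring_nf
  rw [e] at h
  have h2 := exp_mul_neg b
  have h4 := exp_mul_neg (α * b)
  have h3 := Real.exp_pos (-b)
  have h5 := Real.exp_pos (-(α * b))
  unfold tF sF
  rw [mul_div_assoc', le_div_iff₀ (by linarith)]
  have h6 := mul_le_mul_of_nonneg_left h (mul_pos h3 h5).le
  have e1 : Real.exp (-b) * Real.exp (-(α * b)) * (1 + α * (Real.exp b - 1))
     = Real.exp (-(α * b)) * (α * (Real.exp (-b) * Real.exp b) + Real.exp (-b) - α * Real.exp (-b)) := by ring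
  have e2 : Real.exp (-b) * Real.exp (-(α * b)) * Real.exp (α * b)
     = Real.exp (-b) * (Real.exp (-(α * b)) * Real.exp (α * b)) := by ring
  rw [e1, e2, h2, h4] at h6
  nlinarith

lemma UF_pos {a b : ℝ} (ha : 0 ≤ a) (hb : 0 ≤ b) (hab : 0 < a + b) : 0 < UF a b := by
  have h1 := sF_nonneg hb
  have h2 := m1F_nonneg b
  have h3 := m2F_nonneg hb
  unfold UF
  rcases ha.eq_or_lt with h | h
  · have hb' : 0 < b := by linarith
    have := m2F_pos hb'
    positivity
  · positivity

lemma A_pos {a b : ℝ} (ha : 0 ≤ a) (hb : 0 ≤ b) (hab : 0 < a + b) : 0 < a + sF b := by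
  have h1 := sF_nonneg hb
  rcases ha.eq_or_lt with h | h
  · have := sF_pos (show 0 < b by linarith)
    linarith
  · linarith

lemma M_pos {α a b : ℝ} (hα : 1 < α) (ha : 0 ≤ a) (hb : 0 ≤ b) (hab : 0 < a + b) :
    0 < a + tF α b := by
  have h1 := tF_nonneg hα hb
  rcases ha.eq_or_lt with h | h
  · have := tF_pos hα (show 0 < b by linarith)
    linarith
  · linarith

/-- derivative in `a`. -/
lemma LF_deriv_a {α p a b : ℝ} (hα : 1 < α) (ha : 0 ≤ a) (hb : 0 ≤ b) (hab : 0 < a + b) :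
    HasDerivAt (fun a => LF α p a b) (NF α p b a / ((a + sF b) * (a + tF α b) * UF a b)) a := by
  have hA := A_pos ha hb hab
  have hM := M_pos hα ha hb hab
  have hU := UF_pos ha hb hab
  have d1 := (((hasDerivAt_id a).add_const (sF b)).log hA.ne').const_mul (3 + p)
  have d2 := (((hasDerivAt_id a).add_const (tF α b)).log hM.ne').const_mul p
  have d0 : HasDerivAt (fun a => UF a b) (3 * a ^ 2 + 6 * sF b * a + 6 * m1F b) a := by
    have := ((((hasDerivAt_id a).pow 3).add (((hasDerivAt_id a).pow 2).const_mul (3 * sF b))).add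
      ((hasDerivAt_id a).const_mul (6 * m1F b))).add_const (3 * m2F b)
    exact hd_conv this (fun y => by simp [UF]) (by simp; ring)
  have d3 := d0.log hU.ne'
  have := (d1.sub d2).sub d3
  refine hd_conv this (fun y => rfl) ?_
  simp only [id]
  rw [eq_comm]
  field_simp
  unfold NF UF
  ring

/-- derivative along the line `a + b = l`. -/
lemma LF_deriv_line {α p t l : ℝ} (hα : 1 < α) (hp : p * (α - 1) = 2) (ht : 0 ≤ t) (htl : t ≤ l)
    (hl : 0 < l) :
    HasDerivAt (fun t => LF α p t (l - t))
      (t * ((kF α p (l - t) - t) * UF t (l - t) + t ^ 2 * (t + sF (l - t)) * (t + tF α (l - t)))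
        / ((t + sF (l - t)) * (t + tF α (l - t)) * UF t (l - t))) t := by
  have hb : 0 ≤ l - t := by linarith
  have hA := A_pos ht hb (by linarith)
  have hM := M_pos hα ht hb (by linarith)
  have hU := UF_pos ht hb (by linarith)
  have dl : HasDerivAt (fun t => l - t) (-1) t := by simpa using (hasDerivAt_id t).const_sub l
  have ds := (sF_deriv (l - t)).comp t dl
  have dt := (tF_deriv hα (l - t)).comp t dl
  have dm1 := (m1F_deriv (l - t)).comp t dl
  have dm2 := (m2F_deriv (l - t)).comp t dl
  have d1 := (((hasDerivAt_id t).add ds).log hA.ne').const_mul (3 + p)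
  have d2 := (((hasDerivAt_id t).add dt).log hM.ne').const_mul p
  have d0 := ((((hasDerivAt_id t).pow 3).add ((ds.mul ((hasDerivAt_id t).pow 2)).const_mul 3)).add
      ((dm1.mul (hasDerivAt_id t)).const_mul 6)).add (dm2.const_mul 3)
  have d0' : HasDerivAt (fun t => UF t (l - t)) (UF t (l - t) - t ^ 3) t := by
    refine hd_conv d0 (fun u => ?_) ?_
    · simp [UF]; ring
    · simp only [Function.comp, id, UF, sF, m1F, m2F]
      simp
      ring
  have d3 := d0'.log hU.ne'
  have := (d1.sub d2).sub d3
  refine hd_conv this (fun y => rfl) ?_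
  have ex : Real.exp (-(l - t)) = 1 - sF (l - t) := by simp [sF]
  have ey : Real.exp (-(α * (l - t))) = 1 - α * tF α (l - t) := by
    unfold tF; field_simp; ring
  simp only [id, Function.comp, Pi.add_apply, ex, ey]
  rw [eq_comm]
  unfold kF
  field_simp
  have : p * α = p + 2 := by linarith
  linear_combination (-(tF α (l - t)) * (t + sF (l - t)) * UF t (l - t)) * this

lemma mono_helper {f f' : ℝ → ℝ} {a b : ℝ} (hab : a ≤ b)
    (h : ∀ x, a ≤ x → x ≤ b → HasDerivAt f (f' x) x) (h0 : ∀ x, a ≤ x → x ≤ b → 0 ≤ f' x) :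
    f a ≤ f b := by
  have hm : MonotoneOn f (Set.Icc a b) := by
    apply monotoneOn_of_deriv_nonneg (convex_Icc a b)
    · intro x hx
      exact (h x hx.1 hx.2).continuousAt.continuousWithinAt
    · intro x hx
      have hx' := interior_subset hx
      exact (h x hx'.1 hx'.2).differentiableAt.differentiableWithinAt
    · intro x hx
      have hx' := interior_subset hx
      rw [(h x hx'.1 hx'.2).deriv]
      exact h0 x hx'.1 hx'.2
  exact hm ⟨le_refl _, hab⟩ ⟨hab, le_refl _⟩ hab

lemma anti_helper {f f' : ℝ → ℝ} {a b : ℝ} (hab : a ≤ b)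
    (h : ∀ x, a ≤ x → x ≤ b → HasDerivAt f (f' x) x) (h0 : ∀ x, a ≤ x → x ≤ b → f' x ≤ 0) :
    f b ≤ f a := by
  have := mono_helper (f := fun x => - f x) (f' := fun x => - f' x) hab
    (fun x h1 h2 => (h x h1 h2).neg) (fun x h1 h2 => by have := h0 x h1 h2; linarith)
  simpa using this

lemma aAM_le {α t b : ℝ} (hα : 1 < α) (ht : 0 ≤ t) (hb : 0 ≤ b) :
    t * (t + sF b) * (t + tF α b) ≤ UF t b := by
  have h1 := sF_nonneg hb
  have h2 := m1F_nonneg b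
  have h3 := m2F_nonneg hb
  have h4 := tF_nonneg hα hb
  have h5 := tF_le_sF (b := b) hα
  have h6 := sq_le_m1F hb
  unfold UF
  have e1 : tF α b * sF b ≤ 2 * m1F b := by nlinarith
  have e2 : t * (tF α b * sF b) ≤ t * (2 * m1F b) := mul_le_mul_of_nonneg_left e1 ht
  have e3 : t ^ 2 * tF α b ≤ t ^ 2 * sF b := mul_le_mul_of_nonneg_left h5 (sq_nonneg t)
  have e4 : 0 ≤ t ^ 2 * sF b := by positivity
  have e5 : 0 ≤ t * m1F b := by positivity
  nlinarith

lemma LF_zero_b {α p c : ℝ} : LF α p c 0 = 0 := by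
  unfold LF UF
  rw [sF_zero, tF_zero, m1F_zero, m2F_zero]
  have : Real.log (c ^ 3) = 3 * Real.log c := by rw [Real.log_pow]; norm_num
  simp [this]
  ring

lemma LF_small {α p B a b : ℝ} (hα : 1 < α) (hp : p * (α - 1) = 2)
    (hk : ∀ b, 0 ≤ b → b ≤ B → kF α p b ≤ 0) (ha : 0 ≤ a) (hb : 0 ≤ b) (hab : 0 < a + b)
    (hbB : b ≤ B) : 0 ≤ LF α p a b := by
  have h := anti_helper (f := fun t => LF α p t (a + b - t)) (a := a) (b := a + b) (by linarith)
    (fun t h1 h2 => LF_deriv_line hα hp (by linarith) h2 hab)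
    (by
      intro t h1 h2
      have ht : 0 ≤ t := by linarith
      have hb' : 0 ≤ a + b - t := by linarith
      have hA := A_pos ht hb' (by linarith)
      have hM := M_pos hα ht hb' (by linarith)
      have hU := UF_pos ht hb' (by linarith)
      apply div_nonpos_of_nonpos_of_nonneg _ (by positivity)
      apply mul_nonpos_of_nonneg_of_nonpos ht
      have h3 := hk (a + b - t) hb' (by linarith)
      have h4 := aAM_le hα ht hb'
      have h5 : kF α p (a + b - t) * UF t (a + b - t) ≤ 0 :=
        mul_nonpos_of_nonpos_of_nonneg h3 hU.le
      nlinarith [mul_le_mul_of_nonneg_left h4 ht])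
  simp only [sub_self] at h
  rw [LF_zero_b] at h
  simpa using h

lemma LF_ge_F {α p a b : ℝ} (hα : 1 < α) (hp : p * (α - 1) = 2)
    (hk : ∀ c, b ≤ c → a ≤ kF α p c) (ha : 0 ≤ a) (hb : 0 ≤ b) (hab : 0 < a + b) :
    LF α p 0 (a + b) ≤ LF α p a b := by
  have h := mono_helper (f := fun t => LF α p t (a + b - t)) (a := 0) (b := a) ha
    (fun t h1 h2 => LF_deriv_line hα hp h1 (by linarith) hab)
    (by
      intro t ht h2
      have hb' : 0 ≤ a + b - t := by linarith
      have hA := A_pos ht hb' (by linarith)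
      have hM := M_pos hα ht hb' (by linarith)
      have hU := UF_pos ht hb' (by linarith)
      have h3 := hk (a + b - t) (by linarith)
      have : 0 ≤ kF α p (a + b - t) - t := by linarith
      positivity)
  simpa using h

lemma cs_ineq (b : ℝ) : m1F b ^ 2 ≤ sF b * m2F b := by
  have h1 : (b / 2) ^ 2 ≤ Real.sinh (b / 2) ^ 2 := by
    rcases le_total 0 b with h | h
    · have h2 := Real.self_le_sinh_iff.2 (show 0 ≤ b / 2 by linarith)
      exact pow_le_pow_left₀ (by linarith) h2 2
    · have h2 := Real.self_le_sinh_iff.2 (show 0 ≤ -(b / 2) by linarith)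
      rw [Real.sinh_neg] at h2
      nlinarith
  rw [Real.sinh_eq] at h1
  have e1 : Real.exp (b / 2) * Real.exp (-(b / 2)) = 1 := by rw [← Real.exp_add]; simp
  have e2 : Real.exp (b / 2) ^ 2 = Real.exp b := by rw [← Real.exp_nat_mul]; congr 1; push_cast; ring
  have e3 : Real.exp (-(b / 2)) ^ 2 = Real.exp (-b) := by
    rw [← Real.exp_nat_mul]; congr 1; push_cast; ring
  have h4 : b ^ 2 + 2 ≤ Real.exp b + Real.exp (-b) := by nlinarith
  have h5 := exp_mul_neg b
  have h6 := mul_le_mul_of_nonneg_left h4 (Real.exp_pos (-b)).le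
  unfold m1F sF m2F
  nlinarith

lemma cubic_sign {s τ m1 m2 δ a0 t1 t2 : ℝ} (N : ℝ → ℝ)
    (hN : ∀ a, N a = (6 * a * (2 * m1 - s ^ 2) + 3 * (3 * m2 - 2 * m1 * s)) * (a + τ)
      - δ * (a ^ 3 + 3 * s * a ^ 2 + 6 * m1 * a + 3 * m2))
    (hs : 0 < s) (hτ : 0 < τ) (hδ : 0 ≤ δ) (hcs : m1 ^ 2 ≤ s * m2)
    (ha0 : 0 ≤ a0) (h01 : a0 ≤ t1) (h12 : t1 < t2) (hN0 : 0 ≤ N a0) (hN1 : N t1 < 0) : N t2 < 0 := by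
  have h01' : a0 < t1 := by
    rcases h01.eq_or_lt with h | h
    · rw [h] at hN0; linarith
    · exact h
  by_contra hcon
  push Not at hcon
  have ht1 : 0 < t1 := by linarith
  have ht2 : 0 < t2 := by linarith
  rcases lt_or_ge (N 0) 0 with h0 | h0
  · have ha0' : 0 < a0 := by
      rcases ha0.eq_or_lt with h | h
      · rw [← h] at hN0; linarith
      · exact h
    have key : -δ * (a0 * t1 * t2 * (t1 - a0) * (t2 - a0) * (t2 - t1))
      = -N 0 * ((t1 - a0) * (t2 - a0) * (t2 - t1)) + N a0 * (t1 * t2 * (t2 - t1))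
        + -N t1 * (a0 * t2 * (t2 - a0)) + N t2 * (a0 * t1 * (t1 - a0)) := by
      simp only [hN]; ring
    have d1 : 0 < t1 - a0 := by linarith
    have d2 : 0 < t2 - a0 := by linarith
    have d3 : 0 < t2 - t1 := by linarith
    have n0 : 0 < -N 0 := by linarith
    have n1 : 0 < -N t1 := by linarith
    have p1 : 0 ≤ δ * (a0 * t1 * t2 * (t1 - a0) * (t2 - a0) * (t2 - t1)) := by positivity
    have p2 : 0 < -N 0 * ((t1 - a0) * (t2 - a0) * (t2 - t1)) := by positivity
    have p3 : 0 ≤ N a0 * (t1 * t2 * (t2 - t1)) := by positivity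
    have p4 : 0 < -N t1 * (a0 * t2 * (t2 - a0)) := by positivity
    have p5 : 0 ≤ N t2 * (a0 * t1 * (t1 - a0)) := by positivity
    linarith
  · have c0 : m2 * δ ≤ (3 * m2 - 2 * m1 * s) * τ := by rw [hN] at h0; nlinarith
    have d3 : 0 < t2 - t1 := by linarith
    have hc0 : 0 ≤ (3 * m2 - 2 * m1 * s) * τ - m2 * δ := by linarith
    by_cases hc1 : 0 ≤ 6 * (2 * m1 - s ^ 2) * τ + 3 * (3 * m2 - 2 * m1 * s) - 6 * m1 * δ
    · have key : t1 ^ 2 * N t2 - t2 ^ 2 * N t1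
        = -(3 * ((3 * m2 - 2 * m1 * s) * τ - m2 * δ) * ((t2 - t1) * (t1 + t2))
          + (6 * (2 * m1 - s ^ 2) * τ + 3 * (3 * m2 - 2 * m1 * s) - 6 * m1 * δ) * (t1 * t2 * (t2 - t1))
          + δ * (t1 ^ 2 * t2 ^ 2 * (t2 - t1))) := by
        simp only [hN]; ring
      have p1 : 0 ≤ 3 * ((3 * m2 - 2 * m1 * s) * τ - m2 * δ) * ((t2 - t1) * (t1 + t2)) := by positivity
      have p2 : 0 ≤ (6 * (2 * m1 - s ^ 2) * τ + 3 * (3 * m2 - 2 * m1 * s) - 6 * m1 * δ) * (t1 * t2 * (t2 - t1)) := by positivity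
      have p3 : 0 ≤ δ * (t1 ^ 2 * t2 ^ 2 * (t2 - t1)) := by positivity
      have p4 : 0 ≤ t1 ^ 2 * N t2 := by positivity
      have p5 : 0 < t2 ^ 2 * (-N t1) := by
        have : 0 < -N t1 := by linarith
        positivity
      linarith
    · have hc2 : 2 * (2 * m1 - s ^ 2) - s * δ ≤ 0 := by
        by_contra h
        push Not at h hc1
        have e1 : s * (s * τ ^ 2 + m2 - 2 * m1 * τ) = (s * τ - m1) ^ 2 + (s * m2 - m1 ^ 2) := by ring
        have e2 : 0 ≤ s * τ ^ 2 + m2 - 2 * m1 * τ := by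
          have : 0 ≤ s * (s * τ ^ 2 + m2 - 2 * m1 * τ) := by rw [e1]; nlinarith [sq_nonneg (s * τ - m1)]
          exact nonneg_of_mul_nonneg_right this hs
        have e3 := mul_nonneg hδ e2
        have e4 := mul_pos_of_neg_of_neg hc1 (show -τ < 0 by linarith)
        have e5 := mul_pos h (show 0 < τ ^ 2 by positivity)
        nlinarith
      have key : t1 * N t2 - t2 * N t1
        = -(3 * ((3 * m2 - 2 * m1 * s) * τ - m2 * δ) * (t2 - t1)
          + 3 * (-(2 * (2 * m1 - s ^ 2) - s * δ)) * (t1 * t2 * (t2 - t1))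
          + δ * (t1 * t2 * ((t2 - t1) * (t1 + t2)))) := by
        simp only [hN]; ring
      have hc2' : 0 ≤ -(2 * (2 * m1 - s ^ 2) - s * δ) := by linarith
      have p1 : 0 ≤ 3 * ((3 * m2 - 2 * m1 * s) * τ - m2 * δ) * (t2 - t1) := by positivity
      have p2 : 0 ≤ 3 * (-(2 * (2 * m1 - s ^ 2) - s * δ)) * (t1 * t2 * (t2 - t1)) := by positivity
      have p3 : 0 ≤ δ * (t1 * t2 * ((t2 - t1) * (t1 + t2))) := by positivity
      have p4 : 0 ≤ t1 * N t2 := by positivity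
      have p5 : 0 < t2 * (-N t1) := by
        have : 0 < -N t1 := by linarith
        positivity
      linarith

lemma LF_tendsto {α p b : ℝ} :
    Filter.Tendsto (fun a => LF α p a b) Filter.atTop (nhds 0) := by
  set g : ℝ → ℝ := fun z => (3 + p) * Real.log (1 + sF b * z) - p * Real.log (1 + tF α b * z)
    - Real.log (1 + 3 * sF b * z + 6 * m1F b * z ^ 2 + 3 * m2F b * z ^ 3) with hg
  have hc : ContinuousAt g 0 := by
    apply ContinuousAt.sub
    · apply ContinuousAt.sub
      · exact continuousAt_const.mul (ContinuousAt.log (by fun_prop) (by simp))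
      · exact continuousAt_const.mul (ContinuousAt.log (by fun_prop) (by simp))
    · exact ContinuousAt.log (by fun_prop) (by simp)
  have h0 : g 0 = 0 := by simp [hg]
  have ht : Filter.Tendsto (fun a : ℝ => g a⁻¹) Filter.atTop (nhds 0) := by
    have := hc.tendsto.comp tendsto_inv_atTop_zero
    rw [h0] at this
    exact this
  refine ht.congr' ?_
  have q1 : ∀ᶠ a : ℝ in Filter.atTop, 1 + sF b * a⁻¹ ≠ 0 := by
    have : ContinuousAt (fun z => 1 + sF b * z) 0 := by fun_prop
    exact (this.tendsto.comp tendsto_inv_atTop_zero).eventually_ne (by simp)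
  have q2 : ∀ᶠ a : ℝ in Filter.atTop, 1 + tF α b * a⁻¹ ≠ 0 := by
    have : ContinuousAt (fun z => 1 + tF α b * z) 0 := by fun_prop
    exact (this.tendsto.comp tendsto_inv_atTop_zero).eventually_ne (by simp)
  have q3 : ∀ᶠ a : ℝ in Filter.atTop,
      1 + 3 * sF b * a⁻¹ + 6 * m1F b * a⁻¹ ^ 2 + 3 * m2F b * a⁻¹ ^ 3 ≠ 0 := by
    have : ContinuousAt (fun z => 1 + 3 * sF b * z + 6 * m1F b * z ^ 2 + 3 * m2F b * z ^ 3) 0 := by fun_prop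
    exact (this.tendsto.comp tendsto_inv_atTop_zero).eventually_ne (by simp)
  filter_upwards [q1, q2, q3, Filter.eventually_gt_atTop 0] with a h1 h2 h3 ha
  have e1 : a + sF b = a * (1 + sF b * a⁻¹) := by field_simp
  have e2 : a + tF α b = a * (1 + tF α b * a⁻¹) := by field_simp
  have e3 : UF a b = a ^ 3 * (1 + 3 * sF b * a⁻¹ + 6 * m1F b * a⁻¹ ^ 2 + 3 * m2F b * a⁻¹ ^ 3) := by
    unfold UF; field_simp
  unfold LF
  rw [e1, e2, e3, Real.log_mul ha.ne' h1, Real.log_mul ha.ne' h2, Real.log_mul (by positivity) h3,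
    Real.log_pow]
  simp only [hg]
  push_cast
  ring

lemma LF_from {α p a0 a b : ℝ} (hα : 1 < α) (hp0 : 0 ≤ p) (hb : 0 < b) (ha0 : 0 ≤ a0)
    (haa : a0 ≤ a) (hN : 0 ≤ NF α p b a0) (hL : 0 ≤ LF α p a0 b) : 0 ≤ LF α p a b := by
  have hs := sF_pos hb
  have hτ := tF_pos hα hb
  have hsτ := tF_le_sF (b := b) hα
  have sign : ∀ t1 t2, a0 ≤ t1 → t1 < t2 → NF α p b t1 < 0 → NF α p b t2 < 0 := by
    intro t1 t2 h1 h2 h3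
    exact cubic_sign (NF α p b) (fun a => by unfold NF UF; ring) hs hτ
      (mul_nonneg hp0 (by linarith : 0 ≤ sF b - tF α b)) (cs_ineq b) ha0 h1 h2 hN h3
  have dpos : ∀ t, 0 ≤ t → 0 < (t + sF b) * (t + tF α b) * UF t b := by
    intro t ht
    have hA := A_pos ht hb.le (by linarith)
    have hM := M_pos hα ht hb.le (by linarith)
    have hU := UF_pos ht hb.le (by linarith)
    positivity
  rcases lt_or_ge (NF α p b a) 0 with h | h
  · refine ge_of_tendsto' (f := fun t => LF α p a b) (x := Filter.atTop (α := ℝ)) tendsto_const_nhds (fun _ => ?_)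
    refine le_of_tendsto (LF_tendsto (α := α) (p := p) (b := b)) ?_
    filter_upwards [Filter.eventually_ge_atTop a] with c hc
    refine anti_helper (f := fun t => LF α p t b) hc
      (fun t h1 h2 => LF_deriv_a hα (by linarith) hb.le (by linarith)) (fun t h1 h2 => ?_)
    apply div_nonpos_of_nonpos_of_nonneg _ (dpos t (by linarith)).le
    rcases h1.eq_or_lt with e | e
    · rw [← e]; exact h.le
    · exact (sign a t haa e h).le
  · refine hL.trans (mono_helper (f := fun t => LF α p t b) haa
      (fun t h1 h2 => LF_deriv_a hα (by linarith) hb.le (by linarith)) (fun t h1 h2 => ?_))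
    apply div_nonneg _ (dpos t (by linarith)).le
    by_contra hc
    push Not at hc
    rcases h2.eq_or_lt with e | e
    · rw [e] at hc; linarith
    · have h5 := sign t a h1 e hc
      linarith

lemma sF_le {b : ℝ} : sF b ≤ b := by
  have := Real.add_one_le_exp (-b)
  unfold sF; linarith

lemma two_m1_le {b : ℝ} (hb : 0 ≤ b) : 2 * m1F b ≤ b * sF b := by
  have h := mono_helper (f := fun b => b * sF b - 2 * m1F b) (f' := fun b => m1F b) hb
    (fun x _ _ => hd_conv (((hasDerivAt_id x).mul (sF_deriv x)).sub ((m1F_deriv x).const_mul 2))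
      (fun y => rfl) (by simp [m1F, sF]; ring))
    (fun x _ _ => m1F_nonneg x)
  simp only [sF_zero, m1F_zero] at h
  linarith

lemma three_m2_le {b : ℝ} (hb : 0 ≤ b) : 3 * m2F b ≤ 2 * b * m1F b := by
  have h := mono_helper (f := fun b => 2 * (b * m1F b) - 3 * m2F b) (f' := fun b => m2F b) hb
    (fun x _ _ => hd_conv ((((hasDerivAt_id x).mul (m1F_deriv x)).const_mul 2).sub
      ((m2F_deriv x).const_mul 3)) (fun y => rfl) (by simp [m1F, m2F]; ring))
    (fun x h _ => m2F_nonneg h)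
  simp only [m1F_zero, m2F_zero] at h
  linarith

lemma three_m2_le' {b : ℝ} (hb : 0 ≤ b) : 3 * m2F b ≤ b ^ 2 * sF b := by
  have h := mono_helper (f := fun b => b ^ 2 * sF b - 3 * m2F b) (f' := fun b => 2 * b * m1F b) hb
    (fun x _ _ => hd_conv ((((hasDerivAt_id x).pow 2).mul (sF_deriv x)).sub
      ((m2F_deriv x).const_mul 3)) (fun y => rfl) (by simp [m1F, sF]; ring))
    (fun x h _ => mul_nonneg (by linarith) (m1F_nonneg x))
  simp only [sF_zero, m2F_zero] at h
  linarith

noncomputable def WF (a b : ℝ) : ℝ := a ^ 2 + 2 * sF b * a + 2 * m1F b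

lemma WF_le {a b : ℝ} (ha : 0 ≤ a) (hb : 0 ≤ b) : WF a b ≤ (a + b) * (a + sF b) := by
  have h1 := two_m1_le hb
  have h2 := mul_le_mul_of_nonneg_left (sF_le (b := b)) ha
  unfold WF
  nlinarith

lemma UF_le {a b : ℝ} (ha : 0 ≤ a) (hb : 0 ≤ b) : UF a b ≤ (a + b) * WF a b := by
  have h1 := mul_le_mul_of_nonneg_left (two_m1_le hb) ha
  have h2 := mul_le_mul_of_nonneg_left (sF_le (b := b)) (sq_nonneg a)
  have h3 := three_m2_le hb
  unfold WF UF
  nlinarith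

lemma WF_nonneg {a b : ℝ} (ha : 0 ≤ a) (hb : 0 ≤ b) : 0 ≤ WF a b := by
  have h1 := sF_nonneg hb
  have h2 := m1F_nonneg b
  unfold WF
  positivity

lemma ratio_anti {a b0 b : ℝ} (ha : 0 ≤ a) (hb0 : 0 < b0) (hb : b0 ≤ b) :
    (a + sF b) * WF a b / UF a b ≤ (a + sF b0) * WF a b0 / UF a b0 := by
  refine anti_helper (f := fun b => (a + sF b) * WF a b / UF a b)
    (f' := fun b => Real.exp (-b) * (UF a b * (WF a b + 2 * (a + b) * (a + sF b))
      - 3 * (a + b) ^ 2 * (a + sF b) * WF a b) / (UF a b) ^ 2) hb (fun x h1 h2 => ?_) (fun x h1 h2 => ?_)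
  · have hU := UF_pos ha (show 0 ≤ x by linarith) (by linarith)
    have dA := (sF_deriv x).const_add a
    have dW : HasDerivAt (fun b => WF a b) (2 * (a + x) * Real.exp (-x)) x :=
      hd_conv (((((sF_deriv x).const_mul 2).mul_const a).const_add (a ^ 2)).add
        ((m1F_deriv x).const_mul 2)) (fun y => rfl) (by ring)
    have dU : HasDerivAt (fun b => UF a b) (3 * (a + x) ^ 2 * Real.exp (-x)) x :=
      hd_conv ((((((sF_deriv x).const_mul 3).mul_const (a ^ 2)).const_add (a ^ 3)).add
        (((m1F_deriv x).const_mul 6).mul_const a)).add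
        ((m2F_deriv x).const_mul 3)) (fun y => rfl) (by ring)
    exact hd_conv ((dA.mul dW).div dU hU.ne') (fun y => rfl) (by simp; ring)
  · have hx : 0 ≤ x := by linarith
    have hU := UF_pos ha hx (by linarith)
    have hA := A_pos ha hx (by linarith)
    have hW := WF_nonneg ha hx
    apply div_nonpos_of_nonpos_of_nonneg _ (sq_nonneg _)
    apply mul_nonpos_of_nonneg_of_nonpos (Real.exp_pos _).le
    have h3 := WF_le ha hx
    have h4 := UF_le ha hx
    have hc : 0 ≤ a + x := by linarith
    have : UF a x * (WF a x + 2 * (a + x) * (a + sF x)) ≤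
        ((a + x) * WF a x) * (3 * ((a + x) * (a + sF x))) := by
      apply mul_le_mul h4 (by linarith) (by positivity) (by positivity)
    nlinarith

lemma y_le_x {α b : ℝ} (hα : 1 < α) (hb : 0 ≤ b) : Real.exp (-(α * b)) ≤ Real.exp (-b) := by
  apply Real.exp_le_exp.2; nlinarith

lemma delta_mono {α a b b1 : ℝ} (hα : 1 < α) (ha : 0 ≤ a) (hb0 : 0 < b) (hb : b ≤ b1) :
    (sF b - tF α b) / (a + tF α b) ≤ (sF b1 - tF α b1) / (a + tF α b1) := by
  refine mono_helper (f := fun b => (sF b - tF α b) / (a + tF α b))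
    (f' := fun b => ((Real.exp (-b) - Real.exp (-(α * b))) * (a + tF α b)
      - (sF b - tF α b) * Real.exp (-(α * b))) / (a + tF α b) ^ 2) hb (fun x h1 h2 => ?_) (fun x h1 h2 => ?_)
  · have hM := M_pos hα ha (show 0 ≤ x by linarith) (by linarith)
    exact hd_conv (((sF_deriv x).sub (tF_deriv hα x)).div ((tF_deriv hα x).const_add a) hM.ne')
      (fun y => rfl) (by simp)
  · apply div_nonneg _ (sq_nonneg _)
    have h3 := cross_le (b := x) hα
    have h4 := mul_nonneg ha (sub_nonneg.2 (y_le_x hα (show 0 ≤ x by linarith)))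
    nlinarith

lemma NF_nonneg_of {α p a b r q : ℝ} (hα : 1 < α) (ha : 0 ≤ a) (hb : 0 < b)
    (hr : (a + sF b) * WF a b / UF a b ≤ r) (hq : p * ((sF b - tF α b) / (a + tF α b)) ≤ q)
    (hrq : q ≤ 3 - 3 * r) : 0 ≤ NF α p b a := by
  have hU := UF_pos ha hb.le (by linarith)
  have hM := M_pos hα ha hb.le (by linarith)
  have e : NF α p b a = UF a b * (a + tF α b) * ((3 - 3 * ((a + sF b) * WF a b / UF a b))
      - p * ((sF b - tF α b) / (a + tF α b))) := by
    field_simp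
    unfold NF WF UF
    ring
  rw [e]
  apply mul_nonneg (by positivity)
  linarith

lemma delta_inf {α p a b : ℝ} (hα : 1 < α) (hp : p * (α - 1) = 2) (hp0 : 0 < p) (ha : 0 ≤ a) (hb : 0 < b) :
    p * ((sF b - tF α b) / (a + tF α b)) ≤ 2 / (α * a + 1) := by
  have hM := M_pos hα ha hb.le (by linarith)
  have hα0 : 0 < α * a + 1 := by positivity
  rw [mul_div_assoc', div_le_div_iff₀ hM hα0]
  have hy := y_le_x hα hb.le
  have hy0 := Real.exp_pos (-(α * b))
  have ey : Real.exp (-(α * b)) = 1 - α * tF α b := by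
    unfold tF; field_simp; ring
  have ex : Real.exp (-b) = 1 - sF b := by simp [sF]
  rw [ey] at hy hy0
  rw [ex] at hy
  set s := sF b
  set τ := tF α b
  -- `p (α x - y) (α a + 1) ≥ 2 y`
  have h1 : 2 * (1 - α * τ) ≤ p * (α * (1 - s) - (1 - α * τ)) := by
    have : p * ((α - 1) * (1 - α * τ)) ≤ p * (α * (1 - s) - (1 - α * τ)) := by
      apply mul_le_mul_of_nonneg_left _ hp0.le
      nlinarith
    nlinarith
  have h2 := mul_le_mul_of_nonneg_right h1 hα0.le
  have h3 : 0 ≤ (1 - α * τ) * (α * a) := by positivity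
  have h4 : p * α = p + 2 := by linarith
  have h5 : α * (p * (s - τ) * (α * a + 1)) ≤ α * (2 * (a + τ)) := by
    nlinarith
  exact le_of_mul_le_mul_left h5 (by linarith)

lemma kF_deriv {α p : ℝ} (hα : 1 < α) (b : ℝ) :
    HasDerivAt (kF α p) ((p + 2) * Real.exp (-b) - (p + 3) * Real.exp (-(α * b))) b :=
  hd_conv (((sF_deriv b).const_mul (p + 2)).sub ((tF_deriv hα b).const_mul (p + 3)))
    (fun _ => rfl) rfl

lemma y_eq (α b : ℝ) : Real.exp (-(α * b)) = Real.exp (-b) * Real.exp (-((α - 1) * b)) := by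
  rw [← Real.exp_add]; ring_nf

lemma kF_mono {α p b0 b b1 : ℝ} (hα : 1 < α) (hp0 : 0 < p)
    (h0 : (p + 3) * Real.exp (-((α - 1) * b0)) ≤ p + 2) (hb0 : b0 ≤ b) (hb : b ≤ b1) :
    kF α p b ≤ kF α p b1 := by
  refine mono_helper hb (fun x _ _ => kF_deriv hα x) (fun x h1 _ => ?_)
  rw [y_eq]
  have : Real.exp (-((α - 1) * x)) ≤ Real.exp (-((α - 1) * b0)) := by
    apply Real.exp_le_exp.2; nlinarith
  have h2 := mul_le_mul_of_nonneg_left this (show 0 ≤ p + 3 by linarith)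
  have h3 := mul_nonneg (Real.exp_pos (-x)).le (show 0 ≤ p + 2 - (p + 3) * Real.exp (-((α - 1) * x)) by linarith)
  linarith

lemma kF_nonpos {α p b B : ℝ} (hα : 1 < α) (hp0 : 0 < p) (hb0 : 0 ≤ b) (hb : b ≤ B)
    (hB : kF α p B ≤ 0) : kF α p b ≤ 0 := by
  rcases le_total ((p + 3) * Real.exp (-((α - 1) * b))) (p + 2) with h | h
  · exact (kF_mono hα hp0 h le_rfl hb).trans hB
  · have h1 := anti_helper hb0 (fun x _ _ => kF_deriv (p := p) hα x) (fun x _ h1 => by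
      rw [y_eq]
      have : Real.exp (-((α - 1) * b)) ≤ Real.exp (-((α - 1) * x)) := by
        apply Real.exp_le_exp.2; nlinarith
      have h2 := mul_le_mul_of_nonneg_left this (show 0 ≤ p + 3 by linarith)
      have h3 := mul_nonneg (Real.exp_pos (-x)).le (show 0 ≤ (p + 3) * Real.exp (-((α - 1) * x)) - (p + 2) by linarith)
      linarith)
    have : kF α p 0 = 0 := by simp [kF, sF_zero, tF_zero]
    linarith

lemma logratio_mono {α b0 b : ℝ} (hα : 1 < α) (hb0 : 0 < b0) (hb : b0 ≤ b) :
    Real.log (sF b0) - Real.log (tF α b0) ≤ Real.log (sF b) - Real.log (tF α b) := by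
  refine mono_helper (f := fun b => Real.log (sF b) - Real.log (tF α b))
    (f' := fun b => Real.exp (-b) / sF b - Real.exp (-(α * b)) / tF α b) hb (fun x h1 h2 => ?_) (fun x h1 h2 => ?_)
  · exact ((sF_deriv x).log (sF_pos (by linarith)).ne').sub ((tF_deriv hα x).log (tF_pos hα (by linarith)).ne')
  · rw [sub_nonneg, div_le_div_iff₀ (tF_pos hα (by linarith)) (sF_pos (by linarith))]
    exact cross_le hα

lemma logm2_mono {b b1 : ℝ} (hb0 : 0 < b) (hb : b ≤ b1) :
    Real.log (3 * m2F b) - 3 * Real.log (sF b) ≤ Real.log (3 * m2F b1) - 3 * Real.log (sF b1) := by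
  refine mono_helper (f := fun b => Real.log (3 * m2F b) - 3 * Real.log (sF b))
    (f' := fun b => 3 * (b ^ 2 * Real.exp (-b)) / (3 * m2F b) - 3 * (Real.exp (-b) / sF b)) hb (fun x h1 h2 => ?_) (fun x h1 h2 => ?_)
  · exact (((m2F_deriv x).const_mul 3).log (mul_pos three_pos (m2F_pos (by linarith))).ne').sub
      (((sF_deriv x).log (sF_pos (by linarith)).ne').const_mul 3)
  · have hx : 0 < x := by linarith
    have h3 := mul_le_mul_of_nonneg_left (three_m2_le' hx.le) (Real.exp_pos (-x)).le
    have hm := m2F_pos hx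
    have hs := sF_pos hx
    rw [sub_nonneg, mul_div_assoc', div_le_div_iff₀ hs (by positivity)]
    nlinarith

lemma F_box {α p b0 b b1 ρ σ : ℝ} (hα : 1 < α) (hp : 33 / 4 ≤ p) (hb0 : 0 < b0) (h0 : b0 ≤ b)
    (h1 : b ≤ b1) (hρ : 1 ≤ ρ) (hσ : 0 < σ) (hs : ρ * tF α b0 ≤ sF b0) (hm : 3 * m2F b1 ≤ σ * sF b1 ^ 3)
    (hρσ : σ ^ 4 ≤ ρ ^ 33) : 0 ≤ LF α p 0 b := by
  have hb1 : 0 < b1 := by linarith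
  have e : LF α p 0 b = p * (Real.log (sF b) - Real.log (tF α b))
      - (Real.log (3 * m2F b) - 3 * Real.log (sF b)) := by
    unfold LF UF; simp; ring
  rw [e]
  have i1 := logratio_mono hα hb0 h0
  have i2 := logm2_mono (show 0 < b by linarith) h1
  have t0 := tF_pos hα hb0
  have s1 := sF_pos hb1
  have n1 := m2F_pos hb1
  have j1 : Real.log ρ + Real.log (tF α b0) ≤ Real.log (sF b0) := by
    rw [← Real.log_mul (by linarith) t0.ne']
    exact Real.log_le_log (by positivity) hs
  have j2 : Real.log (3 * m2F b1) ≤ Real.log σ + 3 * Real.log (sF b1) := by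
    have : Real.log (sF b1 ^ 3) = 3 * Real.log (sF b1) := by rw [Real.log_pow]; norm_num
    rw [← this, ← Real.log_mul hσ.ne' (by positivity)]
    exact Real.log_le_log (by positivity) hm
  have j3 : 4 * Real.log σ ≤ 33 * Real.log ρ := by
    have := Real.log_le_log (by positivity) hρσ
    rw [Real.log_pow, Real.log_pow] at this
    exact_mod_cast this
  have j4 : 0 ≤ Real.log ρ := Real.log_nonneg hρ
  have j5 := mul_le_mul hp (show Real.log ρ ≤ Real.log (sF b) - Real.log (tF α b) by linarith) j4 (by linarith)
  linarith

lemma F_large {α p b : ℝ} (hα : 1 < α) (hp0 : 0 < p) (hp : p ≤ 9) (h6 : p * Real.log α = Real.log 6)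
    (hb : 4 ≤ b) : 0 ≤ LF α p 0 b := by
  have hb0 : 0 < b := by linarith
  have hx := Real.exp_pos (-b)
  have hx1 : Real.exp (-b) ≤ 1 / 16 := by
    have h1 : Real.exp (-b) ≤ Real.exp (-4) := Real.exp_le_exp.2 (by linarith)
    have h2 : (2 : ℝ) ≤ Real.exp 1 := by have := Real.add_one_le_exp (1 : ℝ); linarith
    have h3 : (16 : ℝ) ≤ Real.exp 4 := by
      have : Real.exp 4 = Real.exp 1 ^ 4 := by rw [← Real.exp_nat_mul]; norm_num
      rw [this]
      calc (16 : ℝ) = 2 ^ 4 := by norm_num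
        _ ≤ _ := by gcongr
    have h4 := exp_mul_neg 4
    nlinarith [Real.exp_pos (-4)]
  have hy := Real.exp_pos (-(α * b))
  have hy1 : Real.exp (-(α * b)) < 1 := by
    rw [Real.exp_lt_one_iff]; have : 0 < α * b := by positivity
    linarith
  have hm := m2F_pos hb0
  set x := Real.exp (-b) with hxdef
  set z := x * (b ^ 2 + 2 * b + 2) / 2 with hz
  have em : 3 * m2F b = 6 * (1 - z) := by unfold m2F; rw [hz]; ring
  have hz1 : 0 < 1 - z := by linarith
  have eL : LF α p 0 b = (3 + p) * Real.log (1 - x) - p * Real.log (1 - Real.exp (-(α * b))) - Real.log (1 - z) := by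
    have l1 : Real.log (tF α b) = Real.log (1 - Real.exp (-(α * b))) - Real.log α := by
      unfold tF; rw [Real.log_div (by linarith) (by linarith)]
    have l2 : Real.log (UF 0 b) = Real.log 6 + Real.log (1 - z) := by
      rw [← Real.log_mul (by norm_num) hz1.ne', ← em]; simp [UF]
    unfold LF
    rw [zero_add, zero_add, l1, l2]
    simp only [sF]
    linarith
  rw [eL]
  have i1 := Real.one_sub_inv_le_log_of_pos (show 0 < 1 - x by linarith)
  have i2 := Real.log_nonpos (show 0 ≤ 1 - Real.exp (-(α * b)) by linarith) (by linarith)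
  have i3 := Real.log_le_sub_one_of_pos hz1
  have i4 : -(16 / 15 * x) ≤ 1 - (1 - x)⁻¹ := by
    have : (1 - x)⁻¹ ≤ 1 + 16 / 15 * x := by
      rw [inv_le_iff_one_le_mul₀ (by linarith)]
      nlinarith
    linarith
  have i5 : (3 + p) * (-(16 / 15 * x)) ≤ (3 + p) * Real.log (1 - x) :=
    mul_le_mul_of_nonneg_left (i4.trans i1) (by linarith)
  have i6 : p * Real.log (1 - Real.exp (-(α * b))) ≤ 0 := mul_nonpos_of_nonneg_of_nonpos hp0.le i2
  have hq : 26 ≤ b ^ 2 + 2 * b + 2 := by nlinarith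
  have i7 : 13 * x ≤ z := by
    have := mul_le_mul_of_nonneg_left hq hx.le
    rw [hz]; linarith
  have i8 : p * x ≤ 9 * x := mul_le_mul_of_nonneg_right hp hx.le
  linarith

lemma log_slope {α β : ℝ} (h1 : 1 < α) (h : α ≤ β) :
    Real.log β * (α - 1) ≤ Real.log α * (β - 1) := by
  rcases h.eq_or_lt with rfl | hlt
  · exact le_rfl
  · have := strictConcaveOn_log_Ioi.concaveOn.slope_anti_adjacent (x := 1) (y := α) (z := β)
      (by simp) (by simp; linarith) h1 hlt
    rw [Real.log_one, div_le_div_iff₀ (by linarith) (by linarith)] at this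
    nlinarith

set_option exponentiation.threshold 2000 in
lemma alpha_lo {α : ℝ} (h1 : 1 < α) (h6 : 2 * Real.log α = (α - 1) * Real.log 6) : 803 / 647 ≤ α := by
  by_contra hc
  push Not at hc
  have h := log_slope h1 hc.le
  have h2 : 78 * Real.log 6 < 647 * Real.log (803 / 647) := by
    have : Real.log ((6 : ℝ) ^ 78) < Real.log ((803 / 647 : ℝ) ^ 647) := by
      apply Real.log_lt_log (by positivity)
      norm_num
    rw [Real.log_pow, Real.log_pow] at this
    exact_mod_cast this
  have h3 : 0 < α - 1 := by linarith
  have h4 : Real.log (803 / 647) * (α - 1) ≤ (78 / 647 * Real.log 6) * (α - 1) := by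
    linarith
  have h5 := le_of_mul_le_mul_right h4 h3
  linarith

set_option exponentiation.threshold 2000 in
lemma alpha_hi {α : ℝ} (h1 : 1 < α) (h6 : 2 * Real.log α = (α - 1) * Real.log 6) : α ≤ 489 / 394 := by
  by_contra hc
  push Not at hc
  have h := log_slope (by norm_num) hc.le
  have h2 : 788 * Real.log (489 / 394) < 95 * Real.log 6 := by
    have : Real.log ((489 / 394 : ℝ) ^ 788) < Real.log ((6 : ℝ) ^ 95) := by
      apply Real.log_lt_log (by positivity)
      norm_num
    rw [Real.log_pow, Real.log_pow] at this
    exact_mod_cast this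
  have h3 : 0 < α - 1 := by linarith
  have h4 : (95 / 788 * Real.log 6) * (α - 1) ≤ Real.log (489 / 394) * (α - 1) := by
    linarith
  have h5 := le_of_mul_le_mul_right h4 h3
  linarith

/-- Taylor polynomial of degree nine of `exp (-z)`. -/
noncomputable def TP (z : ℝ) : ℝ :=
  1 - z + z ^ 2 / 2 - z ^ 3 / 6 + z ^ 4 / 24 - z ^ 5 / 120 + z ^ 6 / 720 - z ^ 7 / 5040
    + z ^ 8 / 40320 - z ^ 9 / 362880
/-- error term. -/
noncomputable def TE (z : ℝ) : ℝ := z ^ 10 * (11 / 36288000)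

lemma exp_TP {z : ℝ} (h0 : 0 ≤ z) (h1 : z ≤ 1) :
    TP z - TE z ≤ Real.exp (-z) ∧ Real.exp (-z) ≤ TP z + TE z := by
  have h := Real.exp_bound (x := -z) (by rw [abs_neg, abs_of_nonneg h0]; exact h1) (n := 10) (by norm_num)
  have e1 : ∑ m ∈ Finset.range 10, (-z) ^ m / (m.factorial : ℝ) = TP z := by
    simp only [Finset.sum_range_succ, Finset.sum_range_zero, Nat.factorial, TP]
    push_cast
    ring
  have e2 : |(-z)| ^ 10 * (((10 : ℕ).succ : ℝ) / (((10 : ℕ).factorial : ℝ) * (10 : ℕ))) = TE z := by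
    rw [abs_neg, abs_of_nonneg h0]
    simp only [Nat.factorial, TE]
    norm_num
  rw [e1, e2, abs_le] at h
  constructor <;> linarith [h.1, h.2]

lemma exp_num {z l u : ℝ} (h0 : 0 ≤ z) (h8 : z ≤ 8) (hl0 : 0 ≤ TP (z / 8) - TE (z / 8))
    (hl : l ≤ (TP (z / 8) - TE (z / 8)) ^ 8) (hu : (TP (z / 8) + TE (z / 8)) ^ 8 ≤ u) :
    l ≤ Real.exp (-z) ∧ Real.exp (-z) ≤ u := by
  have e : Real.exp (-z) = Real.exp (-(z / 8)) ^ 8 := by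
    rw [← Real.exp_nat_mul]; congr 1; push_cast; ring
  obtain ⟨h1, h2⟩ := exp_TP (z := z / 8) (by linarith) (by linarith)
  rw [e]
  exact ⟨hl.trans (pow_le_pow_left₀ hl0 h1 8), (pow_le_pow_left₀ (Real.exp_pos _).le h2 8).trans hu⟩

/-- numerical enclosures at a grid point. -/
def GB (α b xl xu tl tu : ℝ) : Prop :=
  xl ≤ Real.exp (-b) ∧ Real.exp (-b) ≤ xu ∧ tl ≤ tF α b ∧ tF α b ≤ tu

lemma GB_of {α b xl xu tl tu yl yu : ℝ} (h1 : 1.24111 ≤ α) (h2 : α ≤ 1.24112)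
    (hb : 0 ≤ b) (hb6 : b ≤ 6) (hx0 : 0 ≤ TP (b / 8) - TE (b / 8))
    (hxl : xl ≤ (TP (b / 8) - TE (b / 8)) ^ 8) (hxu : (TP (b / 8) + TE (b / 8)) ^ 8 ≤ xu)
    (hy0 : 0 ≤ TP (1.24112 * b / 8) - TE (1.24112 * b / 8))
    (hyl : yl ≤ (TP (1.24112 * b / 8) - TE (1.24112 * b / 8)) ^ 8)
    (hyu : 0 ≤ TP (1.24111 * b / 8) - TE (1.24111 * b / 8) ∧
      (TP (1.24111 * b / 8) + TE (1.24111 * b / 8)) ^ 8 ≤ yu)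
    (htl : 0 ≤ tl ∧ tl * 1.24112 ≤ 1 - yu) (htu : 0 ≤ tu ∧ 1 - yl ≤ tu * 1.24111) :
    GB α b xl xu tl tu := by
  obtain ⟨e1, e2⟩ := exp_num hb (by linarith) hx0 hxl hxu
  have e3 := (exp_num (z := 1.24112 * b) (u := (TP (1.24112 * b / 8) + TE (1.24112 * b / 8)) ^ 8)
    (by positivity) (by norm_num; linarith) hy0 hyl le_rfl).1
  have e4 := (exp_num (z := 1.24111 * b) (l := (TP (1.24111 * b / 8) - TE (1.24111 * b / 8)) ^ 8)
    (by positivity) (by norm_num; linarith) hyu.1 le_rfl hyu.2).2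
  have hα : 0 < α := lt_of_lt_of_le (by norm_num) h1
  have e5 : Real.exp (-(1.24112 * b)) ≤ Real.exp (-(α * b)) := by
    apply Real.exp_le_exp.2
    have := mul_le_mul_of_nonneg_right h2 hb
    linarith
  have e6 : Real.exp (-(α * b)) ≤ Real.exp (-(1.24111 * b)) := by
    apply Real.exp_le_exp.2
    have := mul_le_mul_of_nonneg_right h1 hb
    linarith
  refine ⟨e1, e2, ?_, ?_⟩
  · unfold tF
    rw [le_div_iff₀ hα]
    have := mul_le_mul_of_nonneg_left h2 htl.1
    linarith [htl.2]
  · unfold tF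
    rw [div_le_iff₀ hα]
    have := mul_le_mul_of_nonneg_left h1 htu.1
    linarith [htu.2]

lemma F_box_num {α p b b0 b1 xl xu tl tu xl1 xu1 tl1 tu1 ρ σ : ℝ} (g0 : GB α b0 xl xu tl tu)
    (g1 : GB α b1 xl1 xu1 tl1 tu1) (hα : 1.24111 ≤ α) (hp : 33 / 4 ≤ p) (hb0 : 0 < b0) (h0 : b0 ≤ b)
    (h1 : b ≤ b1) (hρ : 1 ≤ ρ) (hσ : 0 < σ) (hs : ρ * tu ≤ 1 - xu)
    (hm : xu1 ≤ 1 ∧ 3 * (2 - xl1 * (b1 ^ 2 + 2 * b1 + 2)) ≤ σ * (1 - xu1) ^ 3)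
    (hρσ : σ ^ 4 ≤ ρ ^ 33) : 0 ≤ LF α p 0 b := by
  refine F_box (lt_of_lt_of_le (by norm_num) hα) hp hb0 h0 h1 hρ hσ ?_ ?_ hρσ
  · have := mul_le_mul_of_nonneg_left g0.2.2.2 (show 0 ≤ ρ by linarith)
    unfold sF
    linarith [g0.2.1]
  · have i1 : (1 - xu1) ^ 3 ≤ sF b1 ^ 3 := by
      apply pow_le_pow_left₀ (by linarith [hm.1])
      unfold sF; linarith [g1.2.1]
    have i2 := mul_le_mul_of_nonneg_left i1 hσ.le
    have i3 := mul_le_mul_of_nonneg_right g1.1 (show 0 ≤ b1 ^ 2 + 2 * b1 + 2 by nlinarith)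
    unfold m2F
    linarith [hm.2]

lemma ratio_num {α a0 b0 xl xu tl tu r : ℝ} (g0 : GB α b0 xl xu tl tu) (hb0 : 0 < b0) (ha0 : 0 ≤ a0)
    (hr0 : 0 ≤ r)
    (hr : (a0 + (1 - xl)) * (a0 ^ 2 + 2 * (1 - xl) * a0 + 2 * (1 - xl * (b0 + 1))) ≤
      r * (a0 ^ 3 + 3 * (1 - xu) * a0 ^ 2 + 6 * (1 - xu * (b0 + 1)) * a0
        + 3 * (2 - xu * (b0 ^ 2 + 2 * b0 + 2)))) :
    (a0 + sF b0) * WF a0 b0 / UF a0 b0 ≤ r := by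
  have hU := UF_pos ha0 hb0.le (by linarith)
  rw [div_le_iff₀ hU]
  obtain ⟨gx, gy, -, -⟩ := g0
  have s1 : sF b0 ≤ 1 - xl := by unfold sF; linarith
  have s2 : 1 - xu ≤ sF b0 := by unfold sF; linarith
  have m1 : m1F b0 ≤ 1 - xl * (b0 + 1) := by
    have := mul_le_mul_of_nonneg_right gx (show 0 ≤ b0 + 1 by linarith)
    unfold m1F; linarith
  have m2 : 1 - xu * (b0 + 1) ≤ m1F b0 := by
    have := mul_le_mul_of_nonneg_right gy (show 0 ≤ b0 + 1 by linarith)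
    unfold m1F; linarith
  have m3 : 2 - xu * (b0 ^ 2 + 2 * b0 + 2) ≤ m2F b0 := by
    have := mul_le_mul_of_nonneg_right gy (show 0 ≤ b0 ^ 2 + 2 * b0 + 2 by nlinarith)
    unfold m2F; linarith
  have hs := sF_pos hb0
  have hW := WF_nonneg ha0 hb0.le
  have w1 : WF a0 b0 ≤ a0 ^ 2 + 2 * (1 - xl) * a0 + 2 * (1 - xl * (b0 + 1)) := by
    unfold WF; gcongr
  have u1 : a0 ^ 3 + 3 * (1 - xu) * a0 ^ 2 + 6 * (1 - xu * (b0 + 1)) * a0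
        + 3 * (2 - xu * (b0 ^ 2 + 2 * b0 + 2)) ≤ UF a0 b0 := by
    unfold UF; gcongr
  calc (a0 + sF b0) * WF a0 b0
      ≤ (a0 + (1 - xl)) * (a0 ^ 2 + 2 * (1 - xl) * a0 + 2 * (1 - xl * (b0 + 1))) :=
        mul_le_mul (by linarith) w1 hW (by linarith)
    _ ≤ _ := hr
    _ ≤ _ := mul_le_mul_of_nonneg_left u1 hr0

lemma N_num {α p b b0 b1 xl xu tl tu xl1 xu1 tl1 tu1 a0 r : ℝ} (g0 : GB α b0 xl xu tl tu)
    (g1 : GB α b1 xl1 xu1 tl1 tu1) (hα : 1.24111 ≤ α) (hp1 : 8.2947 ≤ p) (hp2 : p ≤ 8.29488)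
    (hb0 : 0 < b0) (h0 : b0 ≤ b) (h1 : b ≤ b1) (ha0 : 0 ≤ a0) (hr0 : 0 ≤ r) (hr1 : r ≤ 1)
    (hr : (a0 + (1 - xl)) * (a0 ^ 2 + 2 * (1 - xl) * a0 + 2 * (1 - xl * (b0 + 1))) ≤
      r * (a0 ^ 3 + 3 * (1 - xu) * a0 ^ 2 + 6 * (1 - xu * (b0 + 1)) * a0
        + 3 * (2 - xu * (b0 ^ 2 + 2 * b0 + 2))))
    (ht : tl1 ≤ 1 - xl1)
    (hq : 8.29488 * (1 - xl1 - tl1) ≤ (3 - 3 * r) * (a0 + tl1)) : 0 ≤ NF α p b a0 := by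
  have hα1 : 1 < α := lt_of_lt_of_le (by norm_num) hα
  have hb : 0 < b := by linarith
  have hp0 : 0 < p := lt_of_lt_of_le (by norm_num) hp1
  refine NF_nonneg_of (r := r) (q := 3 - 3 * r) hα1 ha0 hb ?_ ?_ le_rfl
  · exact (ratio_anti ha0 hb0 h0).trans (ratio_num g0 hb0 ha0 hr0 hr)
  · refine (mul_le_mul_of_nonneg_left (delta_mono hα1 ha0 hb h1) hp0.le).trans ?_
    have hM := M_pos hα1 ha0 (show 0 ≤ b1 by linarith) (by linarith)
    rw [mul_div_assoc', div_le_iff₀ hM]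
    obtain ⟨gx, -, gt, -⟩ := g1
    have s1 : sF b1 ≤ 1 - xl1 := by unfold sF; linarith
    have i1 : p * (sF b1 - tF α b1) ≤ p * (1 - xl1 - tl1) :=
      mul_le_mul_of_nonneg_left (by linarith) hp0.le
    have i2 : p * (1 - xl1 - tl1) ≤ 8.29488 * (1 - xl1 - tl1) :=
      mul_le_mul_of_nonneg_right hp2 (by linarith)
    have i3 := mul_le_mul_of_nonneg_left gt (show 0 ≤ 3 - 3 * r by linarith)
    linarith

lemma kF_num {α p b0 xl xu tl tu a0 : ℝ} (g0 : GB α b0 xl xu tl tu) (hp1 : 8.2947 ≤ p)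
    (h1 : tu ≤ 1 - xu) (h : a0 ≤ 10.2947 * (1 - xu) - 11.2947 * tu) : a0 ≤ kF α p b0 := by
  obtain ⟨-, gx, -, gt⟩ := g0
  have s1 : 1 - xu ≤ sF b0 := by unfold sF; linarith
  have i1 : 0 ≤ (p - 8.2947) * (sF b0 - tF α b0) := mul_nonneg (by linarith) (by linarith)
  unfold kF
  norm_num at *
  linarith

/-- the box argument. -/
lemma N_from {α p a b b0 a0 : ℝ} (hα : 1 < α) (hp0 : 0 < p)
    (hp : p * (α - 1) = 2) (hF : ∀ c, 0.9 ≤ c → 0 ≤ LF α p 0 c)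
    (hk : ∀ c d, 0.9 ≤ c → c ≤ d → kF α p c ≤ kF α p d) (hb9 : 0.9 ≤ b0) (h0 : b0 ≤ b)
    (hk0 : a0 ≤ kF α p b0) (ha0 : 0 ≤ a0) (hN : 0 ≤ NF α p b a0) (ha : 0 ≤ a) : 0 ≤ LF α p a b := by
  have hb9' : 0.9 ≤ b := hb9.trans h0
  have hb : 0 < b := lt_of_lt_of_le (by norm_num) hb9'
  have key : ∀ t, 0 ≤ t → t ≤ a0 → 0 ≤ LF α p t b := by
    intro t ht hta
    refine (hF (t + b) (by linarith)).trans (LF_ge_F hα hp (fun c hc => ?_) ht hb.le (by linarith))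
    exact hta.trans (hk0.trans (hk b0 c hb9 (h0.trans hc)))
  rcases le_total a a0 with h | h
  · exact key a ha h
  · exact LF_from hα hp0.le hb ha0 h hN (key a0 ha0 le_rfl)

lemma N_box {α p a b b0 b1 xl xu tl tu xl1 xu1 tl1 tu1 a0 r : ℝ} (g0 : GB α b0 xl xu tl tu)
    (g1 : GB α b1 xl1 xu1 tl1 tu1) (hα : 1.24111 ≤ α) (hp1 : 8.2947 ≤ p) (hp2 : p ≤ 8.29488)
    (hp : p * (α - 1) = 2) (hF : ∀ c, 0.9 ≤ c → 0 ≤ LF α p 0 c)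
    (hk : ∀ c d, 0.9 ≤ c → c ≤ d → kF α p c ≤ kF α p d) (ha : 0 ≤ a)
    (hb0 : 0.9 ≤ b0) (h0 : b0 ≤ b) (h1 : b ≤ b1) (ha0 : 0 ≤ a0) (hr0 : 0 ≤ r ∧ r ≤ 1)
    (hr : (a0 + (1 - xl)) * (a0 ^ 2 + 2 * (1 - xl) * a0 + 2 * (1 - xl * (b0 + 1))) ≤
      r * (a0 ^ 3 + 3 * (1 - xu) * a0 ^ 2 + 6 * (1 - xu * (b0 + 1)) * a0
        + 3 * (2 - xu * (b0 ^ 2 + 2 * b0 + 2))))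
    (ht : tl1 ≤ 1 - xl1)
    (hq : 8.29488 * (1 - xl1 - tl1) ≤ (3 - 3 * r) * (a0 + tl1))
    (hk0 : tu ≤ 1 - xu ∧ a0 ≤ 10.2947 * (1 - xu) - 11.2947 * tu) : 0 ≤ LF α p a b :=
  N_from (lt_of_lt_of_le (by norm_num) hα) (lt_of_lt_of_le (by norm_num) hp1) hp hF hk hb0 h0
    (kF_num g0 hp1 hk0.1 hk0.2) ha0
    (N_num g0 g1 hα hp1 hp2 (lt_of_lt_of_le (by norm_num) hb0) h0 h1 ha0 hr0.1 hr0.2 hr ht hq) ha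

lemma grid_0_9 {α : ℝ} (h1 : 1.24111 ≤ α) (h2 : α ≤ 1.24112) :
    GB α 0.9 0.4065693 0.4065700 0.5420420 0.5420494 := by
  refine GB_of h1 h2 (yl := 0.3272571) (yu := 0.3272608) ?_ ?_ ?_ ?_ ?_ ?_ ?_ ?_ ?_ ?_ <;>
    norm_num [TP, TE]

lemma grid_0_98 {α : ℝ} (h1 : 1.24111 ≤ α) (h2 : α ≤ 1.24112) :
    GB α 0.98 0.3753107 0.3753114 0.5669649 0.5669724 := by
  refine GB_of h1 h2 (yl := 0.2963249) (yu := 0.2963285) ?_ ?_ ?_ ?_ ?_ ?_ ?_ ?_ ?_ ?_ <;>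
    norm_num [TP, TE]

lemma grid_1_06 {α : ℝ} (h1 : 1.24111 ≤ α) (h2 : α ≤ 1.24112) :
    GB α 1.06 0.3464555 0.3464562 0.5895321 0.5895397 := by
  refine GB_of h1 h2 (yl := 0.2683164) (yu := 0.2683199) ?_ ?_ ?_ ?_ ?_ ?_ ?_ ?_ ?_ ?_ <;>
    norm_num [TP, TE]

lemma grid_1_15 {α : ℝ} (h1 : 1.24111 ≤ α) (h2 : α ≤ 1.24112) :
    GB α 1.15 0.3166364 0.3166371 0.6123808 0.6123886 := by
  refine GB_of h1 h2 (yl := 0.2399585) (yu := 0.2399619) ?_ ?_ ?_ ?_ ?_ ?_ ?_ ?_ ?_ ?_ <;>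
    norm_num [TP, TE]

lemma grid_1_24 {α : ℝ} (h1 : 1.24111 ≤ α) (h2 : α ≤ 1.24112) :
    GB α 1.24 0.2893839 0.2893846 0.6328147 0.6328226 := by
  refine GB_of h1 h2 (yl := 0.2145976) (yu := 0.2146010) ?_ ?_ ?_ ?_ ?_ ?_ ?_ ?_ ?_ ?_ <;>
    norm_num [TP, TE]

lemma grid_1_33 {α : ℝ} (h1 : 1.24111 ≤ α) (h2 : α ≤ 1.24112) :
    GB α 1.33 0.2644769 0.2644776 0.6510890 0.6510969 := by
  refine GB_of h1 h2 (yl := 0.1919172) (yu := 0.1919204) ?_ ?_ ?_ ?_ ?_ ?_ ?_ ?_ ?_ ?_ <;>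
    norm_num [TP, TE]

lemma grid_1_43 {α : ℝ} (h1 : 1.24111 ≤ α) (h2 : α ≤ 1.24112) :
    GB α 1.43 0.2393086 0.2393093 0.6691376 0.6691457 := by
  refine GB_of h1 h2 (yl := 0.1695167) (yu := 0.1695199) ?_ ?_ ?_ ?_ ?_ ?_ ?_ ?_ ?_ ?_ <;>
    norm_num [TP, TE]

lemma grid_1_54 {α : ℝ} (h1 : 1.24111 ≤ α) (h2 : α ≤ 1.24112) :
    GB α 1.54 0.2143808 0.2143815 0.6865677 0.6865758 := by
  refine GB_of h1 h2 (yl := 0.1478840) (yu := 0.1478870) ?_ ?_ ?_ ?_ ?_ ?_ ?_ ?_ ?_ ?_ <;>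
    norm_num [TP, TE]

lemma grid_1_66 {α : ℝ} (h1 : 1.24111 ≤ α) (h2 : α ≤ 1.24112) :
    GB α 1.66 0.1901386 0.1901393 0.7030557 0.7030638 := by
  refine GB_of h1 h2 (yl := 0.1274206) (yu := 0.1274234) ?_ ?_ ?_ ?_ ?_ ?_ ?_ ?_ ?_ ?_ <;>
    norm_num [TP, TE]

lemma grid_1_8 {α : ℝ} (h1 : 1.24111 ≤ α) (h2 : α ≤ 1.24112) :
    GB α 1.8 0.1652985 0.1652992 0.7194310 0.7194390 := by
  refine GB_of h1 h2 (yl := 0.1070971) (yu := 0.1070997) ?_ ?_ ?_ ?_ ?_ ?_ ?_ ?_ ?_ ?_ <;>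
    norm_num [TP, TE]

lemma grid_1_97 {α : ℝ} (h1 : 1.24111 ≤ α) (h2 : α ≤ 1.24112) :
    GB α 1.97 0.1394565 0.1394572 0.7358453 0.7358533 := by
  refine GB_of h1 h2 (yl := 0.0867252) (yu := 0.0867276) ?_ ?_ ?_ ?_ ?_ ?_ ?_ ?_ ?_ ?_ <;>
    norm_num [TP, TE]

lemma grid_2_18 {α : ℝ} (h1 : 1.24111 ≤ α) (h2 : α ≤ 1.24112) :
    GB α 2.18 0.1130412 0.1130419 0.7518779 0.7518858 := by
  refine GB_of h1 h2 (yl := 0.0668271) (yu := 0.0668292) ?_ ?_ ?_ ?_ ?_ ?_ ?_ ?_ ?_ ?_ <;>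
    norm_num [TP, TE]

lemma grid_2_48 {α : ℝ} (h1 : 1.24111 ≤ α) (h2 : α ≤ 1.24112) :
    GB α 2.48 0.0837429 0.0837436 0.7686172 0.7686250 := by
  refine GB_of h1 h2 (yl := 0.0460519) (yu := 0.0460538) ?_ ?_ ?_ ?_ ?_ ?_ ?_ ?_ ?_ ?_ <;>
    norm_num [TP, TE]

lemma grid_2_97 {α : ℝ} (h1 : 1.24111 ≤ α) (h2 : α ≤ 1.24112) :
    GB α 2.97 0.0513030 0.0513037 0.7855243 0.7855319 := by
  refine GB_of h1 h2 (yl := 0.0250686) (yu := 0.0250700) ?_ ?_ ?_ ?_ ?_ ?_ ?_ ?_ ?_ ?_ <;>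
    norm_num [TP, TE]

lemma grid_3_4 {α : ℝ} (h1 : 1.24111 ≤ α) (h2 : α ≤ 1.24112) :
    GB α 3.4 0.0333729 0.0333736 0.7938778 0.7938853 := by
  refine GB_of h1 h2 (yl := 0.0147011) (yu := 0.0147023) ?_ ?_ ?_ ?_ ?_ ?_ ?_ ?_ ?_ ?_ <;>
    norm_num [TP, TE]

lemma grid_4_26 {α : ℝ} (h1 : 1.24111 ≤ α) (h2 : α ≤ 1.24112) :
    GB α 4.26 0.0141220 0.0141227 0.8016496 0.8016569 := by
  refine GB_of h1 h2 (yl := 0.0050557) (yu := 0.0050566) ?_ ?_ ?_ ?_ ?_ ?_ ?_ ?_ ?_ ?_ <;>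
    norm_num [TP, TE]

lemma F_0_9 {α p b : ℝ} (h1 : 1.24111 ≤ α) (h2 : α ≤ 1.24112) (hp : 33 / 4 ≤ p)
    (hb0 : 0.9 ≤ b) (hb1 : b ≤ 1.15) : 0 ≤ LF α p 0 b := by
  refine F_box_num (grid_0_9 h1 h2) (grid_1_15 h1 h2) h1 hp ?_ hb0 hb1
    (ρ := 1.09478) (σ := 2.0655) ?_ ?_ ?_ ?_ ?_ <;> norm_num

lemma F_1_15 {α p b : ℝ} (h1 : 1.24111 ≤ α) (h2 : α ≤ 1.24112) (hp : 33 / 4 ≤ p)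
    (hb0 : 1.15 ≤ b) (hb1 : b ≤ 1.43) : 0 ≤ LF α p 0 b := by
  refine F_box_num (grid_1_15 h1 h2) (grid_1_43 h1 h2) h1 hp ?_ hb0 hb1
    (ρ := 1.11589) (σ := 2.3691) ?_ ?_ ?_ ?_ ?_ <;> norm_num

lemma F_1_43 {α p b : ℝ} (h1 : 1.24111 ≤ α) (h2 : α ≤ 1.24112) (hp : 33 / 4 ≤ p)
    (hb0 : 1.43 ≤ b) (hb1 : b ≤ 1.8) : 0 ≤ LF α p 0 b := by
  refine F_box_num (grid_1_43 h1 h2) (grid_1_8 h1 h2) h1 hp ?_ hb0 hb1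
    (ρ := 1.13680) (σ := 2.7793) ?_ ?_ ?_ ?_ ?_ <;> norm_num

lemma F_1_8 {α p b : ℝ} (h1 : 1.24111 ≤ α) (h2 : α ≤ 1.24112) (hp : 33 / 4 ≤ p)
    (hb0 : 1.8 ≤ b) (hb1 : b ≤ 2.18) : 0 ≤ LF α p 0 b := by
  refine F_box_num (grid_1_8 h1 h2) (grid_2_18 h1 h2) h1 hp ?_ hb0 hb1
    (ρ := 1.16021) (σ := 3.1981) ?_ ?_ ?_ ?_ ?_ <;> norm_num

lemma F_2_18 {α p b : ℝ} (h1 : 1.24111 ≤ α) (h2 : α ≤ 1.24112) (hp : 33 / 4 ≤ p)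
    (hb0 : 2.18 ≤ b) (hb1 : b ≤ 2.48) : 0 ≤ LF α p 0 b := by
  refine F_box_num (grid_2_18 h1 h2) (grid_2_48 h1 h2) h1 hp ?_ hb0 hb1
    (ρ := 1.17964) (σ := 3.5183) ?_ ?_ ?_ ?_ ?_ <;> norm_num

lemma F_2_48 {α p b : ℝ} (h1 : 1.24111 ≤ α) (h2 : α ≤ 1.24112) (hp : 33 / 4 ≤ p)
    (hb0 : 2.48 ≤ b) (hb1 : b ≤ 2.97) : 0 ≤ LF α p 0 b := by
  refine F_box_num (grid_2_48 h1 h2) (grid_2_97 h1 h2) h1 hp ?_ hb0 hb1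
    (ρ := 1.19207) (σ := 4.0058) ?_ ?_ ?_ ?_ ?_ <;> norm_num

lemma F_2_97 {α p b : ℝ} (h1 : 1.24111 ≤ α) (h2 : α ≤ 1.24112) (hp : 33 / 4 ≤ p)
    (hb0 : 2.97 ≤ b) (hb1 : b ≤ 3.4) : 0 ≤ LF α p 0 b := by
  refine F_box_num (grid_2_97 h1 h2) (grid_3_4 h1 h2) h1 hp ?_ hb0 hb1
    (ρ := 1.20771) (σ := 4.3863) ?_ ?_ ?_ ?_ ?_ <;> norm_num

lemma F_3_4 {α p b : ℝ} (h1 : 1.24111 ≤ α) (h2 : α ≤ 1.24112) (hp : 33 / 4 ≤ p)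
    (hb0 : 3.4 ≤ b) (hb1 : b ≤ 4.26) : 0 ≤ LF α p 0 b := by
  refine F_box_num (grid_3_4 h1 h2) (grid_4_26 h1 h2) h1 hp ?_ hb0 hb1
    (ρ := 1.21758) (σ := 4.9941) ?_ ?_ ?_ ?_ ?_ <;> norm_num

lemma N_0_9 {α p a b : ℝ} (h1 : 1.24111 ≤ α) (h2 : α ≤ 1.24112) (hp1 : 8.2947 ≤ p) (hp2 : p ≤ 8.29488)
    (hF : ∀ c, 0.9 ≤ c → 0 ≤ LF α p 0 c)
    (ha : 0 ≤ a) (hb0 : 0.9 ≤ b) (hb1 : b ≤ 0.98) : 0 ≤ LF α p a b := by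
  have hN : 0 ≤ NF α p b 0 := by
    refine N_num (grid_0_9 h1 h2) (grid_0_98 h1 h2) h1 hp1 hp2 ?_ hb0 hb1
      (a0 := 0) (r := 0.71601) ?_ ?_ ?_ ?_ ?_ ?_ <;> norm_num
  exact LF_from (by norm_num at h1 ⊢; linarith) (by norm_num at hp1 ⊢; linarith) (by norm_num at hb0 ⊢; linarith) le_rfl ha hN (hF b (by norm_num at hb0 ⊢; linarith))

lemma N_0_98 {α p a b : ℝ} (h1 : 1.24111 ≤ α) (h2 : α ≤ 1.24112) (hp1 : 8.2947 ≤ p) (hp2 : p ≤ 8.29488)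
    (hF : ∀ c, 0.9 ≤ c → 0 ≤ LF α p 0 c)
    (ha : 0 ≤ a) (hb0 : 0.98 ≤ b) (hb1 : b ≤ 1.06) : 0 ≤ LF α p a b := by
  have hN : 0 ≤ NF α p b 0 := by
    refine N_num (grid_0_98 h1 h2) (grid_1_06 h1 h2) h1 hp1 hp2 ?_ hb0 hb1
      (a0 := 0) (r := 0.69779) ?_ ?_ ?_ ?_ ?_ ?_ <;> norm_num
  exact LF_from (by norm_num at h1 ⊢; linarith) (by norm_num at hp1 ⊢; linarith) (by norm_num at hb0 ⊢; linarith) le_rfl ha hN (hF b (by norm_num at hb0 ⊢; linarith))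

lemma N_1_06 {α p a b : ℝ} (h1 : 1.24111 ≤ α) (h2 : α ≤ 1.24112) (hp1 : 8.2947 ≤ p) (hp2 : p ≤ 8.29488)
    (hp : p * (α - 1) = 2) (hF : ∀ c, 0.9 ≤ c → 0 ≤ LF α p 0 c) (hk : ∀ c d, 0.9 ≤ c → c ≤ d → kF α p c ≤ kF α p d)
    (ha : 0 ≤ a) (hb0 : 1.06 ≤ b) (hb1 : b ≤ 1.15) : 0 ≤ LF α p a b := by
  refine N_box (grid_1_06 h1 h2) (grid_1_15 h1 h2) h1 hp1 hp2 hp hF hk ha ?_ hb0 hb1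
    (a0 := 0.06) (r := 0.70741) ?_ ?_ ?_ ?_ ?_ ?_ <;> norm_num

lemma N_1_15 {α p a b : ℝ} (h1 : 1.24111 ≤ α) (h2 : α ≤ 1.24112) (hp1 : 8.2947 ≤ p) (hp2 : p ≤ 8.29488)
    (hp : p * (α - 1) = 2) (hF : ∀ c, 0.9 ≤ c → 0 ≤ LF α p 0 c) (hk : ∀ c d, 0.9 ≤ c → c ≤ d → kF α p c ≤ kF α p d)
    (ha : 0 ≤ a) (hb0 : 1.15 ≤ b) (hb1 : b ≤ 1.24) : 0 ≤ LF α p a b := by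
  refine N_box (grid_1_15 h1 h2) (grid_1_24 h1 h2) h1 hp1 hp2 hp hF hk ha ?_ hb0 hb1
    (a0 := 0.05) (r := 0.68432) ?_ ?_ ?_ ?_ ?_ ?_ <;> norm_num

lemma N_1_24 {α p a b : ℝ} (h1 : 1.24111 ≤ α) (h2 : α ≤ 1.24112) (hp1 : 8.2947 ≤ p) (hp2 : p ≤ 8.29488)
    (hp : p * (α - 1) = 2) (hF : ∀ c, 0.9 ≤ c → 0 ≤ LF α p 0 c) (hk : ∀ c d, 0.9 ≤ c → c ≤ d → kF α p c ≤ kF α p d)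
    (ha : 0 ≤ a) (hb0 : 1.24 ≤ b) (hb1 : b ≤ 1.33) : 0 ≤ LF α p a b := by
  refine N_box (grid_1_24 h1 h2) (grid_1_33 h1 h2) h1 hp1 hp2 hp hF hk ha ?_ hb0 hb1
    (a0 := 0.06) (r := 0.67082) ?_ ?_ ?_ ?_ ?_ ?_ <;> norm_num

lemma N_1_33 {α p a b : ℝ} (h1 : 1.24111 ≤ α) (h2 : α ≤ 1.24112) (hp1 : 8.2947 ≤ p) (hp2 : p ≤ 8.29488)
    (hp : p * (α - 1) = 2) (hF : ∀ c, 0.9 ≤ c → 0 ≤ LF α p 0 c) (hk : ∀ c d, 0.9 ≤ c → c ≤ d → kF α p c ≤ kF α p d)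
    (ha : 0 ≤ a) (hb0 : 1.33 ≤ b) (hb1 : b ≤ 1.43) : 0 ≤ LF α p a b := by
  refine N_box (grid_1_33 h1 h2) (grid_1_43 h1 h2) h1 hp1 hp2 hp hF hk ha ?_ hb0 hb1
    (a0 := 0.11) (r := 0.67436) ?_ ?_ ?_ ?_ ?_ ?_ <;> norm_num

lemma N_1_43 {α p a b : ℝ} (h1 : 1.24111 ≤ α) (h2 : α ≤ 1.24112) (hp1 : 8.2947 ≤ p) (hp2 : p ≤ 8.29488)
    (hp : p * (α - 1) = 2) (hF : ∀ c, 0.9 ≤ c → 0 ≤ LF α p 0 c) (hk : ∀ c d, 0.9 ≤ c → c ≤ d → kF α p c ≤ kF α p d)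
    (ha : 0 ≤ a) (hb0 : 1.43 ≤ b) (hb1 : b ≤ 1.54) : 0 ≤ LF α p a b := by
  refine N_box (grid_1_43 h1 h2) (grid_1_54 h1 h2) h1 hp1 hp2 hp hF hk ha ?_ hb0 hb1
    (a0 := 0.15) (r := 0.67195) ?_ ?_ ?_ ?_ ?_ ?_ <;> norm_num

lemma N_1_54 {α p a b : ℝ} (h1 : 1.24111 ≤ α) (h2 : α ≤ 1.24112) (hp1 : 8.2947 ≤ p) (hp2 : p ≤ 8.29488)
    (hp : p * (α - 1) = 2) (hF : ∀ c, 0.9 ≤ c → 0 ≤ LF α p 0 c) (hk : ∀ c d, 0.9 ≤ c → c ≤ d → kF α p c ≤ kF α p d)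
    (ha : 0 ≤ a) (hb0 : 1.54 ≤ b) (hb1 : b ≤ 1.66) : 0 ≤ LF α p a b := by
  refine N_box (grid_1_54 h1 h2) (grid_1_66 h1 h2) h1 hp1 hp2 hp hF hk ha ?_ hb0 hb1
    (a0 := 0.17) (r := 0.66092) ?_ ?_ ?_ ?_ ?_ ?_ <;> norm_num

lemma N_1_66 {α p a b : ℝ} (h1 : 1.24111 ≤ α) (h2 : α ≤ 1.24112) (hp1 : 8.2947 ≤ p) (hp2 : p ≤ 8.29488)
    (hp : p * (α - 1) = 2) (hF : ∀ c, 0.9 ≤ c → 0 ≤ LF α p 0 c) (hk : ∀ c d, 0.9 ≤ c → c ≤ d → kF α p c ≤ kF α p d)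
    (ha : 0 ≤ a) (hb0 : 1.66 ≤ b) (hb1 : b ≤ 1.8) : 0 ≤ LF α p a b := by
  refine N_box (grid_1_66 h1 h2) (grid_1_8 h1 h2) h1 hp1 hp2 hp hF hk ha ?_ hb0 hb1
    (a0 := 0.22) (r := 0.65994) ?_ ?_ ?_ ?_ ?_ ?_ <;> norm_num

lemma N_1_8 {α p a b : ℝ} (h1 : 1.24111 ≤ α) (h2 : α ≤ 1.24112) (hp1 : 8.2947 ≤ p) (hp2 : p ≤ 8.29488)
    (hp : p * (α - 1) = 2) (hF : ∀ c, 0.9 ≤ c → 0 ≤ LF α p 0 c) (hk : ∀ c d, 0.9 ≤ c → c ≤ d → kF α p c ≤ kF α p d)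
    (ha : 0 ≤ a) (hb0 : 1.8 ≤ b) (hb1 : b ≤ 1.97) : 0 ≤ LF α p a b := by
  refine N_box (grid_1_8 h1 h2) (grid_1_97 h1 h2) h1 hp1 hp2 hp hF hk ha ?_ hb0 hb1
    (a0 := 0.27) (r := 0.65656) ?_ ?_ ?_ ?_ ?_ ?_ <;> norm_num

lemma N_1_97 {α p a b : ℝ} (h1 : 1.24111 ≤ α) (h2 : α ≤ 1.24112) (hp1 : 8.2947 ≤ p) (hp2 : p ≤ 8.29488)
    (hp : p * (α - 1) = 2) (hF : ∀ c, 0.9 ≤ c → 0 ≤ LF α p 0 c) (hk : ∀ c d, 0.9 ≤ c → c ≤ d → kF α p c ≤ kF α p d)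
    (ha : 0 ≤ a) (hb0 : 1.97 ≤ b) (hb1 : b ≤ 2.18) : 0 ≤ LF α p a b := by
  refine N_box (grid_1_97 h1 h2) (grid_2_18 h1 h2) h1 hp1 hp2 hp hF hk ha ?_ hb0 hb1
    (a0 := 0.28) (r := 0.63727) ?_ ?_ ?_ ?_ ?_ ?_ <;> norm_num

lemma N_2_18 {α p a b : ℝ} (h1 : 1.24111 ≤ α) (h2 : α ≤ 1.24112) (hp1 : 8.2947 ≤ p) (hp2 : p ≤ 8.29488)
    (hp : p * (α - 1) = 2) (hF : ∀ c, 0.9 ≤ c → 0 ≤ LF α p 0 c) (hk : ∀ c d, 0.9 ≤ c → c ≤ d → kF α p c ≤ kF α p d)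
    (ha : 0 ≤ a) (hb0 : 2.18 ≤ b) (hb1 : b ≤ 2.48) : 0 ≤ LF α p a b := by
  refine N_box (grid_2_18 h1 h2) (grid_2_48 h1 h2) h1 hp1 hp2 hp hF hk ha ?_ hb0 hb1
    (a0 := 0.38) (r := 0.64393) ?_ ?_ ?_ ?_ ?_ ?_ <;> norm_num

lemma N_2_48 {α p a b : ℝ} (h1 : 1.24111 ≤ α) (h2 : α ≤ 1.24112) (hp1 : 8.2947 ≤ p) (hp2 : p ≤ 8.29488)
    (hp : p * (α - 1) = 2) (hF : ∀ c, 0.9 ≤ c → 0 ≤ LF α p 0 c) (hk : ∀ c d, 0.9 ≤ c → c ≤ d → kF α p c ≤ kF α p d)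
    (ha : 0 ≤ a) (hb0 : 2.48 ≤ b) (hb1 : b ≤ 2.97) : 0 ≤ LF α p a b := by
  refine N_box (grid_2_48 h1 h2) (grid_2_97 h1 h2) h1 hp1 hp2 hp hF hk ha ?_ hb0 hb1
    (a0 := 0.43) (r := 0.62818) ?_ ?_ ?_ ?_ ?_ ?_ <;> norm_num

lemma N_2_97 {α p a b : ℝ} (h1 : 1.24111 ≤ α) (h2 : α ≤ 1.24112) (hp1 : 8.2947 ≤ p) (hp2 : p ≤ 8.29488)
    (hp : p * (α - 1) = 2) (hF : ∀ c, 0.9 ≤ c → 0 ≤ LF α p 0 c) (hk : ∀ c d, 0.9 ≤ c → c ≤ d → kF α p c ≤ kF α p d)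
    (ha : 0 ≤ a) (hb0 : 2.97 ≤ b) (hb1 : b ≤ 4.26) : 0 ≤ LF α p a b := by
  refine N_box (grid_2_97 h1 h2) (grid_4_26 h1 h2) h1 hp1 hp2 hp hF hk ha ?_ hb0 hb1
    (a0 := 0.55) (r := 0.62247) ?_ ?_ ?_ ?_ ?_ ?_ <;> norm_num

lemma y_ratio_num {α : ℝ} (h1 : 1.24111 ≤ α) : Real.exp (-((α - 1) * 0.9)) ≤ 0.805 := by
  have h := (exp_num (z := 0.216999) (l := 0) (u := 0.805) (by norm_num) (by norm_num)
    (by norm_num [TP, TE]) (by norm_num [TP, TE]) (by norm_num [TP, TE])).2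
  refine le_trans (Real.exp_le_exp.2 ?_) h
  norm_num at *
  linarith

lemma kF_mono_num {α p : ℝ} (h1 : 1.24111 ≤ α) (hp1 : 8.2947 ≤ p) (c d : ℝ) (hc : 0.9 ≤ c) (hcd : c ≤ d) :
    kF α p c ≤ kF α p d := by
  have hp0 : 0 < p := lt_of_lt_of_le (by norm_num) hp1
  refine kF_mono (b0 := 0.9) (lt_of_lt_of_le (by norm_num) h1) hp0 ?_ hc hcd
  have := mul_le_mul_of_nonneg_left (y_ratio_num h1) (show 0 ≤ p + 3 by linarith)
  norm_num at *
  linarith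

lemma kF_nonpos_num {α p : ℝ} (h1 : 1.24111 ≤ α) (h2 : α ≤ 1.24112) (hp1 : 8.2947 ≤ p) (hp2 : p ≤ 8.29488) :
    kF α p 0.9 ≤ 0 := by
  obtain ⟨gx, -, gt, -⟩ := grid_0_9 h1 h2
  have s1 : sF 0.9 ≤ 1 - 0.4065693 := by unfold sF; linarith
  have hd : 0 ≤ sF 0.9 - tF α 0.9 := by
    have := tF_le_sF (b := 0.9) (lt_of_lt_of_le (by norm_num) h1); linarith
  have := mul_nonneg (show 0 ≤ 8.29488 - p by linarith) hd
  unfold kF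
  norm_num at *
  linarith

lemma F_all {α p c : ℝ} (h1 : 1.24111 ≤ α) (h2 : α ≤ 1.24112) (hp1 : 8.2947 ≤ p) (hp2 : p ≤ 8.29488)
    (h6 : p * Real.log α = Real.log 6) (hc : 0.9 ≤ c) : 0 ≤ LF α p 0 c := by
  have hp : 33 / 4 ≤ p := le_trans (by norm_num) hp1
  rcases le_total c 1.15 with h | g1
  · exact F_0_9 h1 h2 hp hc h
  rcases le_total c 1.43 with h | g2
  · exact F_1_15 h1 h2 hp g1 h
  rcases le_total c 1.8 with h | g3
  · exact F_1_43 h1 h2 hp g2 h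
  rcases le_total c 2.18 with h | g4
  · exact F_1_8 h1 h2 hp g3 h
  rcases le_total c 2.48 with h | g5
  · exact F_2_18 h1 h2 hp g4 h
  rcases le_total c 2.97 with h | g6
  · exact F_2_48 h1 h2 hp g5 h
  rcases le_total c 3.4 with h | g7
  · exact F_2_97 h1 h2 hp g6 h
  rcases le_total c 4.26 with h | g8
  · exact F_3_4 h1 h2 hp g7 h
  exact F_large (lt_of_lt_of_le (by norm_num) h1) (by linarith) (hp2.trans (by norm_num)) h6
    (le_trans (by norm_num) g8)

lemma L_all {α p a b : ℝ} (h1 : 1.24111 ≤ α) (h2 : α ≤ 1.24112) (hp1 : 8.2947 ≤ p) (hp2 : p ≤ 8.29488)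
    (hp : p * (α - 1) = 2) (h6 : p * Real.log α = Real.log 6) (ha : 0 ≤ a) (hb : 0 ≤ b) (hab : 0 < a + b) :
    0 ≤ LF α p a b := by
  have hα : 1 < α := lt_of_lt_of_le (by norm_num) h1
  have hp0 : 0 < p := lt_of_lt_of_le (by norm_num) hp1
  have hF : ∀ c, 0.9 ≤ c → 0 ≤ LF α p 0 c := fun c hc => F_all h1 h2 hp1 hp2 h6 hc
  have hk : ∀ c d, 0.9 ≤ c → c ≤ d → kF α p c ≤ kF α p d := kF_mono_num h1 hp1
  rcases le_total b 0.9 with h | g0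
  · exact LF_small hα hp (fun c h0 hc => kF_nonpos hα hp0 h0 hc (kF_nonpos_num h1 h2 hp1 hp2)) ha hb hab h
  rcases le_total b 0.98 with h | g1
  · exact N_0_9 h1 h2 hp1 hp2 hF ha g0 h
  rcases le_total b 1.06 with h | g2
  · exact N_0_98 h1 h2 hp1 hp2 hF ha g1 h
  rcases le_total b 1.15 with h | g3
  · exact N_1_06 h1 h2 hp1 hp2 hp hF hk ha g2 h
  rcases le_total b 1.24 with h | g4
  · exact N_1_15 h1 h2 hp1 hp2 hp hF hk ha g3 h
  rcases le_total b 1.33 with h | g5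
  · exact N_1_24 h1 h2 hp1 hp2 hp hF hk ha g4 h
  rcases le_total b 1.43 with h | g6
  · exact N_1_33 h1 h2 hp1 hp2 hp hF hk ha g5 h
  rcases le_total b 1.54 with h | g7
  · exact N_1_43 h1 h2 hp1 hp2 hp hF hk ha g6 h
  rcases le_total b 1.66 with h | g8
  · exact N_1_54 h1 h2 hp1 hp2 hp hF hk ha g7 h
  rcases le_total b 1.8 with h | g9
  · exact N_1_66 h1 h2 hp1 hp2 hp hF hk ha g8 h
  rcases le_total b 1.97 with h | g10
  · exact N_1_8 h1 h2 hp1 hp2 hp hF hk ha g9 h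
  rcases le_total b 2.18 with h | g11
  · exact N_1_97 h1 h2 hp1 hp2 hp hF hk ha g10 h
  rcases le_total b 2.48 with h | g12
  · exact N_2_18 h1 h2 hp1 hp2 hp hF hk ha g11 h
  rcases le_total b 2.97 with h | g13
  · exact N_2_48 h1 h2 hp1 hp2 hp hF hk ha g12 h
  rcases le_total b 4.26 with h | g14
  · exact N_2_97 h1 h2 hp1 hp2 hp hF hk ha g13 h
  have gr := grid_4_26 h1 h2
  refine N_from (b0 := 4.26) (a0 := 0.14) hα hp0 hp hF hk (by norm_num) g14
    (kF_num gr hp1 (by norm_num) (by norm_num)) (by norm_num) ?_ ha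
  refine NF_nonneg_of (r := 0.42985) (q := 3 - 3 * 0.42985) hα (by norm_num) (by linarith)
    ((ratio_anti (by norm_num) (by norm_num) g14).trans
      (ratio_num gr (by norm_num) (by norm_num) (by norm_num) (by norm_num))) ?_ le_rfl
  refine (delta_inf hα hp hp0 (by norm_num) (by linarith)).trans ?_
  rw [div_le_iff₀ (by positivity)]
  norm_num at *
  linarith

lemma integral_UF (a b : ℝ) :
    a ^ 3 / 3 + ∫ x in (0 : ℝ)..b, (x + a) ^ 2 * Real.exp (-x) = UF a b / 3 := by
  have h : ∫ x in (0 : ℝ)..b, (x + a) ^ 2 * Real.exp (-x) =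
      (a ^ 2 * sF b + 2 * a * m1F b + m2F b) - (a ^ 2 * sF 0 + 2 * a * m1F 0 + m2F 0) := by
    refine integral_eq_sub_of_hasDerivAt (f := fun b => a ^ 2 * sF b + 2 * a * m1F b + m2F b)
      (fun x _ => ?_) (Continuous.intervalIntegrable (by fun_prop) _ _)
    exact hd_conv ((((sF_deriv x).const_mul (a ^ 2)).add ((m1F_deriv x).const_mul (2 * a))).add
      (m2F_deriv x)) (fun y => rfl) (by ring)
  rw [h, sF_zero, m1F_zero, m2F_zero]
  unfold UF
  ring

/-- `G(a,b,α*) ≥ 0` for all `a, b ≥ 0`, where `α*` is the unique solution in `(1,∞)` of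
`(1/(α−1))·log α = ½·log 6`. -/
theorem G_nonneg_at_alphaStar
    (αs : ℝ) (hαs1 : 1 < αs)
    (hαseq : (1 / (αs - 1)) * Real.log αs = (1 / 2) * Real.log 6) :
    ∀ a b : ℝ, 0 ≤ a → 0 ≤ b → 0 ≤ G a b αs := by
  intro a b ha hb
  have hα1 : 0 < αs - 1 := by linarith
  have h6 : 2 * Real.log αs = (αs - 1) * Real.log 6 := by
    field_simp at hαseq
    linarith
  have hlo := alpha_lo hαs1 h6
  have hhi := alpha_hi hαs1 h6
  obtain ⟨p, hpdef⟩ : ∃ p : ℝ, p = 2 / (αs - 1) := ⟨_, rfl⟩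
  have hp : p * (αs - 1) = 2 := by rw [hpdef]; field_simp
  have hp6 : p * Real.log αs = Real.log 6 := by
    have : (αs - 1) * (p * Real.log αs - Real.log 6) = 0 := by
      linear_combination (Real.log αs) * hp + h6
    rcases mul_eq_zero.1 this with h | h <;> linarith
  have hp1 : 8.2947 ≤ p := by
    rw [hpdef, le_div_iff₀ hα1]; norm_num; linarith
  have hp2 : p ≤ 8.29488 := by
    rw [hpdef, div_le_iff₀ hα1]; norm_num; linarith
  have hα2 : 1.24111 ≤ αs := le_trans (by norm_num) hlo
  have hα3 : αs ≤ 1.24112 := le_trans hhi (by norm_num)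
  have hp0 : 0 < p := lt_of_lt_of_le (by norm_num) hp1
  have hne : 1 - αs ≠ 0 := by linarith
  have e1 : 2 / (1 - αs) = -p := by
    rw [div_eq_iff hne]; linarith
  have e2 : (1 - 3 * αs) / (1 - αs) = 3 + p := by
    rw [div_eq_iff hne]; linarith
  unfold G
  rw [integral_UF, e1, e2]
  rcases (add_nonneg ha hb).eq_or_lt with h0 | hab
  · have ha' : a = 0 := by linarith
    have hb' : b = 0 := by linarith
    subst ha' hb'
    have : UF 0 0 = 0 := by simp [UF, m2F_zero]
    rw [this]
    have e3 : (0 + 1 - Real.exp (-(0 : ℝ)) : ℝ) = 0 := by simp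
    rw [e3, Real.zero_rpow (by linarith)]
    simp
  · have hL := L_all hα2 hα3 hp1 hp2 hp hp6 ha hb hab
    have hA := A_pos ha hb hab
    have hM := M_pos hαs1 ha hb hab
    have hU := UF_pos ha hb hab
    have hα0 : 0 < αs := by linarith
    have eA : a + 1 - Real.exp (-b) = a + sF b := by unfold sF; ring
    have eM : a * αs + 1 - Real.exp (-(αs * b)) = αs * (a + tF αs b) := by
      unfold tF; field_simp; ring
    rw [eA, eM, Real.mul_rpow hα0.le hM.le]
    have e4 : αs ^ (-p) = 1 / 6 := by
      rw [Real.rpow_def_of_pos hα0]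
      have : Real.log αs * -p = -Real.log 6 := by linarith
      rw [this, Real.exp_neg, Real.exp_log (by norm_num)]
      norm_num
    have key : UF a b ≤ (a + tF αs b) ^ (-p) * (a + sF b) ^ (3 + p) := by
      rw [Real.rpow_def_of_pos hM, Real.rpow_def_of_pos hA, ← Real.exp_add]
      rw [← Real.log_le_iff_le_exp hU]
      unfold LF at hL
      linarith
    rw [e4]
    linarith
end

section
/- Define G(a,b,α) = 2·(aα + 1 − e^{−αb})^{2/(1−α)}·(a + 1 − e^{−b})^{(1−3α)/(1−α)} − (a³/3 + ∫₀ᵇ (x+a)²·e^{−x} dx). For every α > 1/3 with α ≠ 1 and every b ≥ 0, the fourth partial derivative of G with respect to a is nonnegative for all a ≥ 0; explicitly, ∂⁴G/∂a⁴ = 8α(α+1)(3α−1)·(1+a−e^{−b})^{(3α−1)/(α−1)}·(1+aα−e^{−bα})^{2/(1−α)}·((e^b − α e^{bα} + (α−1)e^{b+bα})/((α−1)(e^b(a+1)−1)(e^{bα}(aα+1)−1)))⁴ ≥ 0. -/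
open MeasureTheory Real intervalIntegral

/-- product of two real powers of affine functions -/
noncomputable def TT (α c d s t x : ℝ) : ℝ := (x * α + 1 - c) ^ s * (x + 1 - d) ^ t

lemma TT_deriv (α c d s t x : ℝ) (hu : 0 < x * α + 1 - c) (hv : 0 < x + 1 - d) :
    HasDerivAt (TT α c d s t)
      (s * α * TT α c d (s - 1) t x + t * TT α c d s (t - 1) x) x := by
  have h1 : HasDerivAt (fun x : ℝ => x * α + 1 - c) α x := by
    simpa using (((hasDerivAt_id x).mul_const α).add_const 1).sub_const c
  have h2 : HasDerivAt (fun x : ℝ => x + 1 - d) 1 x := by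
    simpa using ((hasDerivAt_id x).add_const 1).sub_const d
  have h := (h1.rpow_const (p := s) (Or.inl hu.ne')).mul (h2.rpow_const (p := t) (Or.inl hv.ne'))
  refine h.congr_deriv ?_
  unfold TT
  ring

lemma iter_four (F0 F1 F2 F3 F4 : ℝ → ℝ)
    (h0 : ∀ x, 0 ≤ x → HasDerivAt F0 (F1 x) x)
    (h1 : ∀ x, 0 ≤ x → HasDerivAt F1 (F2 x) x)
    (h2 : ∀ x, 0 ≤ x → HasDerivAt F2 (F3 x) x)
    (h3 : ∀ x, 0 ≤ x → HasDerivAt F3 (F4 x) x) (f : ℝ → ℝ)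
    (hf : ∀ x, 0 ≤ x → f x = F0 x) (a : ℝ) (ha : 0 ≤ a) :
    iteratedDerivWithin 4 f (Set.Ici 0) a = F4 a := by
  have step : ∀ (n : ℕ) (A B : ℝ → ℝ), (∀ x, 0 ≤ x → HasDerivAt A (B x) x) →
      (∀ x, 0 ≤ x → iteratedDerivWithin n f (Set.Ici 0) x = A x) →
      (∀ x, 0 ≤ x → iteratedDerivWithin (n+1) f (Set.Ici 0) x = B x) := by
    intro n A B hAB hA x hx
    rw [iteratedDerivWithin_succ]
    rw [derivWithin_congr (s := Set.Ici 0) (f := A) (fun y hy => hA y hy) (hA x hx)]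
    exact (hAB x hx).hasDerivWithinAt.derivWithin (uniqueDiffOn_Ici 0 x hx)
  refine step 3 F3 F4 h3 (step 2 F2 F3 h2 (step 1 F1 F2 h1 (step 0 F0 F1 h0 ?_))) a ha
  intro x hx
  simpa using hf x hx

lemma G_int (b a : ℝ) : ∫ x in (0 : ℝ)..b, (x + a) ^ 2 * Real.exp (-x) =
    (∫ x in (0 : ℝ)..b, x ^ 2 * Real.exp (-x)) + (2 * ∫ x in (0 : ℝ)..b, x * Real.exp (-x)) * a
     + (∫ x in (0 : ℝ)..b, Real.exp (-x)) * a ^ 2 := by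
  have i1 : IntervalIntegrable (fun x : ℝ => x ^ 2 * Real.exp (-x)) volume 0 b :=
    Continuous.intervalIntegrable (by fun_prop) _ _
  have i2 : IntervalIntegrable (fun x : ℝ => (2 * a) * (x * Real.exp (-x))) volume 0 b :=
    Continuous.intervalIntegrable (by fun_prop) _ _
  have i3 : IntervalIntegrable (fun x : ℝ => a ^ 2 * Real.exp (-x)) volume 0 b :=
    Continuous.intervalIntegrable (by fun_prop) _ _
  have : ∀ x : ℝ, (x + a) ^ 2 * Real.exp (-x) =
    x ^ 2 * Real.exp (-x) + (2 * a) * (x * Real.exp (-x)) + a ^ 2 * Real.exp (-x) := by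
    intro x; ring
  simp_rw [this]
  rw [intervalIntegral.integral_add (i1.add i2) i3, intervalIntegral.integral_add i1 i2,
    intervalIntegral.integral_const_mul, intervalIntegral.integral_const_mul]
  ring

lemma poly_deriv (k c0 c1 c2 c3 x : ℝ) : HasDerivAt
    (fun x : ℝ => c0 + c1 * x + c2 * x ^ 2 + c3 * x ^ 3) (c1 + 2 * c2 * x + 3 * c3 * x ^ 2) x := by
  have h := ((((hasDerivAt_id x).const_mul c1).const_add c0).add
    ((hasDerivAt_pow 2 x).const_mul c2)).add ((hasDerivAt_pow 3 x).const_mul c3)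
  refine h.congr_deriv ?_
  simp; ring

lemma TT_shift (α c d s t x : ℝ) (i j : ℕ) (hu : 0 < x * α + 1 - c) (hv : 0 < x + 1 - d) :
    TT α c d (s - i) (t - j) x =
      TT α c d s t x / ((x * α + 1 - c) ^ i * (x + 1 - d) ^ j) := by
  unfold TT
  rw [Real.rpow_sub_natCast hu.ne', Real.rpow_sub_natCast hv.ne']
  field_simp

lemma poly_iter (k0 k1 k2 k3 : ℝ) (α c d p q : ℝ)
    (hu : ∀ x, 0 ≤ x → 0 < x * α + 1 - c) (hv : ∀ x, 0 ≤ x → 0 < x + 1 - d)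
    (hpq : p + q = 3) (f : ℝ → ℝ)
    (hf : ∀ x, 0 ≤ x → f x = 2 * TT α c d p q x + (k0 + k1 * x + k2 * x ^ 2 + k3 * x ^ 3))
    (a : ℝ) (ha : 0 ≤ a) :
    iteratedDerivWithin 4 f (Set.Ici 0) a =
      2 * (p * (p - 1) * (p - 2) * (p - 3)) * TT α c d p q a *
        ((α * (a + 1 - d) - (a * α + 1 - c)) /
          ((a * α + 1 - c) * (a + 1 - d))) ^ 4 := by
  have D : ∀ s t x, 0 ≤ x → HasDerivAt (TT α c d s t)
      (s * α * TT α c d (s - 1) t x + t * TT α c d s (t - 1) x) x :=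
    fun s t x hx => TT_deriv α c d s t x (hu x hx) (hv x hx)
  have e2 : ∀ s : ℝ, s - 1 - 1 = s - 2 := fun s => by ring
  have e3 : ∀ s : ℝ, s - 2 - 1 = s - 3 := fun s => by ring
  have e4 : ∀ s : ℝ, s - 3 - 1 = s - 4 := fun s => by ring
  let T := TT α c d
  have key := iter_four
    (fun x => 2 * T p q x + (k0 + k1 * x + k2 * x ^ 2 + k3 * x ^ 3))
    (fun x => 2 * (p * α * T (p-1) q x + q * T p (q-1) x)
      + (k1 + (2 * k2) * x + (3 * k3) * x ^ 2 + 0 * x ^ 3))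
    (fun x => 2 * (p * (p-1) * α^2 * T (p-2) q x + 2 * p * q * α * T (p-1) (q-1) x
      + q * (q-1) * T p (q-2) x)
      + (2 * k2 + (6 * k3) * x + 0 * x ^ 2 + 0 * x ^ 3))
    (fun x => 2 * (p * (p-1) * (p-2) * α^3 * T (p-3) q x
      + 3 * p * (p-1) * q * α^2 * T (p-2) (q-1) x
      + 3 * p * q * (q-1) * α * T (p-1) (q-2) x
      + q * (q-1) * (q-2) * T p (q-3) x)
      + (6 * k3 + 0 * x + 0 * x ^ 2 + 0 * x ^ 3))
    (fun x => 2 * (p * (p-1) * (p-2) * (p-3) * α^4 * T (p-4) q x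
      + 4 * p * (p-1) * (p-2) * q * α^3 * T (p-3) (q-1) x
      + 6 * p * (p-1) * q * (q-1) * α^2 * T (p-2) (q-2) x
      + 4 * p * q * (q-1) * (q-2) * α * T (p-1) (q-3) x
      + q * (q-1) * (q-2) * (q-3) * T p (q-4) x))
    ?_ ?_ ?_ ?_ f hf a ha
  · rw [key]
    have S : ∀ i j : ℕ, _ := fun i j => TT_shift α c d p q a i j (hu a ha) (hv a ha)
    have s40 := S 4 0
    have s31 := S 3 1
    have s22 := S 2 2
    have s13 := S 1 3
    have s04 := S 0 4
    norm_num at s40 s31 s22 s13 s04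
    simp only [T]
    rw [s40, s31, s22, s13, s04]
    have h1 := (hu a ha).ne'
    have h2 := (hv a ha).ne'
    obtain rfl : q = 3 - p := by linarith
    generalize TT α c d p (3 - p) a = Z
    generalize a * α + 1 - c = u at *
    generalize a + 1 - d = v at *
    field_simp
    ring
  · intro x hx
    refine HasDerivAt.congr_deriv (((D p q x hx).const_mul 2).add (poly_deriv 0 k0 k1 k2 k3 x)) ?_
    simp only [T]; ring
  · intro x hx
    refine HasDerivAt.congr_deriv (((((D (p-1) q x hx).const_mul (p*α)).add ((D p (q-1) x hx).const_mul q)).const_mul 2).add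
      (poly_deriv 0 k1 (2 * k2) (3 * k3) 0 x)) ?_
    simp only [T, e2]; ring
  · intro x hx
    refine HasDerivAt.congr_deriv ((((((D (p-2) q x hx).const_mul (p*(p-1)*α^2)).add
      ((D (p-1) (q-1) x hx).const_mul (2*p*q*α))).add
      ((D p (q-2) x hx).const_mul (q*(q-1)))).const_mul 2).add
      (poly_deriv 0 (2 * k2) (6 * k3) 0 0 x)) ?_
    simp only [T, e2, e3]; ring
  · intro x hx
    refine HasDerivAt.congr_deriv (((((((D (p-3) q x hx).const_mul (p*(p-1)*(p-2)*α^3)).add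
      ((D (p-2) (q-1) x hx).const_mul (3*p*(p-1)*q*α^2))).add
      ((D (p-1) (q-2) x hx).const_mul (3*p*q*(q-1)*α))).add
      ((D p (q-3) x hx).const_mul (q*(q-1)*(q-2)))).const_mul 2).add
      (poly_deriv 0 (6 * k3) 0 0 0 x)) ?_
    simp only [T, e2, e3, e4]; ring

lemma poly_iter0 (k : ℝ) (f : ℝ → ℝ)
    (hf : ∀ x, 0 ≤ x → f x = k * x ^ 3)
    (a : ℝ) (ha : 0 ≤ a) :
    iteratedDerivWithin 4 f (Set.Ici 0) a = 0 := by
  have key := iter_four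
    (fun x => 0 + 0 * x + 0 * x ^ 2 + k * x ^ 3)
    (fun x => 0 + 0 * x + (3 * k) * x ^ 2 + 0 * x ^ 3)
    (fun x => 0 + (6 * k) * x + 0 * x ^ 2 + 0 * x ^ 3)
    (fun x => 6 * k + 0 * x + 0 * x ^ 2 + 0 * x ^ 3)
    (fun x => 0) ?_ ?_ ?_ ?_ f (by intro x hx; rw [hf x hx]; ring) a ha
  · exact key
  all_goals
    intro x hx
    refine (poly_deriv 0 _ _ _ _ x).congr_deriv ?_
    ring

theorem G_main
    (α : ℝ) (hα : 1 / 3 < α) (hα1 : α ≠ 1) (b : ℝ) (hb : 0 ≤ b)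
    (a : ℝ) (ha : 0 ≤ a) :
    iteratedDerivWithin 4 (fun a => G a b α) (Set.Ici 0) a
        = 8 * α * (α + 1) * (3 * α - 1) *
            (1 + a - Real.exp (-b)) ^ ((3 * α - 1) / (α - 1)) *
            (1 + a * α - Real.exp (-(b * α))) ^ (2 / (1 - α)) *
            ((Real.exp b - α * Real.exp (b * α) + (α - 1) * Real.exp (b + b * α)) /
              ((α - 1) * (Real.exp b * (a + 1) - 1) *
                (Real.exp (b * α) * (a * α + 1) - 1))) ^ 4 := by
  have hα0 : 0 < α := by linarith
  have h1 : (1 - α) ≠ 0 := sub_ne_zero.mpr (Ne.symm hα1)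
  have h1' : (α - 1) ≠ 0 := sub_ne_zero.mpr hα1
  have hq : (1 - 3 * α) / (1 - α) = (3 * α - 1) / (α - 1) := by
    rw [div_eq_div_iff h1 h1']; ring
  have hpq : 2 / (1 - α) + (1 - 3 * α) / (1 - α) = 3 := by
    field_simp; ring
  rcases hb.eq_or_lt with rfl | hb
  · have hR : Real.exp 0 - α * Real.exp (0 * α) + (α - 1) * Real.exp (0 + 0 * α) = 0 := by
      simp
    rw [hR, poly_iter0 (2 * α ^ (2 / (1 - α)) - 1 / 3)]
    · simp
    · intro x hx
      unfold G
      rcases hx.eq_or_lt with rfl | hx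
      · have : 2 / (1 - α) ≠ 0 := div_ne_zero two_ne_zero h1
        simp [Real.zero_rpow this]
      · have e : x ^ (2 / (1 - α)) * x ^ ((1 - 3 * α) / (1 - α)) = x ^ 3 := by
          rw [← Real.rpow_add hx, hpq]; norm_cast
        simp only [mul_zero, neg_zero, Real.exp_zero, add_sub_cancel_right,
          intervalIntegral.integral_same, add_zero]
        rw [Real.mul_rpow hx.le hα0.le]
        linear_combination (2 * α ^ (2 / (1 - α))) * e
    · exact ha
  · have hu : ∀ x, 0 ≤ x → 0 < x * α + 1 - Real.exp (-(α * b)) := by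
      intro x hx
      have : Real.exp (-(α * b)) < 1 := Real.exp_lt_one_iff.mpr (by have := mul_pos hα0 hb; linarith)
      have := mul_nonneg hx hα0.le
      linarith
    have hv : ∀ x, 0 ≤ x → 0 < x + 1 - Real.exp (-b) := by
      intro x hx
      have : Real.exp (-b) < 1 := Real.exp_lt_one_iff.mpr (by linarith)
      linarith
    rw [poly_iter (-(∫ x in (0 : ℝ)..b, x ^ 2 * Real.exp (-x)))
      (-(2 * ∫ x in (0 : ℝ)..b, x * Real.exp (-x))) (-(∫ x in (0 : ℝ)..b, Real.exp (-x)))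
      (-(1/3)) α (Real.exp (-(α * b))) (Real.exp (-b)) _ _ hu hv hpq _ _ a ha]
    · have hu' := (hu a ha).ne'
      have hv' := (hv a ha).ne'
      unfold TT
      rw [← hq, show 1 + a - Real.exp (-b) = a + 1 - Real.exp (-b) by ring,
        show 1 + a * α - Real.exp (-(b * α)) = a * α + 1 - Real.exp (-(α * b)) by
          rw [mul_comm b α]; ring]
      have E1 : Real.exp b * (a + 1) - 1 = Real.exp b * (a + 1 - Real.exp (-b)) := by
        rw [mul_sub, ← Real.exp_add]; simp
      have E2 : Real.exp (b * α) * (a * α + 1) - 1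
          = Real.exp (b * α) * (a * α + 1 - Real.exp (-(α * b))) := by
        rw [mul_sub, ← Real.exp_add, mul_comm b α]; simp
      have E3 : Real.exp b - α * Real.exp (b * α) + (α - 1) * Real.exp (b + b * α)
          = Real.exp b * Real.exp (b * α) *
            (α * (a + 1 - Real.exp (-b)) - (a * α + 1 - Real.exp (-(α * b)))) := by
        have x1 : Real.exp b * Real.exp (-b) = 1 := by rw [← Real.exp_add]; simp
        have x2 : Real.exp (b * α) * Real.exp (-(α * b)) = 1 := by
          rw [← Real.exp_add, mul_comm b α]; simp
        rw [Real.exp_add]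
        linear_combination (α * Real.exp (b * α)) * x1 - Real.exp b * x2
      rw [E1, E2, E3]
      have n1 := (Real.exp_pos b).ne'
      have n2 := (Real.exp_pos (b * α)).ne'
      generalize (a * α + 1 - Real.exp (-(α * b))) ^ (2 / (1 - α)) = X
      generalize (a + 1 - Real.exp (-b)) ^ ((1 - 3 * α) / (1 - α)) = Y
      generalize a * α + 1 - Real.exp (-(α * b)) = u at *
      generalize a + 1 - Real.exp (-b) = v at *
      have C : 2 * (2 / (1 - α) * (2 / (1 - α) - 1) * (2 / (1 - α) - 2) * (2 / (1 - α) - 3))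
          = 8 * α * (α + 1) * (3 * α - 1) / (α - 1) ^ 4 := by
        rw [show (α - 1) ^ 4 = (1 - α) ^ 4 by ring]
        field_simp
        ring
      rw [C]
      field_simp
    · intro x hx
      simp only [G, TT]
      rw [G_int]
      ring

/-- For every `α > 1/3`, `α ≠ 1`, `b ≥ 0`, the fourth partial derivative of `G` with
respect to `a` (taken on the half-line `a ≥ 0`) equals the explicit expression
and is nonnegative for all `a ≥ 0`. -/
theorem fourth_deriv_G_eq_and_nonneg
    (α : ℝ) (hα : 1 / 3 < α) (hα1 : α ≠ 1) (b : ℝ) (hb : 0 ≤ b)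
    (a : ℝ) (ha : 0 ≤ a) :
    iteratedDerivWithin 4 (fun a => G a b α) (Set.Ici 0) a
        = 8 * α * (α + 1) * (3 * α - 1) *
            (1 + a - Real.exp (-b)) ^ ((3 * α - 1) / (α - 1)) *
            (1 + a * α - Real.exp (-(b * α))) ^ (2 / (1 - α)) *
            ((Real.exp b - α * Real.exp (b * α) + (α - 1) * Real.exp (b + b * α)) /
              ((α - 1) * (Real.exp b * (a + 1) - 1) *
                (Real.exp (b * α) * (a * α + 1) - 1))) ^ 4
      ∧ 0 ≤ iteratedDerivWithin 4 (fun a => G a b α) (Set.Ici 0) a := by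
  have h := G_main α hα hα1 b hb a ha
  refine ⟨h, ?_⟩
  rw [h]
  have hα0 : 0 < α := by linarith
  have h3 : 0 ≤ 3 * α - 1 := by linarith
  have hu : 0 ≤ 1 + a * α - Real.exp (-(b * α)) := by
    have : Real.exp (-(b * α)) ≤ 1 := Real.exp_le_one_iff.mpr (by have := mul_nonneg hb hα0.le; linarith)
    have := mul_nonneg ha hα0.le
    linarith
  have hv : 0 ≤ 1 + a - Real.exp (-b) := by
    have : Real.exp (-b) ≤ 1 := Real.exp_le_one_iff.mpr (by linarith)
    linarith
  have := Real.rpow_nonneg hu (2 / (1 - α))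
  have := Real.rpow_nonneg hv ((3 * α - 1) / (α - 1))
  have h4 : ∀ z : ℝ, 0 ≤ z ^ 4 := fun z => by positivity
  exact mul_nonneg (by positivity) (h4 _)
end

section
/- Let α* be the unique solution in (1,∞) of (1/(α−1))·log α = (1/2)·log 6. Then for every b ≥ 0, (1 − e^{−α* b})^{2/(1−α*)}·(1 − e^{−b})^{(1−3α*)/(1−α*)} ≥ 1 − ((b² + 2b + 2)/2)·e^{−b}. -/
open Real

lemma poly_one (w : ℝ) (h0 : 0 ≤ w) (h1 : w ≤ 1/2) :
    0 ≤ 1860+2920*w-2840*w^2-10068*w^3-9796*w^4-4768*w^5-1264*w^6-168*w^7-8*w^8 := by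
  have h : ∀ k : ℕ, w^(k+1) ≤ w * (1/2)^k := fun k => by
    rw [pow_succ']
    gcongr
  have := h 1
  have := h 2
  have := h 3
  have := h 4
  have := h 5
  have := h 6
  have := h 7
  norm_num at *
  linarith

lemma poly_two (x : ℝ) (h0 : 0 ≤ x) (h1 : x ≤ 3/4) :
    0 ≤ 48 + 30*x - 6*x^2 - 50*x^3 - 102*x^4 - 84*x^5 - 114*x^6 + 23*x^7 + 163*x^8 + 331*x^9
      + 241*x^10 - 133*x^11 - 166*x^12 - 249*x^13 - 453*x^14 - 188*x^15 := by
  have hd : 0 ≤ 3/4 - x := by linarith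
  have e : 48 + 30*x - 6*x^2 - 50*x^3 - 102*x^4 - 84*x^5 - 114*x^6 + 23*x^7 + 163*x^8 + 331*x^9
      + 241*x^10 - 133*x^11 - 166*x^12 - 249*x^13 - 453*x^14 - 188*x^15 =
    (17179869184/4782969)*x^0*(3/4-x)^15 + (29527900160/531441)*x^1*(3/4-x)^14
    + (638473732096/1594323)*x^2*(3/4-x)^13 + (8526416052224/4782969)*x^3*(3/4-x)^12
    + (969832136704/177147)*x^4*(3/4-x)^11 + (19558102466560/1594323)*x^5*(3/4-x)^10
    + (98868925038592/4782969)*x^6*(3/4-x)^9 + (4709362761728/177147)*x^7*(3/4-x)^8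
    + (13913723125760/531441)*x^8*(3/4-x)^7 + (93755455074304/4782969)*x^9*(3/4-x)^6
    + (5819137903616/531441)*x^10*(3/4-x)^5 + (7040917116160/1594323)*x^11*(3/4-x)^4
    + (5852170163072/4782969)*x^12*(3/4-x)^3 + (38593131728/177147)*x^13*(3/4-x)^2
    + (35632667980/1594323)*x^14*(3/4-x)^1 + (1421928856/4782969)*x^15*(3/4-x)^0 := by
    ring
  rw [e]
  positivity

lemma poly_two' (x : ℝ) (h0 : 0 ≤ x) (h1 : x ≤ 3/4) :
    0 ≤ (61-98*x+41*x^2)*(1+x+x^2+x^3+x^4+x^5)^3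
      - (1+x)^2*((3-3*x^5+(x^5)^2)*(1+x+x^2+x^3+x^4+x^5)^3)
      - (1+x)^2*((1-x^5)^3*(10*(1+x+x^2+x^3+x^4+x^5)^2-45*(x^5*(1+x+x^2+x^3+x^4+x^5))
        +120*(x^5)^2)) := by
  have h := poly_two x h0 h1
  have h5 : x^5 ≤ (3/4)^5 := by gcongr
  have h6 : x^6 ≤ (3/4)^6 := by gcongr
  have h7 : x^7 ≤ (3/4)^7 := by gcongr
  have h8 : x^8 ≤ (3/4)^8 := by gcongr
  have hh : 0 ≤ 394-417*x^5-293*x^6-61*x^7-85*x^8 := by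
    norm_num at *
    linarith
  have h16 : 0 ≤ x^16*(394-417*x^5-293*x^6-61*x^7-85*x^8) := by positivity
  have hr : 0 ≤ 398*x^17+197*x^18+309*x^19+36*x^20+7*x^25+140*x^26+84*x^27 := by positivity
  linarith

lemma log_upper (y : ℝ) (hy : 1 ≤ y) : log y ≤ (y-1)*(y+5)/(4*y+2) := by
  have hm : MonotoneOn (fun y : ℝ => (y-1)*(y+5)/(4*y+2) - log y) (Set.Ici 1) := by
    have hd : ∀ z : ℝ, 1 ≤ z → HasDerivAt (fun y : ℝ => (y-1)*(y+5)/(4*y+2) - log y)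
        (((1*(z+5)+(z-1)*1)*(4*z+2) - (z-1)*(z+5)*(4*1))/(4*z+2)^2 - z⁻¹) z := by
      intro z hz
      refine HasDerivAt.sub (HasDerivAt.div (((hasDerivAt_id' z).sub_const 1).mul
        ((hasDerivAt_id' z).add_const 5)) (((hasDerivAt_id' z).const_mul 4).add_const 2) ?_)
        (Real.hasDerivAt_log ?_)
      · linarith
      · linarith
    refine monotoneOn_of_deriv_nonneg (convex_Ici 1)
      (fun z hz => (hd z hz).continuousAt.continuousWithinAt) ?_ ?_
    · intro z hz
      rw [interior_Ici] at hz
      exact (hd z (le_of_lt hz)).differentiableAt.differentiableWithinAt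
    · intro z hz
      rw [interior_Ici] at hz
      have hz : (1:ℝ) < z := hz
      rw [(hd z hz.le).deriv]
      have : ((1*(z+5)+(z-1)*1)*(4*z+2) - (z-1)*(z+5)*(4*1))/(4*z+2)^2 - z⁻¹
        = 4*(z-1)^3/((4*z+2)^2*z) := by
        field_simp
        ring
      rw [this]
      have : 0 < z - 1 := by linarith
      positivity
  have := hm (Set.mem_Ici.2 le_rfl) (Set.mem_Ici.2 hy) hy
  simp at this
  linarith

lemma concave_aux (b : ℝ) (hb : 0 < b) :
    ConcaveOn ℝ (Set.Ioi 0) (fun s : ℝ => log (1 - exp (-(s*b)))) ∧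
    ConvexOn ℝ (Set.Ioi 0) (fun s : ℝ => log (1 - exp (-(s*b))) - log s) := by
  have hE : ∀ s : ℝ, 0 < s → 0 < 1 - exp (-(s*b)) := by
    intro s hs
    have : exp (-(s*b)) < 1 := by
      rw [exp_lt_one_iff]
      have := mul_pos hs hb
      linarith
    linarith
  have hdE : ∀ s : ℝ, HasDerivAt (fun s : ℝ => exp (-(s*b))) (exp (-(s*b)) * (-(1*b))) s :=
    fun s => ((hasDerivAt_id' s).mul_const b).neg.exp
  have d1 : ∀ s : ℝ, 0 < s → HasDerivAt (fun s : ℝ => log (1 - exp (-(s*b))))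
      (b*exp (-(s*b))/(1 - exp (-(s*b)))) s := by
    intro s hs
    have := ((hdE s).const_sub 1).log (hE s hs).ne'
    convert this using 1
    ring
  have d2 : ∀ s : ℝ, 0 < s → HasDerivAt (fun s : ℝ => b*exp (-(s*b))/(1 - exp (-(s*b))))
      (-(b^2*exp (-(s*b))/(1 - exp (-(s*b)))^2)) s := by
    intro s hs
    have h1 := (hE s hs).ne'
    have := ((hdE s).const_mul b).div ((hdE s).const_sub 1) h1
    refine this.congr_deriv ?_
    field_simp
    ring
  constructor
  · refine concaveOn_of_hasDerivWithinAt2_nonpos (convex_Ioi 0)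
      (fun s hs => (d1 s hs).continuousAt.continuousWithinAt)
      (f' := fun s : ℝ => b*exp (-(s*b))/(1 - exp (-(s*b))))
      (f'' := fun s : ℝ => (-(b^2*exp (-(s*b))/(1 - exp (-(s*b)))^2))) ?_ ?_ ?_
    · intro s hs
      rw [interior_Ioi] at hs
      exact (d1 s hs).hasDerivWithinAt
    · intro s hs
      rw [interior_Ioi] at hs
      exact (d2 s hs).hasDerivWithinAt
    · intro s hs
      have : 0 ≤ (b^2*exp (-(s*b))/(1 - exp (-(s*b)))^2) := by positivity
      linarith
  · have e1 : ∀ s : ℝ, 0 < s → HasDerivAt (fun s : ℝ => log (1 - exp (-(s*b))) - log s)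
      (b*exp (-(s*b))/(1 - exp (-(s*b))) - s⁻¹) s := fun s hs =>
        (d1 s hs).sub (Real.hasDerivAt_log hs.ne')
    have e2 : ∀ s : ℝ, 0 < s → HasDerivAt
      (fun s : ℝ => b*exp (-(s*b))/(1 - exp (-(s*b))) - s⁻¹)
      (-(b^2*exp (-(s*b))/(1 - exp (-(s*b)))^2) - (-(s^2)⁻¹)) s := fun s hs =>
        (d2 s hs).sub (hasDerivAt_inv hs.ne')
    refine convexOn_of_hasDerivWithinAt2_nonneg (convex_Ioi 0)
      (fun s hs => (e1 s hs).continuousAt.continuousWithinAt)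
      (f' := fun s : ℝ => b*exp (-(s*b))/(1 - exp (-(s*b))) - s⁻¹)
      (f'' := fun s : ℝ => (-(b^2*exp (-(s*b))/(1 - exp (-(s*b)))^2)) - (-(s^2)⁻¹)) ?_ ?_ ?_
    · intro s hs
      rw [interior_Ioi] at hs
      exact (e1 s hs).hasDerivWithinAt
    · intro s hs
      rw [interior_Ioi] at hs
      exact (e2 s hs).hasDerivWithinAt
    · intro s hs
      rw [interior_Ioi] at hs
      have hs : 0 < s := hs
      have hE' := hE s hs
      have key : s * b * exp (-(s*b)/2) ≤ 1 - exp (-(s*b)) := by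
        have h : s*b/2 ≤ sinh (s*b/2) := self_le_sinh_iff.2 (by positivity)
        rw [sinh_eq] at h
        have h1 : exp (s*b/2) * exp (-(s*b)/2) = 1 := by
          rw [← exp_add, ← exp_zero]; congr 1; ring
        have h2 : exp (-(s*b)) = exp (-(s*b)/2) * exp (-(s*b)/2) := by
          rw [← exp_add]; congr 1; ring
        have h3 : exp (-(s*b/2)) = exp (-(s*b)/2) := by congr 1; ring
        rw [h3] at h
        rw [h2]
        have h4 := exp_pos (-(s*b)/2)
        nlinarith
      have h2 : exp (-(s*b)) = exp (-(s*b)/2) ^ 2 := by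
          rw [sq, ← exp_add]; congr 1; ring
      have key2 : s^2*(b^2*exp (-(s*b))) ≤ (1 - exp (-(s*b)))^2 := by
        calc s^2*(b^2*exp (-(s*b))) = (s * b * exp (-(s*b)/2))^2 := by rw [h2]; ring
          _ ≤ _ := by gcongr
      have : b^2*exp (-(s*b))/(1 - exp (-(s*b)))^2 ≤ (s^2)⁻¹ := by
        rw [div_le_iff₀ (by positivity), inv_mul_eq_div, le_div_iff₀ (by positivity)]
        linarith
      linarith

lemma L_pos (b : ℝ) (hb : 0 < b) : 0 < 1 - (b^2+2*b+2)/2*exp (-b) := by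
  have h := Real.sum_le_exp_of_nonneg hb.le 4
  simp [Finset.sum_range_succ, Nat.factorial] at h
  have h1 : exp b * exp (-b) = 1 := by rw [← exp_add]; simp
  have h2 := exp_pos (-b)
  have h3 : 0 < b^3 := by positivity
  have h4 : 0 < (exp b - (b^2+2*b+2)/2) * exp (-b) := by
    apply mul_pos _ h2
    nlinarith
  nlinarith

lemma L_upper (b : ℝ) (hb : 0 < b) (hb1 : b ≤ 1/2) :
    1 - (b^2+2*b+2)/2*exp (-b) ≤ b^3/6*(1+b) := by
  have h := Real.exp_bound (x := -b) (by rw [abs_neg, abs_of_pos hb]; linarith) (n := 4) (by norm_num)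
  simp [Finset.sum_range_succ, Nat.factorial] at h
  rw [abs_of_pos hb] at h
  have h' := (abs_le.1 h).1
  have hE : 1 - b + b^2/2 - b^3/6 - b^4*(5/96) ≤ exp (-b) := by
    norm_num at h'
    nlinarith
  have : (b^2+2*b+2)/2*(1 - b + b^2/2 - b^3/6 - b^4*(5/96)) ≤ (b^2+2*b+2)/2*exp (-b) := by
    gcongr
  have h4 : 0 < b^4 := by positivity
  have : 0 ≤ b^4 * (1/2-b) := mul_nonneg h4.le (by linarith)
  have : 0 ≤ b^4 * (1/2-b) * b := by positivity
  nlinarith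

lemma region_two (b : ℝ) (hb : 0 < b) (hx : exp (-b/5) ≤ 3/4) :
    1 - (b^2+2*b+2)/2*exp (-b) ≤
      (1 - exp (-b))^3 * ((1 - exp (-b))/(1 - exp (-(6/5*b))))^10 := by
  have hX : exp (-b) = exp (-b/5)^5 := by rw [← exp_nat_mul]; congr 1; push_cast; ring
  have hX6 : exp (-(6/5*b)) = exp (-b/5)^6 := by rw [← exp_nat_mul]; congr 1; push_cast; ring
  have hlog : 10*(1-exp (-b/5))/(1+exp (-b/5)) ≤ b := by
    have h := le_log_one_add_of_nonneg (x := exp (b/5) - 1) (by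
      have := one_le_exp (x := b/5) (by positivity); linarith)
    rw [show 1 + (exp (b/5) - 1) = exp (b/5) by ring, log_exp] at h
    have e : exp (-b/5) = (exp (b/5))⁻¹ := by rw [← exp_neg]; congr 1; ring
    have h0 := exp_pos (b/5)
    have e2 : 10*(1-exp (-b/5))/(1+exp (-b/5)) = 5*(2*(exp (b/5) - 1)/(exp (b/5) - 1+2)) := by
      rw [e]
      have : exp (b/5) - 1+2 ≠ 0 := by linarith
      field_simp
      ring
    rw [e2]
    linarith
  rw [hX, hX6]
  have x0 := exp_pos (-b/5)
  generalize exp (-b/5) = x at *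
  have hS : 1 ≤ 1+x+x^2+x^3+x^4+x^5 := by
    have : 0 ≤ x+x^2+x^3+x^4+x^5 := by positivity
    linarith
  have hp := poly_two' x x0.le hx
  have hr : (1 - x^5)/(1-x^6) = 1 - x^5/(1+x+x^2+x^3+x^4+x^5) := by
    have h1 : 1 - x^6 = (1-x)*(1+x+x^2+x^3+x^4+x^5) := by ring
    have h2 : 1 - x ≠ 0 := by linarith
    rw [h1]
    field_simp
    ring
  rw [hr]
  have hX5 : x^5 ≤ (3/4)^5 := by gcongr
  have hX0 : 0 < x^5 := by positivity
  set S := 1+x+x^2+x^3+x^4+x^5 with hSdef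
  clear_value S
  generalize x^5 = X at *
  have hS0 : 0 < S := by linarith
  have hd0 : 0 ≤ X/S := by positivity
  have hd1 : X/S ≤ 1/4 := by
    rw [div_le_iff₀ hS0]
    norm_num at hX5
    linarith
  have hpow : 1-10*(X/S)+45*(X/S)^2-120*(X/S)^3 ≤ (1-X/S)^10 := by
    generalize X/S = d at *
    have e : (1-d)^10 - (1-10*d+45*d^2-120*d^3)
      = d^4*((210-252*d)+d^2*(210-120*d)+d^4*(45-10*d)+d^6) := by ring
    have : 0 ≤ 210-252*d := by linarith
    have : 0 ≤ 210-120*d := by linarith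
    have : 0 ≤ 45-10*d := by linarith
    have : 0 ≤ d^4*((210-252*d)+d^2*(210-120*d)+d^4*(45-10*d)+d^6) := by positivity
    linarith
  have hq : (61-98*x+41*x^2)/(1+x)^2 ≤ (b^2+2*b+2)/2 := by
    have h1 : 0 ≤ 10*(1-x)/(1+x) := div_nonneg (by linarith) (by linarith)
    have h2 : (61-98*x+41*x^2)/(1+x)^2
        = ((10*(1-x)/(1+x))^2 + 2*(10*(1-x)/(1+x)) + 2)/2 := by
      field_simp
      ring
    rw [h2]
    gcongr
  have hu : 0 ≤ 1 - X := by norm_num at hX5; linarith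
  have hmain : 1 - (61-98*x+41*x^2)/(1+x)^2 * X
      ≤ (1-X)^3*(1-10*(X/S)+45*(X/S)^2-120*(X/S)^3) := by
    have e : (1-X)^3*(1-10*(X/S)+45*(X/S)^2-120*(X/S)^3)
      - (1 - (61-98*x+41*x^2)/(1+x)^2 * X)
      = X*((61-98*x+41*x^2)*S^3 - (1+x)^2*((3-3*X+X^2)*S^3)
        - (1+x)^2*((1-X)^3*(10*S^2-45*(X*S)+120*X^2)))/((1+x)^2*S^3) := by
      field_simp
      ring
    have : 0 ≤ X*((61-98*x+41*x^2)*S^3 - (1+x)^2*((3-3*X+X^2)*S^3)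
        - (1+x)^2*((1-X)^3*(10*S^2-45*(X*S)+120*X^2)))/((1+x)^2*S^3) := by positivity
    linarith
  calc 1 - (b^2+2*b+2)/2*X ≤ 1 - (61-98*x+41*x^2)/(1+x)^2 * X := by gcongr
    _ ≤ _ := hmain
    _ ≤ _ := by gcongr

lemma deriv_ineq (b : ℝ) (hb : 0 < b) (hy : exp (b/4) ≤ 3/2) :
    0 ≤ 11*(exp (-b)/(1 - exp (-b))) - 10*(exp (-(5/4*b))/(1 - exp (-(5/4*b))))
      - (b^2/2*exp (-b))/(1 - (b^2+2*b+2)/2*exp (-b)) := by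
  have hL := L_pos b hb
  have h4 : exp (-b) = (exp (b/4)^4)⁻¹ := by
    rw [← exp_nat_mul, ← exp_neg]; congr 1; push_cast; ring
  have h5 : exp (-(5/4*b)) = (exp (b/4)^5)⁻¹ := by
    rw [← exp_nat_mul, ← exp_neg]; congr 1; push_cast; ring
  have hy1 : 1 < exp (b/4) := by rw [one_lt_exp_iff]; positivity
  have hlog := log_upper _ hy1.le
  rw [log_exp] at hlog
  obtain ⟨t, rfl⟩ : ∃ t, b = 4*t := ⟨b/4, by ring⟩
  have ht : 0 < t := by linarith
  rw [h4] at hL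
  rw [h4, h5]
  rw [show 4*t/4 = t by ring] at *
  generalize exp t = y at *
  clear h4 h5
  have y0 : 0 < y := by linarith
  have y4 : 0 < y^4 - 1 := by have := one_lt_pow₀ hy1 (n := 4) (by norm_num); linarith
  have y5 : 0 < y^5 - 1 := by have := one_lt_pow₀ hy1 (n := 5) (by norm_num); linarith
  have eL : 1 - ((4*t)^2+2*(4*t)+2)/2*(y^4)⁻¹ = (y^4-1-4*t-8*t^2)/y^4 := by
    field_simp
    ring
  rw [eL] at hL ⊢
  have hM : 0 < y^4-1-4*t-8*t^2 := by
    have := (div_pos_iff_of_pos_right (pow_pos y0 4)).1 hL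
    exact this
  have hN : 0 < 11*y^4+y^3+y^2+y+1 := by positivity
  have hS : 0 < 1+y+y^2+y^3+y^4 := by positivity
  have key : 0 ≤ (11*y^4+y^3+y^2+y+1)*(y^4-1) - 4*(11*y^4+y^3+y^2+y+1)*t
      - 8*t^2*((11*y^4+y^3+y^2+y+1)+(y^4-1)*(1+y+y^2+y^3+y^4)) := by
    have hmono : (11*y^4+y^3+y^2+y+1)*(y^4-1) - 4*(11*y^4+y^3+y^2+y+1)*((y-1)*(y+5)/(4*y+2))
      - 8*((y-1)*(y+5)/(4*y+2))^2*((11*y^4+y^3+y^2+y+1)+(y^4-1)*(1+y+y^2+y^3+y^4))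
      ≤ (11*y^4+y^3+y^2+y+1)*(y^4-1) - 4*(11*y^4+y^3+y^2+y+1)*t
      - 8*t^2*((11*y^4+y^3+y^2+y+1)+(y^4-1)*(1+y+y^2+y^3+y^4)) := by gcongr
    refine le_trans ?_ hmono
    have hp := poly_one (y-1) (by linarith) (by linarith)
    have e : (11*y^4+y^3+y^2+y+1)*(y^4-1) - 4*(11*y^4+y^3+y^2+y+1)*((y-1)*(y+5)/(4*y+2))
      - 8*((y-1)*(y+5)/(4*y+2))^2*((11*y^4+y^3+y^2+y+1)+(y^4-1)*(1+y+y^2+y^3+y^4))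
      = (y-1)^4*(1860+2920*(y-1)-2840*(y-1)^2-10068*(y-1)^3-9796*(y-1)^4-4768*(y-1)^5
        -1264*(y-1)^6-168*(y-1)^7-8*(y-1)^8)/(4*y+2)^2 := by
      field_simp
      ring
    rw [e]
    positivity
  have e4 : (y^4)⁻¹/(1-(y^4)⁻¹) = 1/(y^4-1) := by
    have : 1 - (y^4)⁻¹ = (y^4-1)/y^4 := by field_simp
    rw [this]; field_simp
  have e5 : (y^5)⁻¹/(1-(y^5)⁻¹) = 1/(y^5-1) := by
    have : 1 - (y^5)⁻¹ = (y^5-1)/y^5 := by field_simp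
    rw [this]; field_simp
  have eM : ((4*t)^2/2*(y^4)⁻¹)/((y^4-1-4*t-8*t^2)/y^4) = 8*t^2/(y^4-1-4*t-8*t^2) := by
    field_simp
    ring
  rw [e4, e5, eM]
  have e6 : 11*(1/(y^4-1)) - 10*(1/(y^5-1))
      = (11*y^4+y^3+y^2+y+1)/((y^4-1)*(1+y+y^2+y^3+y^4)) := by
    have : y^5-1 = (y-1)*(1+y+y^2+y^3+y^4) := by ring
    rw [this]
    have : y - 1 ≠ 0 := by linarith
    field_simp
    ring
  rw [e6, sub_nonneg, div_le_div_iff₀ hM (by positivity)]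
  linarith

lemma one_sub_exp_pos {c : ℝ} (hc : 0 < c) : 0 < 1 - exp (-c) := by
  have : exp (-c) < 1 := by rw [exp_lt_one_iff]; linarith
  linarith

/-- The logarithmic gap for exponent `5/4`. -/
noncomputable def Hgap (b : ℝ) : ℝ :=
  11*log (1 - exp (-b)) - 8*log (1 - exp (-(5/4*b))) - log (1 - (b^2+2*b+2)/2*exp (-b))

lemma Hgap_deriv (b : ℝ) (hb : 0 < b) : HasDerivAt Hgap
    (11*(exp (-b)/(1 - exp (-b))) - 10*(exp (-(5/4*b))/(1 - exp (-(5/4*b))))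
      - (b^2/2*exp (-b))/(1 - (b^2+2*b+2)/2*exp (-b))) b := by
  have h1 := (one_sub_exp_pos hb).ne'
  have h2 := (one_sub_exp_pos (c := 5/4*b) (by positivity)).ne'
  have h3 := (L_pos b hb).ne'
  have d1 : HasDerivAt (fun b : ℝ => exp (-b)) (exp (-b) * (-1)) b := (hasDerivAt_neg b).exp
  have d2 : HasDerivAt (fun b : ℝ => exp (-(5/4*b))) (exp (-(5/4*b)) * (-(5/4*1))) b :=
    ((hasDerivAt_id' b).const_mul (5/4)).neg.exp
  have d3 : HasDerivAt (fun b : ℝ => (b^2+2*b+2)/2) (b+1) b := by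
    have := ((((hasDerivAt_id' b).pow 2).add ((hasDerivAt_id' b).const_mul 2)).add_const 2).div_const 2
    refine this.congr_deriv ?_
    norm_num
    ring
  have := ((((d1.const_sub 1).log h1).const_mul 11).sub
    (((d2.const_sub 1).log h2).const_mul 8)).sub (((d3.mul d1).const_sub 1).log h3)
  refine this.congr_deriv ?_
  simp only [Pi.mul_apply]
  ring

lemma Hgap_mono {a b : ℝ} (ha : 0 < a) (hab : a ≤ b) (hy : exp (b/4) ≤ 3/2) :
    Hgap a ≤ Hgap b := by
  have hm : MonotoneOn Hgap (Set.Icc a b) := by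
    refine monotoneOn_of_deriv_nonneg (convex_Icc a b)
      (fun z hz => (Hgap_deriv z (ha.trans_le hz.1)).continuousAt.continuousWithinAt) ?_ ?_
    · intro z hz
      rw [interior_Icc] at hz
      exact (Hgap_deriv z (ha.trans hz.1)).differentiableAt.differentiableWithinAt
    · intro z hz
      rw [interior_Icc] at hz
      rw [(Hgap_deriv z (ha.trans hz.1)).deriv]
      apply deriv_ineq z (ha.trans hz.1)
      refine le_trans ?_ hy
      have := hz.2
      gcongr
  exact hm ⟨le_rfl, hab⟩ ⟨hab, le_rfl⟩ hab

lemma Hgap_lower (a : ℝ) (ha : 0 < a) (ha1 : a ≤ 1/2) :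
    log 6 - 8*log (5/4) + (3*log (1-a/2) - log (1+a)) ≤ Hgap a := by
  have hu := one_sub_exp_pos ha
  have hA := one_sub_exp_pos (c := 5/4*a) (by positivity)
  have hL := L_pos a ha
  have h1 : log (1 - exp (-(5/4*a))) ≤ log (5/4) + log (1 - exp (-a)) := by
    rw [← log_mul (by norm_num) hu.ne']
    apply log_le_log hA
    have h4 : exp (-a) = exp (-a/4)^4 := by rw [← exp_nat_mul]; congr 1; push_cast; ring
    have h5 : exp (-(5/4*a)) = exp (-a/4)^5 := by rw [← exp_nat_mul]; congr 1; push_cast; ring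
    rw [h4, h5]
    have z0 := exp_pos (-a/4)
    generalize exp (-a/4) = z at *
    have : 0 ≤ (1-z)^2*(1+2*z+3*z^2+4*z^3) := by positivity
    nlinarith
  have h2 : log (1 - (a^2+2*a+2)/2*exp (-a)) ≤ 3*log a - log 6 + log (1+a) := by
    have h := log_le_log hL (L_upper a ha ha1)
    rw [log_mul (by positivity) (by positivity), log_div (by positivity) (by norm_num),
      log_pow] at h
    push_cast at h
    exact h
  have h3 : log a + log (1-a/2) ≤ log (1 - exp (-a)) := by
    have p : 0 < 1 - a/2 := by linarith
    rw [← log_mul ha.ne' p.ne']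
    apply log_le_log (by positivity)
    have h := Real.quadratic_le_exp_of_nonneg ha.le
    have e : exp (-a) * exp a = 1 := by rw [← exp_add]; simp
    have e0 := exp_pos (-a)
    have h5 : exp (-a) * (1 + a + a^2/2) ≤ 1 := (mul_le_mul_of_nonneg_left h e0.le).trans e.le
    have h6 : exp (-a) * (1 + a + a^2/2) ≤ (1 - a*(1-a/2)) * (1 + a + a^2/2) := by
      nlinarith [sq_nonneg (a^2)]
    have := le_of_mul_le_mul_right h6 (by positivity)
    linarith
  unfold Hgap
  linarith

lemma region_one (b : ℝ) (hb : 0 < b) (hy : exp (b/4) ≤ 3/2) :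
    log 6 - 8*log (5/4) ≤ Hgap b := by
  have hc : ContinuousAt (fun a : ℝ => log 6 - 8*log (5/4) + (3*log (1-a/2) - log (1+a))) 0 := by
    have h1 : ContinuousAt (fun a : ℝ => log (1-a/2)) 0 :=
      ContinuousAt.log (by fun_prop) (by norm_num)
    have h2 : ContinuousAt (fun a : ℝ => log (1+a)) 0 :=
      ContinuousAt.log (by fun_prop) (by norm_num)
    fun_prop
  have ht := hc.tendsto.mono_left (nhdsWithin_le_nhds (s := Set.Ioi 0))
  simp only [zero_div, sub_zero, add_zero, log_one, mul_zero] at ht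
  refine le_of_tendsto ht ?_
  have hm : 0 < min b (1/2) := by positivity
  filter_upwards [Ioo_mem_nhdsGT hm] with a ha
  have h1 : a ≤ b := ha.2.le.trans (min_le_left _ _)
  have h2 : a ≤ 1/2 := ha.2.le.trans (min_le_right _ _)
  exact (Hgap_lower a ha.1 h2).trans (Hgap_mono ha.1 h1 hy)

lemma alpha_bounds (α : ℝ) (h1 : 1 < α)
    (h : (1 / (α - 1)) * log α = (1 / 2) * log 6) : 6/5 ≤ α ∧ α ≤ 5/4 := by
  have hc : StrictConcaveOn ℝ (Set.Ioi 0) log := strictConcaveOn_log_Ioi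
  have h' : log α / (α - 1) = (1/2)*log 6 := by rw [← h]; ring
  have hsec : ∀ x y : ℝ, 1 < x → x < y → log y / (y-1) < log x / (x-1) := by
    intro x y hx hxy
    have := hc.secant_strict_mono (a := 1) (x := x) (y := y) (by simp) (by simp; linarith)
      (by simp; linarith) hx.ne' (hx.trans hxy).ne' hxy
    simpa using this
  constructor
  · by_contra hlt
    push Not at hlt
    have := hsec _ _ h1 hlt
    rw [h'] at this
    have h10 : log 6 ≤ log ((6/5)^10) := log_le_log (by norm_num) (by norm_num)
    rw [log_pow] at h10
    norm_num at this h10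
    linarith
  · by_contra hlt
    push Not at hlt
    have := hsec _ _ (by norm_num) hlt
    rw [h'] at this
    have h10 : log ((5/4)^8) ≤ log 6 := log_le_log (by norm_num) (by norm_num)
    rw [log_pow] at h10
    norm_num at this h10
    linarith

/-- For `α*` the unique solution in `(1,∞)` of `(1/(α−1))·log α = ½·log 6` and every
`b ≥ 0`: `(1 − e^{−α*b})^{2/(1−α*)}·(1 − e^{−b})^{(1−3α*)/(1−α*)} ≥ 1 − ((b²+2b+2)/2)·e^{−b}`. -/
theorem G_at_zero_ineq
    (αs : ℝ) (hαs1 : 1 < αs)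
    (hαseq : (1 / (αs - 1)) * Real.log αs = (1 / 2) * Real.log 6)
    (b : ℝ) (hb : 0 ≤ b) :
    1 - (b ^ 2 + 2 * b + 2) / 2 * Real.exp (-b) ≤
      (1 - Real.exp (-(αs * b))) ^ (2 / (1 - αs)) *
        (1 - Real.exp (-b)) ^ ((1 - 3 * αs) / (1 - αs)) := by
  have hα0 : αs - 1 ≠ 0 := by linarith
  have hα0' : 1 - αs ≠ 0 := by linarith
  rcases hb.eq_or_lt with rfl | hb
  · simp only [mul_zero, neg_zero, exp_zero, sub_self]
    rw [zero_rpow (div_ne_zero (by norm_num) hα0')]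
    norm_num
  obtain ⟨hlo, hhi⟩ := alpha_bounds αs hαs1 hαseq
  have hu := one_sub_exp_pos hb
  have hA := one_sub_exp_pos (c := αs*b) (by positivity)
  have hL := L_pos b hb
  obtain ⟨hcc, hcv⟩ := concave_aux b hb
  rw [← log_le_log_iff hL (by positivity), log_mul (by positivity) (by positivity),
    log_rpow hA, log_rpow hu]
  have e : 2/(1-αs) * log (1 - exp (-(αs*b))) + (1-3*αs)/(1-αs) * log (1 - exp (-b))
      = 3*log (1 - exp (-b))
        - 2*((log (1 - exp (-(αs*b))) - log (1 - exp (-b)))/(αs-1)) := by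
    rw [show αs - 1 = -(1-αs) by ring]
    field_simp
    ring
  rw [e]
  by_cases hy : exp (b/4) ≤ 3/2
  · have h1 := region_one b hb hy
    have h2 := hcv.secant_mono (a := 1) (x := αs) (y := 5/4) (by simp) (by simp; linarith)
      (by norm_num) hαs1.ne' (by norm_num) hhi
    have h3 : log αs / (αs - 1) = (1/2)*log 6 := by rw [← hαseq]; ring
    simp only [one_mul, log_one, sub_zero] at h2
    rw [show log (1 - exp (-(αs*b))) - log αs - log (1 - exp (-b))
      = (log (1 - exp (-(αs*b))) - log (1 - exp (-b))) - log αs by ring, sub_div, h3] at h2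
    unfold Hgap at h1
    norm_num at h2
    linarith
  · push Not at hy
    have hx : exp (-b/5) ≤ 3/4 := by
      by_contra hlt
      push Not at hlt
      have a1 : (3/4:ℝ)^5 < exp (-b/5)^5 := by gcongr
      have a2 : (3/2:ℝ)^4 < exp (b/4)^4 := by gcongr
      have a3 : exp (-b/5)^5 * exp (b/4)^4 = 1 := by
        rw [← exp_nat_mul, ← exp_nat_mul, ← exp_add, ← exp_zero]; congr 1; push_cast; ring
      have : (3/4:ℝ)^5 * (3/2:ℝ)^4 < exp (-b/5)^5 * exp (b/4)^4 := by gcongr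
      rw [a3] at this
      norm_num at this
    have hA6 := one_sub_exp_pos (c := 6/5*b) (by positivity)
    have h1 := log_le_log hL (region_two b hb hx)
    rw [log_mul (by positivity) (by positivity), log_pow, log_pow,
      log_div hu.ne' hA6.ne'] at h1
    have h2 := hcc.neg.secant_mono (a := 1) (x := 6/5) (y := αs) (by simp) (by norm_num)
      (by simp; linarith) (by norm_num) hαs1.ne' hlo
    simp only [one_mul, Pi.neg_apply] at h2
    rw [show -log (1 - exp (-(αs*b))) - -log (1 - exp (-b))
      = -(log (1 - exp (-(αs*b))) - log (1 - exp (-b))) by ring, neg_div] at h2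
    norm_num at h1 h2
    linarith
end

section
/- Let α* be the unique solution in (1,∞) of (1/(α−1))·log α = (1/2)·log 6. Then for every b ≥ 0, ((1 − e^{−b})^{2α*/(α*−1)}·(1 − e^{−bα*})^{−(1+α*)/(α*−1)}/(α*−1))·[(3α*−1)(1 − e^{−bα*}) − 2α*(1 − e^{−b})] ≥ 1 − (b+1)·e^{−b}. -/
open Real

lemma aux_mono {p p' x : ℝ} (hp : 0 < p) (hpp : p ≤ p') (hx : 0 ≤ x) :
    (1 + x / p) ^ p ≤ (1 + x / p') ^ p' := by
  have hp' : 0 < p' := lt_of_lt_of_le hp hpp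
  have h0 : 0 ≤ x / p := by positivity
  have h := rpow_one_add_le_one_add_mul_self (s := x / p) (by linarith)
    (p := p / p') (by positivity) ((div_le_one hp').2 hpp)
  have h1 : p / p' * (x / p) = x / p' := by field_simp
  rw [h1] at h
  have h2 := Real.rpow_le_rpow (by positivity) h hp'.le
  rw [← Real.rpow_mul (by positivity)] at h2
  have h3 : p / p' * p' = p := div_mul_cancel₀ _ hp'.ne'
  rw [h3] at h2
  exact h2

/-- Quasi-concavity of the profile. -/
lemma aux_quasi {p r ρ c : ℝ} (hp : 0 < p) (hρ : 0 < ρ) (hρr : ρ ≤ r) (hr : r ≤ 1)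
    (hc0 : 0 < c) (hc : c ≤ 1) (hF : c ≤ ρ ^ p * (p + 3 - (p + 2) * ρ)) :
    c ≤ r ^ p * (p + 3 - (p + 2) * r) := by
  rcases eq_or_lt_of_le (hρr.trans hr) with h1 | h1
  · have : r = ρ := by linarith
    rw [this]; exact hF
  set t := (r - ρ) / (1 - ρ) with ht
  have hd : 0 < 1 - ρ := by linarith
  have ht0 : 0 ≤ t := div_nonneg (by linarith) hd.le
  have ht1 : t ≤ 1 := (div_le_one hd).2 (by linarith)
  have hrt : r = (1 - t) * ρ + t * 1 := by rw [ht]; field_simp; ring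
  have hA : 0 < p + 3 - (p + 2) * ρ := by nlinarith
  have e1 := Real.geom_mean_le_arith_mean2_weighted (by linarith : 0 ≤ 1 - t) ht0 hρ.le
    zero_le_one (by ring)
  have e2 := Real.geom_mean_le_arith_mean2_weighted (by linarith : 0 ≤ 1 - t) ht0 hA.le
    zero_le_one (by ring)
  rw [Real.one_rpow, mul_one] at e1 e2
  rw [← hrt] at e1
  have e3 : (1 - t) * (p + 3 - (p + 2) * ρ) + t * 1 = p + 3 - (p + 2) * r := by
    rw [hrt]; ring
  rw [e3] at e2
  have e4 : (ρ ^ (1 - t)) ^ p ≤ r ^ p := Real.rpow_le_rpow (by positivity) e1 hp.le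
  have e5 : (ρ ^ (1 - t)) ^ p = (ρ ^ p) ^ (1 - t) := by
    rw [← Real.rpow_mul hρ.le, ← Real.rpow_mul hρ.le, mul_comm]
  rw [e5] at e4
  have hr0 : 0 < r := by linarith
  calc c = c ^ (1 : ℝ) := (Real.rpow_one c).symm
    _ ≤ c ^ (1 - t) := Real.rpow_le_rpow_of_exponent_ge hc0 hc (by linarith)
    _ ≤ (ρ ^ p * (p + 3 - (p + 2) * ρ)) ^ (1 - t) := Real.rpow_le_rpow hc0.le hF (by linarith)
    _ = (ρ ^ p) ^ (1 - t) * (p + 3 - (p + 2) * ρ) ^ (1 - t) :=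
        Real.mul_rpow (by positivity) hA.le
    _ ≤ _ := mul_le_mul e4 e2 (by positivity) (by positivity)

lemma aux_anti : AntitoneOn (fun t : ℝ => (1 - exp (-t)) * (1 + 2 / t)) (Set.Ioi 0) := by
  have hder : ∀ t ∈ Set.Ioi (0:ℝ), HasDerivAt (fun t : ℝ => (1 - exp (-t)) * (1 + 2 / t))
      (exp (-t) * (1 + 2 / t) + (1 - exp (-t)) * (-2 / t ^ 2)) t := by
    intro t ht
    have ht' : t ≠ 0 := ne_of_gt ht
    have h1 : HasDerivAt (fun t : ℝ => 1 - exp (-t)) (exp (-t)) t := by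
      have := ((hasDerivAt_neg t).exp).const_sub 1
      exact this.congr_deriv (by ring)
    have h2 : HasDerivAt (fun t : ℝ => 1 + 2 / t) (-2 / t ^ 2) t := by
      have := ((hasDerivAt_inv ht').const_mul 2).const_add 1
      exact this.congr_deriv (by field_simp)
    exact h1.mul h2
  apply antitoneOn_of_deriv_nonpos (convex_Ioi 0)
  · exact fun t ht => (hder t ht).continuousAt.continuousWithinAt
  · intro t ht; rw [interior_Ioi] at ht
    exact (hder t ht).differentiableAt.differentiableWithinAt
  · intro t ht; rw [interior_Ioi] at ht
    rw [(hder t ht).deriv]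
    have ht0 : 0 < t := ht
    have hq := Real.quadratic_le_exp_of_nonneg ht0.le
    have he : exp (-t) * exp t = 1 := by rw [← Real.exp_add]; simp
    have hpos := Real.exp_pos (-t)
    have : exp (-t) * (1 + 2 / t) + (1 - exp (-t)) * (-2 / t ^ 2)
        = (exp (-t) * (t ^ 2 + 2 * t + 2) - 2) / t ^ 2 := by field_simp; ring
    rw [this]
    apply div_nonpos_of_nonpos_of_nonneg _ (by positivity)
    nlinarith

lemma aux_psi {b b1 c : ℝ} (hb : 2 ≤ b) (hbb : b ≤ b1) (hc0 : 0 < c) (hc : c ≤ 1)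
    (h : 1 - (b1 + 1) * exp (-b1) ≤ c * (1 - exp (-b1)) ^ 2) :
    1 - (b + 1) * exp (-b) ≤ c * (1 - exp (-b)) ^ 2 := by
  have hder : ∀ t : ℝ, HasDerivAt
      (fun t : ℝ => c * (1 - exp (-t)) ^ 2 - (1 - (t + 1) * exp (-t)))
      (exp (-t) * (2 * c * (1 - exp (-t)) - t)) t := by
    intro t
    have h0 : HasDerivAt (fun t : ℝ => exp (-t)) (-exp (-t)) t := by
      have := ((hasDerivAt_neg t).exp)
      exact this.congr_deriv (by ring)
    have h1 := ((h0.const_sub 1).pow 2).const_mul c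
    have h2 := ((((hasDerivAt_id t).add_const 1).mul h0)).const_sub 1
    exact (h1.sub h2).congr_deriv (by simp; ring)
  have hanti : AntitoneOn (fun t : ℝ => c * (1 - exp (-t)) ^ 2 - (1 - (t + 1) * exp (-t)))
      (Set.Ici 2) := by
    apply antitoneOn_of_deriv_nonpos (convex_Ici 2)
    · exact fun t ht => (hder t).continuousAt.continuousWithinAt
    · intro t ht
      exact (hder t).differentiableAt.differentiableWithinAt
    · intro t ht; rw [interior_Ici] at ht
      have ht2 : 2 < t := ht
      rw [(hder t).deriv]
      have := Real.exp_pos (-t)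
      apply mul_nonpos_of_nonneg_of_nonpos this.le
      nlinarith
  have := hanti (Set.mem_Ici.2 hb) (Set.mem_Ici.2 (hb.trans hbb)) hbb
  simp only at this
  linarith

lemma aux_small {b : ℝ} (hb : 0 ≤ b) :
    1 - (b + 1) * exp (-b) ≤ (1 / 2 + b / 6) * (1 - exp (-b)) ^ 2 := by
  have d2 : ∀ t : ℝ, HasDerivAt (fun t : ℝ => t * cosh t - sinh t) (t * sinh t) t := by
    intro t
    have := ((hasDerivAt_id t).mul (Real.hasDerivAt_cosh t)).sub (Real.hasDerivAt_sinh t)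
    exact this.congr_deriv (by simp)
  have m2 : MonotoneOn (fun t : ℝ => t * cosh t - sinh t) (Set.Ici 0) := by
    apply monotoneOn_of_deriv_nonneg (convex_Ici 0)
    · exact fun t ht => (d2 t).continuousAt.continuousWithinAt
    · exact fun t ht => (d2 t).differentiableAt.differentiableWithinAt
    · intro t ht; rw [interior_Ici] at ht
      rw [(d2 t).deriv]
      exact mul_nonneg (le_of_lt ht) (Real.sinh_nonneg_iff.2 (le_of_lt ht))
  have p2 : ∀ t : ℝ, 0 ≤ t → 0 ≤ t * cosh t - sinh t := by
    intro t ht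
    have := m2 (Set.mem_Ici.2 le_rfl) (Set.mem_Ici.2 ht) ht
    simpa using this
  have d1 : ∀ t : ℝ, HasDerivAt (fun t : ℝ => t * sinh t + 2 - 2 * cosh t)
      (t * cosh t - sinh t) t := by
    intro t
    have := (((hasDerivAt_id t).mul (Real.hasDerivAt_sinh t)).add_const 2).sub
      ((Real.hasDerivAt_cosh t).const_mul 2)
    exact this.congr_deriv (by simp; ring)
  have m1 : MonotoneOn (fun t : ℝ => t * sinh t + 2 - 2 * cosh t) (Set.Ici 0) := by
    apply monotoneOn_of_deriv_nonneg (convex_Ici 0)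
    · exact fun t ht => (d1 t).continuousAt.continuousWithinAt
    · exact fun t ht => (d1 t).differentiableAt.differentiableWithinAt
    · intro t ht; rw [interior_Ici] at ht
      rw [(d1 t).deriv]
      exact p2 t (le_of_lt ht)
  have p1 : ∀ t : ℝ, 0 ≤ t → 0 ≤ t * sinh t + 2 - 2 * cosh t := by
    intro t ht
    have := m1 (Set.mem_Ici.2 le_rfl) (Set.mem_Ici.2 ht) ht
    simpa using this
  have d0 : ∀ t : ℝ, HasDerivAt (fun t : ℝ => t * cosh t + 2 * t - 3 * sinh t)
      (t * sinh t + 2 - 2 * cosh t) t := by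
    intro t
    have := (((hasDerivAt_id t).mul (Real.hasDerivAt_cosh t)).add
      ((hasDerivAt_id t).const_mul 2)).sub ((Real.hasDerivAt_sinh t).const_mul 3)
    exact this.congr_deriv (by simp; ring)
  have m0 : MonotoneOn (fun t : ℝ => t * cosh t + 2 * t - 3 * sinh t) (Set.Ici 0) := by
    apply monotoneOn_of_deriv_nonneg (convex_Ici 0)
    · exact fun t ht => (d0 t).continuousAt.continuousWithinAt
    · exact fun t ht => (d0 t).differentiableAt.differentiableWithinAt
    · intro t ht; rw [interior_Ici] at ht
      rw [(d0 t).deriv]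
      exact p1 t (le_of_lt ht)
  have p0 : 0 ≤ b * cosh b + 2 * b - 3 * sinh b := by
    have := m0 (Set.mem_Ici.2 le_rfl) (Set.mem_Ici.2 hb) hb
    simpa using this
  rw [Real.cosh_eq, Real.sinh_eq] at p0
  have he : exp (-b) * exp b = 1 := by rw [← Real.exp_add]; simp
  have hpos := Real.exp_pos (-b)
  have := mul_nonneg hpos.le p0
  have e : exp (-b) * (b * ((exp b + exp (-b)) / 2) + 2 * b - 3 * ((exp b - exp (-b)) / 2))
     = (exp (-b) * exp b) * (b - 3) / 2 + exp (-b) ^ 2 * (b + 3) / 2 + 2 * b * exp (-b) := by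
    ring
  rw [e, he] at this
  nlinarith

lemma aux_exp {B l : ℝ} (m n : ℕ) (hn : n ≠ 0) (hB : B * n = m) (hl : 0 ≤ l)
    (h : l ^ n ≤ (0.367879 : ℝ) ^ m) : l ≤ exp (-B) := by
  have h1 : (0.367879 : ℝ) ≤ exp (-1) := by
    rw [Real.exp_neg, le_inv_comm₀ (by norm_num) (Real.exp_pos _)]
    have := Real.exp_one_lt_d9
    norm_num at *
    linarith
  have h2 : exp (-B) ^ n = exp (-1) ^ m := by
    rw [← Real.exp_nat_mul, ← Real.exp_nat_mul]
    congr 1; linarith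
  apply le_of_pow_le_pow_left₀ hn (Real.exp_pos _).le
  rw [h2]
  exact h.trans (by gcongr)

lemma aux_num {B c l : ℝ} (hB : 2 ≤ B) (hl0 : 0 ≤ l) (hc0 : 0 < c) (hc : c ≤ 1) (hl : l ≤ exp (-B))
    (h : 1 - (B + 1) * l ≤ c * (1 - l) ^ 2) :
    1 - (B + 1) * exp (-B) ≤ c * (1 - exp (-B)) ^ 2 := by
  have h1 : exp (-B) ≤ 1 := Real.exp_le_one_iff.2 (by linarith)
  have h2 := Real.exp_pos (-B)
  have hk : 0 ≤ (B + 1) - c * (2 - exp (-B) - l) := by nlinarith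
  have hld : (0:ℝ) ≤ exp (-B) - l := by linarith
  nlinarith [mul_nonneg hld hk]

/-- main bound in terms of `p` and `r` -/
lemma aux_main {p α b r : ℝ} (hp8 : 8 ≤ p) (hp9 : p ≤ 9) (hα : α = 1 + 2 / p)
    (hαp : α ^ p = 6) (hb : 0 < b) (hr : r ≤ 1) (hr1 : 1 - exp (-b) ≤ r)
    (hr0 : ∀ d, 0 < d → d ≤ b → (d + 2 / α) / (d + 2) ≤ r) :
    1 - (b + 1) * exp (-b) ≤ (1 - exp (-b)) ^ 2 * (r ^ p * (p + 3 - (p + 2) * r)) := by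
  have hp0 : 0 < p := by linarith
  have hα0 : 0 < α := by rw [hα]; positivity
  -- value at ρ
  have key : ∀ d c : ℝ, 0 < d → d ≤ b → 0 < c → c ≤ 1 →
      c ≤ (1 + (2 * d / (d + 2)) / 8) ^ 8 * (3 - 2 * (d / (d + 2))) / 6 →
      c ≤ r ^ p * (p + 3 - (p + 2) * r) := by
    intro d c hd hdb hc0 hc h
    have hρ : 0 < (d + 2 / α) / (d + 2) := by positivity
    apply aux_quasi hp0 hρ (hr0 d hd hdb) hr hc0 hc
    refine h.trans ?_
    have e1 : (d + 2 / α) / (d + 2) = (1 + (2 * d / (d + 2)) / p) / α := by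
      rw [hα]; field_simp; ring
    have e2 : (p + 3 - (p + 2) * ((d + 2 / α) / (d + 2))) = 3 - 2 * (d / (d + 2)) := by
      rw [hα]; field_simp; ring
    rw [e2, e1, Real.div_rpow (by positivity) hα0.le, hαp]
    have h3 := aux_mono (p := 8) (p' := p) (x := 2 * d / (d + 2)) (by norm_num) hp8 (by positivity)
    have h4 : 0 ≤ 3 - 2 * (d / (d + 2)) := by
      have : d / (d + 2) ≤ 1 := (div_le_one (by linarith)).2 (by linarith)
      linarith
    have h5 : (1 + 2 * d / (d + 2) / 8) ^ (8:ℝ) = (1 + 2 * d / (d + 2) / 8) ^ (8:ℕ) := by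
      exact_mod_cast Real.rpow_natCast (1 + 2 * d / (d + 2) / 8) 8
    rw [h5] at h3
    have := mul_le_mul_of_nonneg_right h3 h4
    linarith
  have hx2 := sq_nonneg (1 - exp (-b))
  have fin : ∀ c : ℝ, 1 - (b + 1) * exp (-b) ≤ c * (1 - exp (-b)) ^ 2 →
      c ≤ r ^ p * (p + 3 - (p + 2) * r) →
      1 - (b + 1) * exp (-b) ≤ (1 - exp (-b)) ^ 2 * (r ^ p * (p + 3 - (p + 2) * r)) := by
    intro c h1 h2
    have := mul_le_mul_of_nonneg_right h2 hx2
    linarith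
  rcases le_or_gt b 2 with h2 | h2
  · apply fin (1 / 2 + b / 6) (aux_small hb.le)
    apply key b _ hb le_rfl (by positivity) (by linarith)
    set y := b / (b + 2) with hy
    have hy0 : 0 ≤ y := by positivity
    have hy1 : y ≤ 1 / 2 := by rw [hy, div_le_iff₀ (by linarith)]; linarith
    have eb : b = 2 * y / (1 - y) := by
      rw [hy]; field_simp; ring
    have e1 : 2 * b / (b + 2) = 2 * y := by rw [hy]; ring
    rw [e1]
    have e2 : 1 / 2 + b / 6 = (3 - y) / (6 * (1 - y)) := by
      have : 1 - y ≠ 0 := by linarith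
      rw [eb]; field_simp; ring
    rw [e2, div_le_iff₀ (by linarith)]
    have e3 : 1 + 2 * y + 7 / 4 * y ^ 2 + 7 / 8 * y ^ 3 ≤ (1 + 2 * y / 8) ^ 8 := by
      have : (1 + 2 * y / 8) ^ 8 = 1 + 2 * y + 7 / 4 * y ^ 2 + 7 / 8 * y ^ 3
        + (70 / 256 * y ^ 4 + 56 / 1024 * y ^ 5 + 28 / 4096 * y ^ 6 + 8 / 16384 * y ^ 7
          + 1 / 65536 * y ^ 8) := by ring
      rw [this]
      have : 0 ≤ (70 / 256 * y ^ 4 + 56 / 1024 * y ^ 5 + 28 / 4096 * y ^ 6 + 8 / 16384 * y ^ 7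
          + 1 / 65536 * y ^ 8) := by positivity
      linarith
    have e4 : 0 ≤ (3 - 2 * y) * (1 - y) := mul_nonneg (by linarith) (by linarith)
    have e5 := mul_le_mul_of_nonneg_right e3 e4
    have e6 : 3 - y ≤ (1 + 2 * y + 7 / 4 * y ^ 2 + 7 / 8 * y ^ 3) * ((3 - 2 * y) * (1 - y)) := by
      have y2 : y ^ 2 ≤ y * (1/2) := by nlinarith
      have y3 : y ^ 3 ≤ y * (1/4) := by nlinarith
      have y4 : y ^ 4 ≤ y * (1/8) := by nlinarith [mul_nonneg hy0 (sq_nonneg y)]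
      have y5 : 0 ≤ y ^ 5 := by positivity
      nlinarith
    linarith
  have piece : ∀ d B c l : ℝ, 2 ≤ d → d ≤ b → b ≤ B → 0 < c → c ≤ 1 → 0 ≤ l → l ≤ exp (-B) →
      1 - (B + 1) * l ≤ c * (1 - l) ^ 2 →
      c ≤ (1 + (2 * d / (d + 2)) / 8) ^ 8 * (3 - 2 * (d / (d + 2))) / 6 →
      1 - (b + 1) * exp (-b) ≤ (1 - exp (-b)) ^ 2 * (r ^ p * (p + 3 - (p + 2) * r)) := by
    intro d B c l hd hdb hbB hc0 hc hl0 hl h1 h2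
    exact fin c (aux_psi (by linarith) hbB hc0 hc (aux_num (by linarith) hl0 hc0 hc hl h1))
      (key d c (by linarith) hdb hc0 hc h2)
  rcases le_or_gt b (5/2) with h3 | h3
  · exact piece 2 (5/2) 0.85 0.082 (by norm_num) h2.le h3 (by norm_num) (by norm_num)
      (by norm_num) (aux_exp 5 2 (by norm_num) (by norm_num) (by norm_num) (by norm_num))
      (by norm_num) (by norm_num)
  rcases le_or_gt b 3 with h4 | h4
  · exact piece (5/2) 3 0.889 0.0497 (by norm_num) h3.le h4 (by norm_num) (by norm_num)
      (by norm_num) (aux_exp 3 1 (by norm_num) (by norm_num) (by norm_num) (by norm_num))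
      (by norm_num) (by norm_num)
  rcases le_or_gt b (17/5) with h5 | h5
  · exact piece 3 (17/5) 0.915 0.0333 (by norm_num) h4.le h5 (by norm_num) (by norm_num)
      (by norm_num) (aux_exp 17 5 (by norm_num) (by norm_num) (by norm_num) (by norm_num))
      (by norm_num) (by norm_num)
  rcases le_or_gt b (37/10) with h6 | h6
  · exact piece (17/5) (37/10) 0.932 0.0247 (by norm_num) h5.le h6 (by norm_num) (by norm_num)
      (by norm_num) (aux_exp 37 10 (by norm_num) (by norm_num) (by norm_num) (by norm_num))
      (by norm_num) (by norm_num)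
  rcases le_or_gt b 4 with h7 | h7
  · exact piece (37/10) 4 0.9435 0.0183 (by norm_num) h6.le h7 (by norm_num) (by norm_num)
      (by norm_num) (aux_exp 4 1 (by norm_num) (by norm_num) (by norm_num) (by norm_num))
      (by norm_num) (by norm_num)
  -- large b
  apply fin 1
  · have := Real.add_one_le_exp (-b)
    have hpos := Real.exp_pos (-b)
    nlinarith
  · have hq : exp (-b) ≤ 0.02 := by
      have h8 : exp (-b) ≤ exp (-4) := Real.exp_le_exp.2 (by linarith)
      have h9 : exp (-4) ≤ 0.02 := by
        rw [Real.exp_neg, inv_le_comm₀ (Real.exp_pos _) (by norm_num)]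
        have h10 : exp 4 = exp 1 ^ 4 := by rw [← Real.exp_nat_mul]; norm_num
        have h11 := Real.exp_one_gt_d9
        have h12 : (2.7:ℝ) ^ 4 ≤ exp 1 ^ 4 := by gcongr; linarith
        rw [h10]
        norm_num at h12 ⊢
        linarith
      exact h8.trans h9
    apply aux_quasi hp0 (ρ := 0.98) (by norm_num) (by linarith) hr one_pos le_rfl
    have h13 : (0.98:ℝ) ^ (9:ℝ) ≤ 0.98 ^ p :=
      Real.rpow_le_rpow_of_exponent_ge (by norm_num) (by norm_num) hp9
    have h14 : (0.98:ℝ) ^ (9:ℝ) = 0.98 ^ (9:ℕ) := by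
      exact_mod_cast Real.rpow_natCast (0.98:ℝ) 9
    have h15 : (1.2:ℝ) ≤ p + 3 - (p + 2) * 0.98 := by linarith
    rw [h14] at h13
    have h16 := mul_le_mul h13 h15 (by norm_num) (by positivity)
    refine le_trans ?_ h16
    norm_num

/-- For `α*` the unique solution in `(1,∞)` of `(1/(α−1))·log α = ½·log 6` and every
`b ≥ 0`:
`((1 − e^{−b})^{2α*/(α*−1)}·(1 − e^{−bα*})^{−(1+α*)/(α*−1)}/(α*−1))
  ·[(3α*−1)(1 − e^{−bα*}) − 2α*(1 − e^{−b})] ≥ 1 − (b+1)·e^{−b}`. -/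
theorem deriv_G_at_zero_ineq
    (αs : ℝ) (hαs1 : 1 < αs)
    (hαseq : (1 / (αs - 1)) * Real.log αs = (1 / 2) * Real.log 6)
    (b : ℝ) (hb : 0 ≤ b) :
    1 - (b + 1) * Real.exp (-b) ≤
      (1 - Real.exp (-b)) ^ (2 * αs / (αs - 1)) *
        (1 - Real.exp (-(b * αs))) ^ (-(1 + αs) / (αs - 1)) / (αs - 1) *
        ((3 * αs - 1) * (1 - Real.exp (-(b * αs))) - 2 * αs * (1 - Real.exp (-b))) := by
  rcases eq_or_lt_of_le hb with h0 | hb0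
  · subst h0; simp
  have ha : 0 < αs - 1 := by linarith
  have hα0 : 0 < αs := by linarith
  obtain ⟨p, hp⟩ : ∃ p, p = 2 / (αs - 1) := ⟨_, rfl⟩
  have hp0 : 0 < p := by rw [hp]; positivity
  have hα : αs = 1 + 2 / p := by rw [hp]; field_simp; ring
  have hαp : αs ^ p = 6 := by
    rw [Real.rpow_def_of_pos hα0]
    have : Real.log αs * p = Real.log 6 := by
      have h : Real.log αs * p = 2 * ((1 / (αs - 1)) * Real.log αs) := by rw [hp]; ring
      rw [h, hαseq]; ring
    rw [this, Real.exp_log (by norm_num)]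
  have hp8 : 8 ≤ p := by
    by_contra hlt
    push Not at hlt
    have h := aux_mono (p := p) (p' := 8) (x := 2) hp0 hlt.le (by norm_num)
    rw [← hα, hαp] at h
    have h5 : (1 + 2 / 8 : ℝ) ^ (8:ℝ) = (1 + 2 / 8) ^ (8:ℕ) := by
      exact_mod_cast Real.rpow_natCast (1 + 2 / 8 : ℝ) 8
    rw [h5] at h
    norm_num at h
  have hp9 : p ≤ 9 := by
    by_contra hlt
    push Not at hlt
    have h := aux_mono (p := 9) (p' := p) (x := 2) (by norm_num) hlt.le (by norm_num)
    rw [← hα, hαp] at h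
    have h5 : (1 + 2 / 9 : ℝ) ^ (9:ℝ) = (1 + 2 / 9) ^ (9:ℕ) := by
      exact_mod_cast Real.rpow_natCast (1 + 2 / 9 : ℝ) 9
    rw [h5] at h
    norm_num at h
  have hbα : b ≤ b * αs := by nlinarith
  have hx : 0 < 1 - exp (-b) := by
    have : exp (-b) < 1 := by rw [Real.exp_lt_one_iff]; linarith
    linarith
  have hxy : 1 - exp (-b) ≤ 1 - exp (-(b * αs)) := by
    have : exp (-(b * αs)) ≤ exp (-b) := Real.exp_le_exp.2 (by linarith)
    linarith
  have hY1 : 1 - exp (-(b * αs)) ≤ 1 := by linarith [Real.exp_pos (-(b * αs))]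
  have hY : 0 < 1 - exp (-(b * αs)) := by linarith
  have hanti := aux_anti (Set.mem_Ioi.2 hb0) (Set.mem_Ioi.2 (by positivity : 0 < b * αs)) hbα
  simp only at hanti
  have main := aux_main (r := (1 - exp (-b)) / (1 - exp (-(b * αs)))) hp8 hp9 hα hαp hb0
    ((div_le_one hY).2 hxy) (by rw [le_div_iff₀ hY]; nlinarith) (by
      intro d hd hdb
      have s1 : (d + 2 / αs) / (d + 2) ≤ (b + 2 / αs) / (b + 2) := by
        have : 2 / αs ≤ 2 := by rw [div_le_iff₀ hα0]; linarith
        rw [div_le_div_iff₀ (by linarith) (by linarith)]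
        nlinarith
      refine s1.trans ?_
      rw [div_le_div_iff₀ (by linarith) hY]
      have e1 : (1 - exp (-(b * αs))) * (1 + 2 / (b * αs)) * b
          = (b + 2 / αs) * (1 - exp (-(b * αs))) := by field_simp
      have e2 : (1 - exp (-b)) * (1 + 2 / b) * b = (1 - exp (-b)) * (b + 2) := by field_simp
      rw [← e1, ← e2]
      exact mul_le_mul_of_nonneg_right hanti hb0.le)
  refine main.trans (le_of_eq ?_)
  generalize 1 - exp (-b) = x at *
  generalize 1 - exp (-(b * αs)) = Y at *
  have q1 : 2 * αs / (αs - 1) = p + 2 := by rw [hp]; field_simp; ring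
  have q2 : -(1 + αs) / (αs - 1) = -(p + 1) := by rw [hp]; field_simp; ring
  have q3 : p + 3 = (3 * αs - 1) / (αs - 1) := by rw [hp]; field_simp; ring
  have hxp : x ^ (p + 2) = x ^ p * x ^ 2 := by
    rw [Real.rpow_add hx]; norm_num
  have hyp : Y ^ (-(p + 1)) = (Y ^ p)⁻¹ * Y⁻¹ := by
    rw [Real.rpow_neg hY.le, Real.rpow_add hY, Real.rpow_one, mul_inv]
  rw [q1, q2, hxp, hyp, Real.div_rpow hx.le hY.le, q3, ← q1]
  have : Y ^ p ≠ 0 := (Real.rpow_pos_of_pos hY p).ne'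
  field_simp
end
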